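/- arXiv:2407.15521 — 7 statements merged into one kernel-verified Lean document; each statement's English description precedes it below -/
import Mathlib

section
/- Assume (H) and let g : ℝ^d → ℂ be a nonzero Schwartz function. Then there exists a constant C > 0 such that for every t > 0, sup_{ξ∈ℝ^d} ∫_{ℝ^d} |V_g F_{tμ}(x,ξ)| dx ≤ C · max{t^{-d/m}, t^{-2d/m}}. (Equivalently, the fundamental solution E(t,·) = F^{-1}(e^{2πitμ}) of the free equation (1/2πi)∂_t u = μ(D)u satisfies ‖E(t,·)‖_{W^{1,∞}} ≤ C max{t^{-2d/m}, t^{-d/m}} for all t > 0.) -/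
open MeasureTheory Real Complex
open scoped ENNReal RealInnerProductSpace

noncomputable section

set_option linter.unusedSectionVars false

section Homog

variable {E : Type} [NormedAddCommGroup E] [NormedSpace ℝ E]

lemma isOpen_ne_zero' : IsOpen {x : E | x ≠ 0} := isOpen_ne

lemma homog_fderiv {F : Type} [NormedAddCommGroup F] [NormedSpace ℝ F] (f : E → F) (s : ℝ)
    (hf : ContDiffOn ℝ (⊤ : ℕ∞) f {x | x ≠ 0})
    (hhom : ∀ c : ℝ, 0 < c → ∀ x : E, x ≠ 0 → f (c • x) = c ^ s • f x)
    (c : ℝ) (hc : 0 < c) (x : E) (hx : x ≠ 0) :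
    fderiv ℝ f (c • x) = c ^ (s - 1) • fderiv ℝ f x := by
  have h1 : fderiv ℝ (fun y => f (c • y)) x = c • fderiv ℝ f (c • x) := fderiv_comp_smul c
  have h2 : (fun y => f (c • y)) =ᶠ[nhds x] fun y => c ^ s • f y := by
    filter_upwards [isOpen_ne_zero'.mem_nhds hx] with y hy
    exact hhom c hc y hy
  have hd : DifferentiableAt ℝ f x :=
    (hf.contDiffAt (isOpen_ne_zero'.mem_nhds hx)).differentiableAt (by simp)
  rw [h2.fderiv_eq, fderiv_fun_const_smul hd] at h1
  rw [Real.rpow_sub_one hc.ne', div_eq_inv_mul, mul_smul, h1, smul_smul, inv_mul_cancel₀ hc.ne',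
    one_smul]

lemma contDiffOn_fderiv' {F : Type} [NormedAddCommGroup F] [NormedSpace ℝ F] (f : E → F)
    (hf : ContDiffOn ℝ (⊤ : ℕ∞) f {x | x ≠ 0}) :
    ContDiffOn ℝ (⊤ : ℕ∞) (fderiv ℝ f) {x | x ≠ 0} :=
  hf.fderiv_of_isOpen isOpen_ne_zero' (by simp)

lemma homog_bound [FiniteDimensional ℝ E] (k : ℕ) :
    ∀ {F : Type} [NormedAddCommGroup F] [NormedSpace ℝ F] (f : E → F) (s : ℝ)
    (_ : ContDiffOn ℝ (⊤ : ℕ∞) f {x | x ≠ 0})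
    (_ : ∀ c : ℝ, 0 < c → ∀ x : E, x ≠ 0 → f (c • x) = c ^ s • f x),
    ∃ C : ℝ, 0 ≤ C ∧ ∀ y : E, y ≠ 0 → ‖iteratedFDeriv ℝ k f y‖ ≤ C * ‖y‖ ^ (s - k) := by
  induction k with
  | zero =>
    intro F _ _ f s hf hhom
    have hcomp : IsCompact (Metric.sphere (0 : E) 1) := isCompact_sphere 0 1
    have hcont : ContinuousOn f (Metric.sphere (0 : E) 1) :=
      hf.continuousOn.mono (fun x hx => by
        rintro rfl; simp at hx)
    obtain ⟨C, hC⟩ := hcomp.exists_bound_of_continuousOn hcont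
    refine ⟨max C 0, le_max_right _ _, fun y hy => ?_⟩
    have hy' : 0 < ‖y‖ := norm_pos_iff.2 hy
    have hu : ‖y‖⁻¹ • y ∈ Metric.sphere (0 : E) 1 := by
      simp [norm_smul, hy'.ne']
    have hu0 : ‖y‖⁻¹ • y ≠ 0 := by simp [hy]
    have := hhom ‖y‖ hy' _ hu0
    rw [smul_smul, mul_inv_cancel₀ hy'.ne', one_smul] at this
    rw [norm_iteratedFDeriv_zero, this, norm_smul, Real.norm_of_nonneg (by positivity)]
    simp only [CharP.cast_eq_zero, sub_zero]
    rw [mul_comm]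
    gcongr
    exact (hC _ hu).trans (le_max_left _ _)
  | succ k ih =>
    intro F _ _ f s hf hhom
    obtain ⟨C, hC0, hC⟩ := ih (fderiv ℝ f) (s - 1) (contDiffOn_fderiv' f hf)
      (homog_fderiv f s hf hhom)
    refine ⟨C, hC0, fun y hy => ?_⟩
    rw [← norm_iteratedFDeriv_fderiv]
    have := hC y hy
    push_cast
    rwa [show s - ((k : ℝ) + 1) = s - 1 - k by ring]

end Homog

section Cone

variable {E : Type} [NormedAddCommGroup E] [NormedSpace ℝ E] [FiniteDimensional ℝ E]

lemma euler_ne_zero {F : Type} [NormedAddCommGroup F] [NormedSpace ℝ F] (f : E → F) (s : ℝ)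
    (hf : ContDiffOn ℝ (⊤ : ℕ∞) f {x | x ≠ 0})
    (hhom : ∀ c : ℝ, 0 < c → ∀ x : E, x ≠ 0 → f (c • x) = c ^ s • f x)
    (u : E) (hu : u ≠ 0) (hinj : Function.Injective (fderiv ℝ f u)) : f u ≠ 0 := by
  intro h0
  have hd : DifferentiableAt ℝ f u :=
    (hf.contDiffAt (isOpen_ne_zero'.mem_nhds hu)).differentiableAt (by simp)
  have h1 : HasDerivAt (fun c : ℝ => f (c • u)) (fderiv ℝ f u u) 1 := by
    have h2 : HasFDerivAt f (fderiv ℝ f u) ((1 : ℝ) • u) := by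
      simpa using hd.hasFDerivAt
    have h3 : HasDerivAt (fun c : ℝ => c • u) u 1 := by
      simpa using (hasDerivAt_id (1 : ℝ)).smul_const u
    exact h2.comp_hasDerivAt 1 h3
  have h4 : (fun c : ℝ => f (c • u)) =ᶠ[nhds 1] fun _ => 0 := by
    filter_upwards [lt_mem_nhds (show (0 : ℝ) < 1 by norm_num)] with c hc
    rw [hhom c hc u hu, h0, smul_zero]
  have h5 : fderiv ℝ f u u = 0 := by
    rw [← h1.deriv, h4.deriv_eq]; simp
  exact hu (hinj (by rw [h5, map_zero]))

lemma cone_normalized {F : Type} [NormedAddCommGroup F] [NormedSpace ℝ F] (f : E → F) (s : ℝ)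
    (hs : 1 ≤ s) (hf : ContDiffOn ℝ (⊤ : ℕ∞) f {x | x ≠ 0})
    (hhom : ∀ c : ℝ, 0 < c → ∀ x : E, x ≠ 0 → f (c • x) = c ^ s • f x)
    (u0 : E) (hu0 : ‖u0‖ = 1) (hinj : Function.Injective (fderiv ℝ f u0)) :
    ∃ δ > 0, ∃ c > 0, ∀ u v : E, ‖u‖ = 1 → ‖v‖ = 1 → ‖u - u0‖ < δ → ‖v - u0‖ < δ →
      ∀ r : ℝ, 0 < r → r ≤ 1 → c * ‖u - r • v‖ ≤ ‖f u - r ^ s • f v‖ := by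
  have hu0' : u0 ≠ 0 := by rintro rfl; simp at hu0
  have hne := euler_ne_zero f s hf hhom u0 hu0' hinj
  have hcd := hf.contDiffAt (isOpen_ne_zero'.mem_nhds hu0')
  obtain ⟨K, hK0, hK⟩ := (fderiv ℝ f u0).toLinearMap.exists_antilipschitzWith
    (LinearMap.ker_eq_bot.2 hinj)
  have hκ : ∀ h : E, (K : ℝ)⁻¹ * ‖h‖ ≤ ‖fderiv ℝ f u0 h‖ := by
    intro h
    have := hK.le_mul_dist h 0
    simp only [dist_zero_right, map_zero] at this
    rw [inv_mul_le_iff₀ (by exact_mod_cast hK0)]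
    exact this
  set κ : ℝ := (K : ℝ)⁻¹ with hκdef
  have hκ0 : 0 < κ := by rw [hκdef]; positivity
  have hst : HasStrictFDerivAt f (fderiv ℝ f u0) u0 := hcd.hasStrictFDerivAt (by simp)
  have hlo := hst.isLittleO.bound (show 0 < κ / 2 by positivity)
  rw [nhds_prod_eq] at hlo
  obtain ⟨t, ht, htt⟩ := Filter.eventually_prod_self_iff'.1 hlo
  obtain ⟨ε0, hε0, hball⟩ := Metric.mem_nhds_iff.1 ht
  set ε := min ε0 1 with hε
  have hεp : 0 < ε := by positivity
  have hε1 : ε ≤ 1 := min_le_right _ _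
  have hB : 0 < ‖f u0‖ := norm_pos_iff.2 hne
  set B := ‖f u0‖ with hBdef
  have hcont := Metric.continuousAt_iff.1 hcd.continuousAt (ε * B / 8) (by positivity)
  obtain ⟨δ0, hδ0, hδ⟩ := hcont
  refine ⟨min δ0 (ε / 2), by positivity, min (κ / 2) (ε * B / 8), by positivity, ?_⟩
  intro u v hu hv huu hvv r hr0 hr1
  have hud : ‖u - u0‖ < ε / 2 := huu.trans_le (min_le_right _ _)
  have hvd : ‖v - u0‖ < ε / 2 := hvv.trans_le (min_le_right _ _)
  have hfu : ‖f u - f u0‖ < ε * B / 8 := by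
    have := hδ (x := u) (by rw [dist_eq_norm]; exact huu.trans_le (min_le_left _ _))
    rwa [dist_eq_norm] at this
  have hfv : ‖f v - f u0‖ < ε * B / 8 := by
    have := hδ (x := v) (by rw [dist_eq_norm]; exact hvv.trans_le (min_le_left _ _))
    rwa [dist_eq_norm] at this
  have hv0 : v ≠ 0 := by rintro rfl; simp at hv
  by_cases hr : 1 - ε / 2 ≤ r
  · rw [← hhom r hr0 v hv0]
    have h1 : ‖r • v - u0‖ < ε := by
      have : r • v - u0 = (v - u0) - (1 - r) • v := by rw [sub_smul, one_smul]; abel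
      rw [this]
      calc _ ≤ ‖v - u0‖ + ‖(1 - r) • v‖ := norm_sub_le _ _
        _ = ‖v - u0‖ + (1 - r) := by
          rw [norm_smul, hv, Real.norm_of_nonneg (by linarith), mul_one]
        _ < ε := by linarith
    have hm1 : u ∈ t := hball (by
      rw [Metric.mem_ball, dist_eq_norm]; exact (by linarith : ‖u - u0‖ < ε).trans_le (min_le_left _ _))
    have hm2 : r • v ∈ t := hball (by
      rw [Metric.mem_ball, dist_eq_norm]; exact h1.trans_le (min_le_left _ _))
    have h2 := htt _ hm1 _ hm2
    simp only at h2
    have h3 := hκ (u - r • v)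
    have h4 : ‖fderiv ℝ f u0 (u - r • v)‖ ≤ ‖f u - f (r • v)‖ +
        ‖f u - f (r • v) - fderiv ℝ f u0 (u - r • v)‖ := by
      have := norm_sub_le (f u - f (r • v)) (f u - f (r • v) - fderiv ℝ f u0 (u - r • v))
      simpa using this
    calc _ ≤ κ / 2 * ‖u - r • v‖ := by gcongr; exact min_le_left _ _
      _ ≤ _ := by linarith
  · push Not at hr
    have h1 : r ^ s ≤ r := by
      calc r ^ s ≤ r ^ (1 : ℝ) := Real.rpow_le_rpow_of_exponent_ge hr0 hr1 hs
        _ = r := Real.rpow_one r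
    have h1' : 0 < r ^ s := by positivity
    have h2 : ‖u - r • v‖ ≤ 2 := by
      calc _ ≤ ‖u‖ + ‖r • v‖ := norm_sub_le _ _
        _ ≤ 2 := by rw [norm_smul, hu, hv, Real.norm_of_nonneg hr0.le]; linarith
    have h3 : f u0 - r ^ s • f u0 = (f u - r ^ s • f v) - (f u - f u0) + r ^ s • (f v - f u0) := by
      rw [smul_sub]; abel
    have h4 : ‖f u0 - r ^ s • f u0‖ = (1 - r ^ s) * B := by
      rw [show f u0 - r ^ s • f u0 = (1 - r ^ s) • f u0 by rw [sub_smul, one_smul], norm_smul,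
        Real.norm_of_nonneg (by linarith)]
    have h5 : ‖f u0 - r ^ s • f u0‖ ≤ ‖f u - r ^ s • f v‖ + ‖f u - f u0‖ + r ^ s * ‖f v - f u0‖ := by
      rw [h3]
      refine (norm_add_le _ _).trans ?_
      rw [norm_smul, Real.norm_of_nonneg h1'.le]
      gcongr
      exact norm_sub_le _ _
    have h6 : r ^ s * ‖f v - f u0‖ ≤ ε * B / 8 := by
      calc _ ≤ 1 * ‖f v - f u0‖ := by gcongr; linarith
        _ ≤ _ := by linarith
    have h7 : ε / 2 * B ≤ (1 - r ^ s) * B := by gcongr; linarith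
    calc _ ≤ ε * B / 8 * 2 := by gcongr; exact min_le_right _ _
      _ ≤ _ := by linarith

/-- the open cone of directions within `δ` of `u` -/
def coneAt (u : E) (δ : ℝ) : Set E := {x | x ≠ 0 ∧ ‖‖x‖⁻¹ • x - u‖ < δ}

lemma cone_local {F : Type} [NormedAddCommGroup F] [NormedSpace ℝ F] (f : E → F) (s : ℝ)
    (hs : 1 ≤ s) (hf : ContDiffOn ℝ (⊤ : ℕ∞) f {x | x ≠ 0})
    (hhom : ∀ c : ℝ, 0 < c → ∀ x : E, x ≠ 0 → f (c • x) = c ^ s • f x)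
    (u0 : E) (hu0 : ‖u0‖ = 1) (hinj : Function.Injective (fderiv ℝ f u0)) :
    ∃ δ > 0, ∃ c > 0, ∀ x ∈ coneAt u0 δ, ∀ x' ∈ coneAt u0 δ,
      c * ‖x‖ ^ (s - 1) * ‖x - x'‖ ≤ ‖f x - f x'‖ := by
  obtain ⟨δ, hδ, c, hc, H⟩ := cone_normalized f s hs hf hhom u0 hu0 hinj
  have key : ∀ x ∈ coneAt u0 δ, ∀ x' ∈ coneAt u0 δ, ‖x'‖ ≤ ‖x‖ →
      c * ‖x‖ ^ (s - 1) * ‖x - x'‖ ≤ ‖f x - f x'‖ := by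
    rintro x ⟨hx, hxd⟩ x' ⟨hx', hxd'⟩ hle
    have ha : 0 < ‖x‖ := norm_pos_iff.2 hx
    have hb : 0 < ‖x'‖ := norm_pos_iff.2 hx'
    have := H (‖x‖⁻¹ • x) (‖x'‖⁻¹ • x') (by simp [norm_smul, ha.ne']) (by simp [norm_smul, hb.ne'])
      hxd hxd' (‖x'‖ / ‖x‖) (by positivity) (by rw [div_le_one ha]; exact hle)
    rw [hhom _ (by positivity) x hx, hhom _ (by positivity) x' hx', smul_smul, smul_smul,
      Real.div_rpow hb.le ha.le, Real.inv_rpow hb.le, Real.inv_rpow ha.le] at this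
    have e1 : ‖x'‖ / ‖x‖ * ‖x'‖⁻¹ = ‖x‖⁻¹ := by field_simp
    have e2 : ‖x'‖ ^ s / ‖x‖ ^ s * (‖x'‖ ^ s)⁻¹ = (‖x‖ ^ s)⁻¹ := by
      have : 0 < ‖x'‖ ^ s := by positivity
      field_simp
    rw [e1, e2, ← smul_sub, ← smul_sub, norm_smul, norm_smul, norm_inv, norm_inv, norm_norm,
      Real.norm_of_nonneg (by positivity : 0 ≤ ‖x‖ ^ s)] at this
    have hxs : 0 < ‖x‖ ^ s := by positivity
    rw [le_inv_mul_iff₀ hxs] at this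
    calc _ = _ := by rw [Real.rpow_sub_one ha.ne']; field_simp
      _ ≤ _ := this
  refine ⟨δ, hδ, c, hc, fun x hx x' hx' => ?_⟩
  rcases le_total ‖x'‖ ‖x‖ with h | h
  · exact key x hx x' hx' h
  · have := key x' hx' x hx h
    rw [norm_sub_rev x x', norm_sub_rev (f x)]
    refine le_trans ?_ this
    gcongr

lemma cone_cover {F : Type} [NormedAddCommGroup F] [NormedSpace ℝ F] (f : E → F) (s : ℝ)
    (hs : 1 ≤ s) (hf : ContDiffOn ℝ (⊤ : ℕ∞) f {x | x ≠ 0})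
    (hhom : ∀ c : ℝ, 0 < c → ∀ x : E, x ≠ 0 → f (c • x) = c ^ s • f x)
    (hinj : ∀ u : E, ‖u‖ = 1 → Function.Injective (fderiv ℝ f u)) :
    ∃ (I : Finset E) (δ : E → ℝ), ∃ c > 0, (∀ u ∈ I, ‖u‖ = 1 ∧ 0 < δ u) ∧
      (∀ x : E, x ≠ 0 → ∃ u ∈ I, x ∈ coneAt u (δ u)) ∧
      ∀ u ∈ I, ∀ x ∈ coneAt u (δ u), ∀ x' ∈ coneAt u (δ u),
      c * ‖x‖ ^ (s - 1) * ‖x - x'‖ ≤ ‖f x - f x'‖ := by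
  have H := fun u (hu : ‖u‖ = 1) => cone_local f s hs hf hhom u hu (hinj u hu)
  choose! δ hδ c hc H using H
  obtain ⟨I, hI, hcov⟩ := (isCompact_sphere (0 : E) 1).elim_nhds_subcover
    (fun u => Metric.ball u (δ u)) (fun u hu => Metric.ball_mem_nhds u (hδ u (by simpa using hu)))
  have hI' : ∀ u ∈ I, ‖u‖ = 1 := fun u hu => by simpa using hI u hu
  obtain ⟨c0, hc0, hcc⟩ : ∃ c0 > 0, ∀ u ∈ I, c0 ≤ c u := by
    by_cases hne : I.Nonempty
    · exact ⟨I.inf' hne c, (Finset.lt_inf'_iff hne).2 fun u hu => hc u (hI' u hu),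
        fun u hu => Finset.inf'_le _ hu⟩
    · exact ⟨1, one_pos, fun u hu => (hne ⟨u, hu⟩).elim⟩
  refine ⟨I, δ, c0, hc0, fun u hu => ⟨hI' u hu, hδ u (hI' u hu)⟩, fun x hx => ?_,
    fun u hu x hx x' hx' => ?_⟩
  · have ha : 0 < ‖x‖ := norm_pos_iff.2 hx
    have : ‖x‖⁻¹ • x ∈ Metric.sphere (0 : E) 1 := by simp [norm_smul, ha.ne']
    have := hcov this
    simp only [Set.mem_iUnion, Metric.mem_ball, dist_eq_norm] at this
    obtain ⟨u, hu, h⟩ := this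
    exact ⟨u, hu, hx, h⟩
  · refine le_trans ?_ (H u (hI' u hu) x hx x' hx')
    gcongr
    exact hcc u hu

end Cone

section IBP

variable {E : Type} [NormedAddCommGroup E] [NormedSpace ℝ E] [FiniteDimensional ℝ E]

lemma contDiff_mul_of_tsupport {U : Set E} (hU : IsOpen U) {Q a : E → ℂ}
    (hQ : ContDiffOn ℝ (⊤ : ℕ∞) Q U) (ha : ContDiff ℝ (⊤ : ℕ∞) a) (hs : tsupport a ⊆ U) :
    ContDiff ℝ (⊤ : ℕ∞) (fun y => Q y * a y) := by
  rw [contDiff_iff_contDiffAt]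
  intro y
  by_cases hy : y ∈ U
  · exact (hQ.contDiffAt (hU.mem_nhds hy)).mul ha.contDiffAt
  · have hy' : y ∉ tsupport a := fun h => hy (hs h)
    have : (fun y => Q y * a y) =ᶠ[nhds y] fun _ => 0 := by
      filter_upwards [(isClosed_tsupport a).isOpen_compl.mem_nhds hy'] with z hz
      rw [image_eq_zero_of_notMem_tsupport hz, mul_zero]
    exact contDiffAt_const.congr_of_eventuallyEq this

lemma norm_iteratedFDeriv_mul_bound {U : Set E} (hU : IsOpen U) {Q a : E → ℂ}
    (hQ : ContDiffOn ℝ (⊤ : ℕ∞) Q U) (ha : ContDiff ℝ (⊤ : ℕ∞) a) {κ M : ℝ} {n : ℕ} {y : E}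
    (hy : y ∈ U)
    (hκ : ∀ j ≤ n, ‖iteratedFDeriv ℝ j Q y‖ ≤ κ) (hM : ∀ j ≤ n, ‖iteratedFDeriv ℝ j a y‖ ≤ M) :
    ‖iteratedFDeriv ℝ n (fun y => Q y * a y) y‖ ≤ 2 ^ n * (κ * M) := by
  have h := norm_iteratedFDerivWithin_mul_le hQ ha.contDiffOn hU.uniqueDiffOn hy (n := n)
    (by exact_mod_cast le_top)
  simp only [iteratedFDerivWithin_of_isOpen _ hU hy] at h
  have hκ0 : 0 ≤ κ := (norm_nonneg _).trans (hκ 0 (Nat.zero_le _))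
  refine h.trans ?_
  calc _ ≤ ∑ i ∈ Finset.range (n + 1), (n.choose i : ℝ) * κ * M := by
        apply Finset.sum_le_sum
        intro i hi
        gcongr
        · exact hκ i (by simpa [Nat.lt_succ_iff] using hi)
        · exact hM _ (Nat.sub_le _ _)
    _ = _ := by
        simp_rw [mul_assoc]
        rw [← Finset.sum_mul, ← Nat.cast_sum, Nat.sum_range_choose]
        push_cast
        ring

variable [MeasurableSpace E] [BorelSpace E]

lemma trivial_bound (ν : Measure E) {U : Set E} (hUm : ν U < ⊤) {G a : E → ℂ} (hG : ∀ y, ‖G y‖ ≤ 1)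
    (hs : tsupport a ⊆ U) {M : ℝ} (hM : ∀ y, ‖a y‖ ≤ M) :
    ‖∫ y, G y * a y ∂ν‖ ≤ M * ν.real U := by
  have h0 : ∀ y, y ∉ U → G y * a y = 0 := fun y hy => by
    rw [image_eq_zero_of_notMem_tsupport (fun h => hy (hs h)), mul_zero]
  rw [← setIntegral_eq_integral_of_forall_compl_eq_zero h0]
  apply norm_setIntegral_le_of_norm_le_const hUm
  intro y _
  rw [norm_mul]
  calc _ ≤ 1 * M := mul_le_mul (hG y) (hM y) (norm_nonneg _) zero_le_one
    _ = M := one_mul M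

lemma ibp_iter (ν : Measure E) [ν.IsAddHaarMeasure] {U : Set E} (hU : IsOpen U) (hUm : ν U < ⊤)
    {ψ : E → ℝ} (hψ : ContDiffOn ℝ (⊤ : ℕ∞) ψ U) {e : E} (he : ‖e‖ ≤ 1) {Q : E → ℂ}
    (hQ : ContDiffOn ℝ (⊤ : ℕ∞) Q U) (hψQ : ∀ y ∈ U, ((fderiv ℝ ψ y e : ℝ) : ℂ) * Q y = 1)
    {κ : ℝ} (N : ℕ) (hκ : ∀ j ≤ N, ∀ y ∈ U, ‖iteratedFDeriv ℝ j Q y‖ ≤ κ) (hκ0 : 0 ≤ κ) :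
    ∀ (a : E → ℂ), ContDiff ℝ (⊤ : ℕ∞) a → HasCompactSupport a → tsupport a ⊆ U →
    ∀ M : ℝ, (∀ j ≤ N, ∀ y, ‖iteratedFDeriv ℝ j a y‖ ≤ M) →
    ‖∫ y, Complex.exp ((ψ y : ℂ) * Complex.I) * a y ∂ν‖ ≤ 2 ^ (N * N) * κ ^ N * M * ν.real U := by
  induction N with
  | zero =>
    intro a ha hc hs M hM
    have := trivial_bound ν hUm (G := fun y => Complex.exp ((ψ y : ℂ) * Complex.I))
      (fun y => (Complex.norm_exp_ofReal_mul_I _).le) hs (M := M)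
      (fun y => by simpa using hM 0 le_rfl y)
    simpa using this
  | succ N ih =>
    intro a ha hc hs M hM
    have ih := ih (fun j hj => hκ j (by omega))
    set f : E → ℂ := fun y => Complex.exp ((ψ y : ℂ) * Complex.I) with hf
    set b : E → ℂ := fun y => Q y * a y with hb
    have hbs : ContDiff ℝ (⊤ : ℕ∞) b := contDiff_mul_of_tsupport hU hQ ha hs
    have hbt : tsupport b ⊆ tsupport a := tsupport_mul_subset_right
    have hbc : HasCompactSupport b := hc.of_isClosed_subset (isClosed_tsupport _) hbt
    set a' : E → ℂ := fun y => fderiv ℝ b y e with ha'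
    have ha's : ContDiff ℝ (⊤ : ℕ∞) a' :=
      (hbs.fderiv_right (m := (⊤ : ℕ∞)) (by simp)).clm_apply contDiff_const
    have ha't : tsupport a' ⊆ tsupport b := tsupport_fderiv_apply_subset ℝ e
    have ha'c : HasCompactSupport a' := hc.of_isClosed_subset (isClosed_tsupport _) (ha't.trans hbt)
    have hfU : ContDiffOn ℝ (⊤ : ℕ∞) f U := by
      apply ContDiffOn.cexp
      exact (Complex.ofRealCLM.contDiff.comp_contDiffOn hψ).mul contDiffOn_const
    have hfd : ∀ y, fderiv ℝ f y e * b y = Complex.I * (f y * a y) := by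
      intro y
      by_cases hy : y ∈ U
      · have h1 : HasFDerivAt ψ (fderiv ℝ ψ y) y :=
          ((hψ.contDiffAt (hU.mem_nhds hy)).differentiableAt (by simp)).hasFDerivAt
        have h2 : HasFDerivAt f _ y := ((Complex.ofRealCLM.hasFDerivAt.comp y h1).mul_const Complex.I).cexp
        rw [h2.fderiv]
        have h3 := hψQ y hy
        simp only [smul_apply, ContinuousLinearMap.comp_apply, Function.comp_apply,
          Complex.ofRealCLM_apply, smul_eq_mul, hb, hf]
        linear_combination (Complex.exp (↑(ψ y) * Complex.I) * Complex.I * a y) * h3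
      · have h0 : a y = 0 := image_eq_zero_of_notMem_tsupport (fun h => hy (hs h))
        simp [hb, h0]
    have i1 : Integrable (fun y => f y * a y) ν :=
      (contDiff_mul_of_tsupport hU hfU ha hs).continuous.integrable_of_hasCompactSupport
        hc.mul_left
    have i2 : Integrable (fun y => f y * a' y) ν :=
      (contDiff_mul_of_tsupport hU hfU ha's ((ha't.trans hbt).trans hs)).continuous.integrable_of_hasCompactSupport
        ha'c.mul_left
    have i3 : Integrable (fun y => f y * b y) ν :=
      (contDiff_mul_of_tsupport hU hfU hbs (hbt.trans hs)).continuous.integrable_of_hasCompactSupport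
        (HasCompactSupport.mul_left hbc)
    have hibp := integral_mul_fderiv_eq_neg_fderiv_mul_of_integrable (μ := ν) (f := f) (g := b) (v := e)
      (by simp_rw [hfd]; exact i1.const_mul _) i2 i3
      (fun x hx => (hfU.contDiffAt (hU.mem_nhds (hs (hbt hx)))).differentiableAt (by simp))
      (fun x _ => hbs.contDiffAt.differentiableAt (by simp))
    simp_rw [hfd] at hibp
    rw [integral_const_mul] at hibp
    have heq : ‖∫ y, f y * a y ∂ν‖ = ‖∫ y, f y * a' y ∂ν‖ := by
      rw [ha', hibp]; simp
    rw [heq]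
    have hM0 : 0 ≤ M := (norm_nonneg _).trans (hM 0 (Nat.zero_le _) 0)
    have hbound : ∀ j ≤ N, ∀ y, ‖iteratedFDeriv ℝ j a' y‖ ≤ 2 ^ (N + 1) * (κ * M) := by
      intro j hj y
      by_cases hy : y ∈ U
      · have h1 : ‖iteratedFDeriv ℝ j a' y‖ ≤ ‖e‖ * ‖iteratedFDeriv ℝ j (fderiv ℝ b) y‖ :=
          norm_iteratedFDeriv_clm_apply_const (N := (⊤ : ℕ∞))
            (hbs.fderiv_right (m := (⊤ : ℕ∞)) (by simp)).contDiffAt (by exact_mod_cast le_top)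
        rw [norm_iteratedFDeriv_fderiv] at h1
        have h2 := norm_iteratedFDeriv_mul_bound hU hQ ha (κ := κ) (M := M) (n := j + 1) hy
          (fun i hi => hκ i (by omega) y hy) (fun i hi => hM i (by omega) y)
        calc _ ≤ _ := h1
          _ ≤ 1 * (2 ^ (j + 1) * (κ * M)) := by gcongr
          _ ≤ _ := by
            rw [one_mul]; gcongr; norm_num
      · have : y ∉ tsupport (iteratedFDeriv ℝ j a') := fun h =>
          hy (hs (hbt (ha't (tsupport_iteratedFDeriv_subset (𝕜 := ℝ) j h))))
        rw [image_eq_zero_of_notMem_tsupport this, norm_zero]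
        positivity
    refine (ih a' ha's ha'c ((ha't.trans hbt).trans hs) _ hbound).trans ?_
    have : (2 : ℝ) ^ (N * N) * 2 ^ (N + 1) ≤ 2 ^ ((N + 1) * (N + 1)) := by
      rw [← pow_add]
      exact pow_le_pow_right₀ (by norm_num) (by nlinarith)
    calc 2 ^ (N * N) * κ ^ N * (2 ^ (N + 1) * (κ * M)) * ν.real U
        = (2 ^ (N * N) * 2 ^ (N + 1)) * κ ^ (N + 1) * M * ν.real U := by ring
      _ ≤ _ := by gcongr

end IBP

section InvBound

variable {E : Type} [NormedAddCommGroup E] [NormedSpace ℝ E] [FiniteDimensional ℝ E]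

lemma norm_iteratedFDeriv_inv_le (i : ℕ) (z : ℝ) (hz : 1 ≤ |z|) :
    ‖iteratedFDeriv ℝ i (fun x : ℝ => x⁻¹) z‖ ≤ i.factorial := by
  rw [norm_iteratedFDeriv_eq_norm_iteratedDeriv, iteratedDeriv_eq_iterate]
  rw [show (fun x : ℝ => x⁻¹) = Inv.inv from rfl, iter_deriv_inv]
  rw [norm_mul, norm_mul, norm_pow, norm_neg, norm_one, one_pow, one_mul, norm_zpow,
    Real.norm_eq_abs, Real.norm_eq_abs, Nat.abs_cast]
  have : |z| ^ (-1 - (i : ℤ)) ≤ 1 := zpow_le_one_of_nonpos₀ hz (by omega)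
  calc _ ≤ (i.factorial : ℝ) * 1 := by gcongr
    _ = _ := mul_one _

lemma inv_bound (N : ℕ) {U : Set E} (hU : IsOpen U) {b : E → ℝ} (hb : ContDiffOn ℝ (⊤ : ℕ∞) b U)
    {L D : ℝ} (hL : 0 < L) (hD : 1 ≤ D) (hbL : ∀ y ∈ U, L ≤ |b y|)
    (hbD : ∀ j, 1 ≤ j → j ≤ N → ∀ y ∈ U, ‖iteratedFDeriv ℝ j b y‖ ≤ D * L) :
    ContDiffOn ℝ (⊤ : ℕ∞) (fun y => (((b y)⁻¹ : ℝ) : ℂ)) U ∧ ∀ j ≤ N, ∀ y ∈ U,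
      ‖iteratedFDeriv ℝ j (fun y => (((b y)⁻¹ : ℝ) : ℂ)) y‖ ≤
        N.factorial * N.factorial * D ^ N * L⁻¹ := by
  have hne : ∀ y ∈ U, b y ≠ 0 := fun y hy h => by
    have := hbL y hy; rw [h, abs_zero] at this; linarith
  have hinv : ContDiffOn ℝ (⊤ : ℕ∞) (fun y => (b y)⁻¹) U := hb.inv hne
  refine ⟨Complex.ofRealCLM.contDiff.comp_contDiffOn hinv, fun j hj y hy => ?_⟩
  have h1 : ‖iteratedFDeriv ℝ j (fun y => (((b y)⁻¹ : ℝ) : ℂ)) y‖ =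
      ‖iteratedFDeriv ℝ j (fun y => (b y)⁻¹) y‖ :=
    Complex.ofRealLI.norm_iteratedFDeriv_comp_left (hinv.contDiffAt (hU.mem_nhds hy))
      (by exact_mod_cast le_top)
  rw [h1]
  set β : E → ℝ := fun y => L⁻¹ • b y with hβ
  have hβs : ContDiffOn ℝ (⊤ : ℕ∞) β U := hb.const_smul L⁻¹
  have hβ1 : ∀ y ∈ U, 1 ≤ |β y| := fun y hy => by
    rw [hβ]; simp only [smul_eq_mul, abs_mul, abs_inv, abs_of_pos hL]
    rw [le_inv_mul_iff₀ hL, mul_one]; exact hbL y hy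
  have hmaps : Set.MapsTo β U ({0}ᶜ : Set ℝ) := fun y hy h => by
    have := hβ1 y hy
    rw [h, abs_zero] at this; linarith
  have hopen : IsOpen ({0}ᶜ : Set ℝ) := isOpen_compl_singleton
  have hfac : ∀ i ≤ N, (i.factorial : ℝ) ≤ N.factorial := fun i hi => by
    exact_mod_cast Nat.factorial_le hi
  have h2 := norm_iteratedFDerivWithin_comp_le (𝕜 := ℝ) (g := fun x : ℝ => x⁻¹) (f := β) (n := j)
    (s := U) (t := {0}ᶜ) (x := y) (N := (⊤ : ℕ∞)) (C := N.factorial) (D := D)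
    (contDiffOn_id.inv (fun x hx => hx)) hβs (by exact_mod_cast le_top) hopen.uniqueDiffOn
    hU.uniqueDiffOn hmaps hy
    (fun i hi => by
      rw [iteratedFDerivWithin_of_isOpen _ hopen (hmaps hy)]
      exact (norm_iteratedFDeriv_inv_le i _ (hβ1 y hy)).trans (hfac i (hi.trans hj)))
    (fun i hi1 hi => by
      rw [iteratedFDerivWithin_of_isOpen _ hU hy, hβ, iteratedFDeriv_const_smul_apply'
        ((hb.contDiffAt (hU.mem_nhds hy)).of_le (by exact_mod_cast le_top)), norm_smul, norm_inv,
        Real.norm_of_nonneg hL.le, inv_mul_le_iff₀ hL]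
      refine (hbD i hi1 (hi.trans hj) y hy).trans ?_
      rw [mul_comm]
      gcongr
      exact le_self_pow₀ hD (by omega))
  rw [iteratedFDerivWithin_of_isOpen _ hU hy] at h2
  have h3 : (fun y => (b y)⁻¹) = fun y => L⁻¹ • (((fun x : ℝ => x⁻¹) ∘ β) y) := by
    funext z
    simp only [hβ, Function.comp, smul_eq_mul, mul_inv, inv_inv]
    rw [← mul_assoc, inv_mul_cancel₀ hL.ne', one_mul]
  have hcs : ContDiffAt ℝ (⊤ : ℕ∞) ((fun x : ℝ => x⁻¹) ∘ β) y :=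
    (hβs.inv hmaps).contDiffAt (hU.mem_nhds hy)
  rw [h3, iteratedFDeriv_const_smul_apply' (hcs.of_le (by exact_mod_cast le_top)), norm_smul,
    norm_inv, Real.norm_of_nonneg hL.le, mul_comm]
  gcongr
  refine h2.trans ?_
  gcongr

end InvBound

section Key

variable {E : Type} [NormedAddCommGroup E] [InnerProductSpace ℝ E] [FiniteDimensional ℝ E]
  [MeasurableSpace E] [BorelSpace E]

lemma key_ibp (N : ℕ) (m : ℝ) (hm : 2 ≤ m) (μ : E → ℝ)
    (hsmooth : ContDiffOn ℝ (⊤ : ℕ∞) μ {x | x ≠ 0})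
    (hhom : ∀ c : ℝ, 0 < c → ∀ x : E, x ≠ 0 → μ (c • x) = c ^ m • μ x)
    (ν : Measure E) [ν.IsAddHaarMeasure] :
    ∃ C1 : ℝ, 1 ≤ C1 ∧ ∃ C2 : ℝ, 0 < C2 ∧ ∀ (t : ℝ), 0 < t → ∀ (ξ p : E), 2 ≤ ‖p‖ →
      ∀ L : ℝ, 0 < L → L ≤ ‖t • fderiv ℝ μ p - innerSL ℝ ξ‖ → C1 * (t * ‖p‖ ^ (m - 2)) ≤ L →
      ∀ (a : E → ℂ), ContDiff ℝ (⊤ : ℕ∞) a → HasCompactSupport a → tsupport a ⊆ Metric.ball p 1 →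
      ∀ M : ℝ, (∀ j ≤ N, ∀ y, ‖iteratedFDeriv ℝ j a y‖ ≤ M) →
      ‖∫ y, Complex.exp (((2 * π * (t * μ y - ⟪ξ, y⟫) : ℝ) : ℂ) * Complex.I) * a y ∂ν‖ ≤
        C2 * L⁻¹ ^ N * M * ν.real (Metric.ball p 1) := by
  set f := fderiv ℝ μ with hf
  have hfs : ContDiffOn ℝ (⊤ : ℕ∞) f {x | x ≠ 0} := contDiffOn_fderiv' μ hsmooth
  have hfh : ∀ c : ℝ, 0 < c → ∀ x : E, x ≠ 0 → f (c • x) = c ^ (m - 1) • f x :=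
    homog_fderiv μ m hsmooth hhom
  have hB := fun k => homog_bound k f (m - 1) hfs hfh
  choose Ck hCk0 hCk using hB
  set Cm : ℝ := ∑ j ∈ Finset.range (N + 2), Ck j with hCm
  have hCm0 : 0 ≤ Cm := Finset.sum_nonneg fun j _ => hCk0 j
  have hCkm : ∀ j ≤ N + 1, Ck j ≤ Cm := fun j hj =>
    Finset.single_le_sum (f := Ck) (fun j _ => hCk0 j) (Finset.mem_range.2 (by omega))
  set P : ℝ := 2 ^ (m - 2) with hP
  have hP0 : 0 < P := by positivity
  -- derivative bounds in the ball
  have hder : ∀ p : E, 2 ≤ ‖p‖ → ∀ y ∈ Metric.ball p 1, y ≠ 0 ∧ ∀ j, 1 ≤ j → j ≤ N + 1 →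
      ‖iteratedFDeriv ℝ j f y‖ ≤ Cm * P * ‖p‖ ^ (m - 2) := by
    intro p hp y hy
    rw [Metric.mem_ball, dist_eq_norm] at hy
    have h1 : ‖p‖ - 1 ≤ ‖y‖ := by
      have := norm_sub_norm_le p y
      rw [norm_sub_rev] at this; linarith
    have h2 : ‖y‖ ≤ 2 * ‖p‖ := by
      have := norm_sub_norm_le y p
      linarith
    have hy0 : y ≠ 0 := by
      rintro rfl; simp at h1; linarith
    refine ⟨hy0, fun j hj1 hj => ?_⟩
    have hj1' : (1 : ℝ) ≤ j := by exact_mod_cast hj1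
    calc _ ≤ Ck j * ‖y‖ ^ (m - 1 - j) := hCk j y hy0
      _ ≤ Cm * ‖y‖ ^ (m - 2) := by
        exact mul_le_mul (hCkm j hj) (Real.rpow_le_rpow_of_exponent_le (by linarith) (by linarith))
          (by positivity) hCm0
      _ ≤ Cm * (2 * ‖p‖) ^ (m - 2) := by gcongr
      _ = _ := by rw [Real.mul_rpow (by norm_num) (norm_nonneg p)]; ring
  set C1 : ℝ := max 1 (4 * (Cm * P)) with hC1
  set D : ℝ := max 1 (2 * π * (Cm * P)) with hD
  set R : ℝ := N.factorial * N.factorial * D ^ N with hR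
  have hD1 : 1 ≤ D := le_max_left _ _
  have hR0 : 0 < R := by positivity
  refine ⟨C1, le_max_left _ _, 2 ^ (N * N) * R ^ N, by positivity, ?_⟩
  intro t ht ξ p hp L hL hLle hC1L a ha hac has M hM
  obtain ⟨e, he, hre⟩ := ContinuousLinearMap.exists_lt_apply_of_lt_opNorm
    (t • f p - innerSL ℝ ξ) (show L / 2 < ‖t • f p - innerSL ℝ ξ‖ by linarith)
  set U := Metric.ball p 1 with hU
  have hUo : IsOpen U := Metric.isOpen_ball
  have hU0 : U ⊆ {x | x ≠ 0} := fun y hy => (hder p hp y hy).1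
  set A : ℝ := t * ‖p‖ ^ (m - 2) with hA
  have hA0 : 0 ≤ A := by positivity
  have hAL : A ≤ L := by
    refine le_trans ?_ hC1L
    exact le_mul_of_one_le_left hA0 (le_max_left _ _)
  have hAL4 : 4 * (Cm * P) * A ≤ L := by
    refine le_trans ?_ hC1L
    gcongr
    exact le_max_right _ _
  set ψ : E → ℝ := fun y => 2 * π * (t * μ y - ⟪ξ, y⟫) with hψ
  have hψs : ContDiffOn ℝ (⊤ : ℕ∞) ψ U := by
    apply contDiffOn_const.mul
    apply ContDiffOn.sub
    · exact contDiffOn_const.mul (hsmooth.mono hU0)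
    · exact (contDiff_const.inner ℝ contDiff_id).contDiffOn
  set b : E → ℝ := fun y => (2 * π * t) • (f y e) - 2 * π * ⟪ξ, e⟫ with hb
  have hfe : ContDiffOn ℝ (⊤ : ℕ∞) (fun y => f y e) U :=
    (hfs.mono hU0).clm_apply contDiffOn_const
  have hbs : ContDiffOn ℝ (⊤ : ℕ∞) b U := (hfe.const_smul _).sub contDiffOn_const
  have hψd : ∀ y ∈ U, fderiv ℝ ψ y e = b y := by
    intro y hy
    have h1 : HasFDerivAt μ (f y) y :=
      ((hsmooth.contDiffAt (isOpen_ne_zero'.mem_nhds (hU0 hy))).differentiableAt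
        (by simp)).hasFDerivAt
    have h2 : HasFDerivAt (fun y : E => ⟪ξ, y⟫) (innerSL ℝ ξ) y := (innerSL ℝ ξ).hasFDerivAt
    have h3 : HasFDerivAt ψ _ y := ((h1.const_mul t).sub h2).const_mul (2 * π)
    rw [h3.fderiv]
    simp [hb]
    ring
  have hbL : ∀ y ∈ U, L ≤ |b y| := by
    intro y hy
    have hmv : ‖f y - f p‖ ≤ Cm * P * ‖p‖ ^ (m - 2) * ‖y - p‖ := by
      apply Convex.norm_image_sub_le_of_norm_fderiv_le (𝕜 := ℝ) (s := U) (f := f)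
      · intro z hz
        exact (hfs.contDiffAt (isOpen_ne_zero'.mem_nhds (hU0 hz))).differentiableAt (by simp)
      · intro z hz
        rw [← norm_iteratedFDeriv_one]
        exact (hder p hp z hz).2 1 le_rfl (by omega)
      · exact convex_ball p 1
      · exact Metric.mem_ball_self one_pos
      · exact hy
    have hy1 : ‖y - p‖ ≤ 1 := by
      rw [hU, Metric.mem_ball, dist_eq_norm] at hy; exact hy.le
    have hmv2 : ‖f y - f p‖ ≤ Cm * P * ‖p‖ ^ (m - 2) := hmv.trans
      (mul_le_of_le_one_right (by positivity) hy1)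
    have h4 : |t * (f y - f p) e| ≤ Cm * P * A := by
      rw [abs_mul, abs_of_pos ht]
      have : |(f y - f p) e| ≤ ‖f y - f p‖ * 1 := by
        rw [← Real.norm_eq_abs]
        exact ContinuousLinearMap.le_opNorm_of_le _ he.le
      calc _ ≤ t * (Cm * P * ‖p‖ ^ (m - 2)) := by gcongr; linarith
        _ = _ := by rw [hA]; ring
    have h5 : b y = 2 * π * ((t • f p - innerSL ℝ ξ) e + t * (f y - f p) e) := by
      simp [hb]; ring
    rw [h5, abs_mul, abs_of_pos (by positivity : 0 < 2 * π)]
    have h6 : L / 4 ≤ |(t • f p - innerSL ℝ ξ) e + t * (f y - f p) e| := by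
      have h7 := abs_sub_abs_le_abs_add ((t • f p - innerSL ℝ ξ) e) (t * (f y - f p) e)
      rw [Real.norm_eq_abs] at hre
      linarith
    calc L = 4 * (L / 4) := by ring
      _ ≤ 2 * π * (L / 4) := by gcongr; linarith [Real.pi_gt_three]
      _ ≤ _ := by gcongr
  have hbD : ∀ j, 1 ≤ j → j ≤ N → ∀ y ∈ U, ‖iteratedFDeriv ℝ j b y‖ ≤ D * L := by
    intro j hj1 hj y hy
    obtain ⟨i, rfl⟩ : ∃ i, j = i + 1 := ⟨j - 1, by omega⟩
    have hfd : fderiv ℝ b = fderiv ℝ (fun y => (2 * π * t) • (f y e)) := by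
      funext z
      rw [hb, fderiv_sub_const]
    rw [← norm_iteratedFDeriv_fderiv, hfd, norm_iteratedFDeriv_fderiv]
    have hcd := (hfs.contDiffAt (isOpen_ne_zero'.mem_nhds (hU0 hy)))
    have hcd2 := hfe.contDiffAt (hUo.mem_nhds hy)
    rw [iteratedFDeriv_const_smul_apply' (hcd2.of_le (by exact_mod_cast le_top)), norm_smul,
      Real.norm_of_nonneg (by positivity)]
    have h1 : ‖iteratedFDeriv ℝ (i + 1) (fun y => f y e) y‖ ≤
        ‖e‖ * ‖iteratedFDeriv ℝ (i + 1) f y‖ :=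
      norm_iteratedFDeriv_clm_apply_const (N := (⊤ : ℕ∞)) hcd (by exact_mod_cast le_top)
    have h2 := (hder p hp y hy).2 (i + 1) (by omega) (by omega)
    calc _ ≤ 2 * π * t * (1 * (Cm * P * ‖p‖ ^ (m - 2))) := by
          gcongr
          exact h1.trans (by gcongr)
      _ = 2 * π * (Cm * P) * A := by rw [hA]; ring
      _ ≤ D * L := by gcongr; exact le_max_right _ _
  obtain ⟨hQs, hQb⟩ := inv_bound N hUo hbs hL hD1 hbL hbD
  have hfin := ibp_iter ν hUo (Metric.isBounded_ball.measure_lt_top) hψs he.le hQs (fun y hy => by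
      rw [hψd y hy, ← Complex.ofReal_mul, mul_inv_cancel₀, Complex.ofReal_one]
      intro h
      have := hbL y hy
      rw [h, abs_zero] at this
      linarith) N hQb (by positivity) a ha hac has M hM
  refine hfin.trans (le_of_eq ?_)
  rw [hR]; ring

end Key

section KeyBound

variable {E : Type} [NormedAddCommGroup E] [InnerProductSpace ℝ E] [FiniteDimensional ℝ E]
  [MeasurableSpace E] [BorelSpace E]

/-- the polynomially decaying weight at scale `T` -/
def wt (N : ℕ) (T : ℝ) (z : E) : ℝ := ((1 + ‖z‖ / T) ^ N)⁻¹

lemma wt_nonneg (N : ℕ) {T : ℝ} (hT : 0 < T) (z : E) : 0 ≤ wt N T z := by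
  unfold wt; positivity

lemma one_le_wt (N : ℕ) {T K : ℝ} (hT : 0 < T) (hK : 0 ≤ K) (z : E) (hz : ‖z‖ ≤ K * T) :
    1 ≤ (1 + K) ^ N * wt N T z := by
  unfold wt
  rw [← div_eq_mul_inv, one_le_div (by positivity)]
  gcongr
  rwa [div_le_iff₀ hT]

lemma scale_ineq {m t T : ℝ} (hm : 2 ≤ m) (ht : 0 < t) (ht1 : t ≤ 1) (hT : T = t ^ (-(2 / m))) :
    1 ≤ T ∧ T⁻¹ ≤ t * T ^ (m - 2) := by
  constructor
  · rw [hT]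
    exact Real.one_le_rpow_of_pos_of_le_one_of_nonpos ht ht1 (by
      have : 0 < 2 / m := by positivity
      linarith)
  · rw [hT, ← Real.rpow_neg ht.le, ← Real.rpow_mul ht.le, neg_neg]
    nth_rewrite 2 [← Real.rpow_one t]
    rw [← Real.rpow_add ht]
    apply Real.rpow_le_rpow_of_exponent_ge ht ht1
    have hm0 : 0 < m := by linarith
    have h1 : 1 + -(2 / m) * (m - 2) = 4 / m - 1 := by field_simp; ring
    have h2 : 2 / m ≤ 1 := by rw [div_le_one hm0]; exact hm
    rw [h1]
    have h3 : 4 / m = 2 * (2 / m) := by ring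
    linarith

lemma key_bound (N : ℕ) (m : ℝ) (hm : 2 ≤ m) (μ : E → ℝ)
    (hsmooth : ContDiffOn ℝ (⊤ : ℕ∞) μ {x | x ≠ 0})
    (hhom : ∀ c : ℝ, 0 < c → ∀ x : E, x ≠ 0 → μ (c • x) = c ^ m • μ x)
    (hhess : ∀ x : E, ‖x‖ = 1 → Function.Injective (fderiv ℝ (fderiv ℝ μ) x))
    (ν : Measure E) [ν.IsAddHaarMeasure] :
    ∃ (I : Finset E) (C : ℝ), 0 < C ∧ ∀ (t : ℝ), 0 < t → t ≤ 1 → ∀ (ξ : E), ∃ cen : E → E,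
      ∀ (p : E) (a : E → ℂ), ContDiff ℝ (⊤ : ℕ∞) a → HasCompactSupport a →
      tsupport a ⊆ Metric.ball p 1 →
      ∀ M : ℝ, (∀ j ≤ N, ∀ y, ‖iteratedFDeriv ℝ j a y‖ ≤ M) →
      ‖∫ y, Complex.exp (((2 * π * (t * μ y - ⟪ξ, y⟫) : ℝ) : ℂ) * Complex.I) * a y ∂ν‖ ≤
        C * M * (wt N (t ^ (-(2 / m))) p + ∑ u ∈ I, wt N (t ^ (-(2 / m))) (p - cen u)) := by
  set f := fderiv ℝ μ with hf
  have hfs : ContDiffOn ℝ (⊤ : ℕ∞) f {x | x ≠ 0} := contDiffOn_fderiv' μ hsmooth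
  have hfh : ∀ c : ℝ, 0 < c → ∀ x : E, x ≠ 0 → f (c • x) = c ^ (m - 1) • f x :=
    homog_fderiv μ m hsmooth hhom
  obtain ⟨I, δ, c0, hc0, hI, hcov, hcone⟩ := cone_cover f (m - 1) (by linarith) hfs hfh hhess
  obtain ⟨C1, hC1, C2, hC2, hibp⟩ := key_ibp N m hm μ hsmooth hhom ν
  set V : ℝ := ν.real (Metric.ball (0 : E) 1) with hV
  have hVp : ∀ p : E, ν.real (Metric.ball p 1) = V := fun p => by
    rw [hV, measureReal_def, measureReal_def, Measure.addHaar_ball_center]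
  have hV0 : 0 ≤ V := measureReal_nonneg
  set C3 : ℝ := max 1 (4 * C1 / c0) with hC3
  have hC31 : 1 ≤ C3 := le_max_left _ _
  set Ca : ℝ := V * 3 ^ N with hCa
  set Cb : ℝ := V * (1 + C3) ^ N with hCb
  set Cc : ℝ := C2 * V * (8 / c0) ^ N with hCc
  have hCa0 : 0 ≤ Ca := by positivity
  have hCb0 : 0 ≤ Cb := by positivity
  have hCc0 : 0 ≤ Cc := by positivity
  refine ⟨I, 1 + Ca + Cb + Cc, by positivity, ?_⟩
  intro t ht ht1 ξ
  set T : ℝ := t ^ (-(2 / m)) with hT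
  obtain ⟨hT1, hTA⟩ := scale_ineq hm ht ht1 hT
  have hT0 : 0 < T := by linarith
  set Lam : E → ℝ := fun x => ‖t • f x - innerSL ℝ ξ‖ with hLam
  set ε : ℝ := c0 * (t * T ^ (m - 2)) * T / 2 with hε
  have hε0 : 0 < ε := by positivity
  have hcen : ∀ u : E, ∃ c : E, u ∈ I → c ∈ coneAt u (δ u) ∧
      ∀ x ∈ coneAt u (δ u), Lam c ≤ Lam x + ε := by
    intro u
    by_cases hu : u ∈ I
    · obtain ⟨hu1, hδ⟩ := hI u hu
      have hne : (Lam '' coneAt u (δ u)).Nonempty := by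
        refine ⟨_, u, ⟨?_, ?_⟩, rfl⟩
        · rintro rfl; simp at hu1
        · simpa [hu1] using hδ
      obtain ⟨_, ⟨c, hc, rfl⟩, hlt⟩ := Real.lt_sInf_add_pos hne hε0
      refine ⟨c, fun _ => ⟨hc, fun x hx => hlt.le.trans ?_⟩⟩
      have : sInf (Lam '' coneAt u (δ u)) ≤ Lam x :=
        csInf_le ⟨0, by rintro _ ⟨z, _, rfl⟩; exact norm_nonneg _⟩ ⟨x, hx, rfl⟩
      linarith
    · exact ⟨0, fun h => (hu h).elim⟩
  choose cen hcen using hcen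
  refine ⟨cen, ?_⟩
  intro p a ha hac has M hM
  have hM0 : 0 ≤ M := (norm_nonneg _).trans (hM 0 (Nat.zero_le _) 0)
  have hw0 : ∀ z : E, 0 ≤ wt N T z := wt_nonneg N hT0
  have htriv : ‖∫ y, Complex.exp (((2 * π * (t * μ y - ⟪ξ, y⟫) : ℝ) : ℂ) * Complex.I) * a y ∂ν‖
      ≤ M * V := by
    rw [← hVp p]
    exact trivial_bound ν (Metric.isBounded_ball.measure_lt_top)
      (fun y => (Complex.norm_exp_ofReal_mul_I _).le) has
      (fun y => by simpa using hM 0 (Nat.zero_le _) y)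
  have hsum0 : 0 ≤ ∑ u ∈ I, wt N T (p - cen u) := Finset.sum_nonneg fun u _ => hw0 _
  by_cases hp : ‖p‖ ≤ 2 * T
  · have h1 := one_le_wt N hT0 (by norm_num : (0 : ℝ) ≤ 2) p hp
    norm_num at h1
    calc _ ≤ M * V := htriv
      _ ≤ M * V * (3 ^ N * wt N T p) := le_mul_of_one_le_right (by positivity) h1
      _ = Ca * M * wt N T p := by rw [hCa]; ring
      _ ≤ _ := by
        apply mul_le_mul _ (by linarith) (hw0 p) (by positivity)
        gcongr
        linarith
  push Not at hp
  have hp2 : 2 ≤ ‖p‖ := by linarith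
  have hp0 : p ≠ 0 := by rintro rfl; simp at hp2; linarith
  obtain ⟨u, hu, hpu⟩ := hcov p hp0
  obtain ⟨hcu, hmin⟩ := hcen u hu
  have hfin : ∀ K : ℝ, K ≤ 1 + Ca + Cb + Cc → K * M * wt N T (p - cen u) ≤
      (1 + Ca + Cb + Cc) * M * (wt N T p + ∑ u ∈ I, wt N T (p - cen u)) := by
    intro K hK
    have h1 : wt N T (p - cen u) ≤ ∑ u ∈ I, wt N T (p - cen u) :=
      Finset.single_le_sum (f := fun u => wt N T (p - cen u)) (fun u _ => hw0 _) hu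
    apply mul_le_mul _ (by linarith [hw0 p]) (hw0 _) (by positivity)
    gcongr
  by_cases hD : ‖p - cen u‖ ≤ C3 * T
  · have h1 := one_le_wt N hT0 (by linarith : (0 : ℝ) ≤ C3) (p - cen u) hD
    calc _ ≤ M * V := htriv
      _ ≤ M * V * ((1 + C3) ^ N * wt N T (p - cen u)) := le_mul_of_one_le_right (by positivity) h1
      _ = Cb * M * wt N T (p - cen u) := by rw [hCb]; ring
      _ ≤ _ := hfin Cb (by linarith)
  push Not at hD
  set D := ‖p - cen u‖ with hDdef
  have hDT : T ≤ D := by nlinarith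
  have hD0 : 0 < D := by linarith
  set A : ℝ := t * ‖p‖ ^ (m - 2) with hA
  have hAT : t * T ^ (m - 2) ≤ A := by
    rw [hA]
    gcongr
    linarith
  have hA0 : 0 < A := lt_of_lt_of_le (by positivity) hAT
  have hεA : ε ≤ c0 * A * D / 2 := by rw [hε]; gcongr
  have hlow : c0 * A * D ≤ Lam p + Lam (cen u) := by
    have h1 := hcone u hu p hpu (cen u) hcu
    rw [show m - 1 - 1 = m - 2 by ring] at h1
    have h2 : t * ‖f p - f (cen u)‖ ≤ Lam p + Lam (cen u) := by
      have : (t • f p - innerSL ℝ ξ) - (t • f (cen u) - innerSL ℝ ξ) = t • (f p - f (cen u)) := by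
        rw [smul_sub]; abel
      calc _ = ‖t • (f p - f (cen u))‖ := by rw [norm_smul, Real.norm_of_nonneg ht.le]
        _ ≤ _ := by rw [← this]; exact norm_sub_le _ _
    calc c0 * A * D = t * (c0 * ‖p‖ ^ (m - 2) * ‖p - cen u‖) := by rw [hA, hDdef]; ring
      _ ≤ t * ‖f p - f (cen u)‖ := by gcongr
      _ ≤ _ := h2
  have hmin' := hmin p hpu
  set L : ℝ := c0 * A * D / 4 with hL
  have hLpos : 0 < L := by positivity
  have hLle : L ≤ Lam p := by rw [hL]; linarith
  have hC1L : C1 * A ≤ L := by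
    have h1 : 4 * C1 / c0 ≤ D := by
      calc _ ≤ C3 := le_max_right _ _
        _ ≤ C3 * T := le_mul_of_one_le_right (by linarith) hT1
        _ ≤ D := hD.le
    rw [div_le_iff₀ hc0] at h1
    rw [hL]
    nlinarith
  have hest := hibp t ht ξ p hp2 L hLpos hLle hC1L a ha hac has M hM
  rw [hVp] at hest
  have hLw : L⁻¹ ^ N ≤ (8 / c0) ^ N * wt N T (p - cen u) := by
    unfold wt
    rw [← inv_pow, ← mul_pow]
    gcongr
    rw [← hDdef, ← div_eq_mul_inv, le_div_iff₀ (by positivity), inv_mul_le_iff₀ hLpos]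
    have h1 : 1 + D / T ≤ 2 * (D / T) := by
      have : 1 ≤ D / T := by rw [le_div_iff₀ hT0]; linarith
      linarith
    have h2 : D / T ≤ A * D := by
      rw [div_eq_inv_mul]
      gcongr
      exact hTA.trans hAT
    calc _ ≤ 2 * (A * D) := by linarith
      _ = _ := by rw [hL]; field_simp; ring
  calc _ ≤ _ := hest
    _ ≤ C2 * ((8 / c0) ^ N * wt N T (p - cen u)) * M * V := by gcongr
    _ = Cc * M * wt N T (p - cen u) := by rw [hCc]; ring
    _ ≤ _ := hfin Cc (by linarith)

end KeyBound


section Assembly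

variable {E : Type} [NormedAddCommGroup E] [InnerProductSpace ℝ E] [FiniteDimensional ℝ E]
  [MeasurableSpace E] [BorelSpace E]

lemma lint_comp_smul (ν : Measure E) [ν.IsAddHaarMeasure] {r : ℝ} (hr : 0 < r)
    (f : E → ℝ≥0∞) :
    ∫⁻ x, f (r • x) ∂ν = ENNReal.ofReal ((r ^ Module.finrank ℝ E)⁻¹) * ∫⁻ x, f x ∂ν := by
  have h1 := (Homeomorph.smulOfNeZero r hr.ne' : E ≃ₜ E).measurableEmbedding.lintegral_map
    (μ := ν) f
  have h2 : Measure.map (⇑(Homeomorph.smulOfNeZero r hr.ne' : E ≃ₜ E)) ν =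
    ENNReal.ofReal (abs (r ^ Module.finrank ℝ E)⁻¹) • ν := Measure.map_addHaar_smul ν hr.ne'
  rw [h2, lintegral_smul_measure, abs_of_pos (by positivity)] at h1
  exact h1.symm

lemma continuous_wt (N : ℕ) {T : ℝ} (hT : 0 < T) : Continuous (wt N T : E → ℝ) := by
  unfold wt
  refine Continuous.inv₀ (by fun_prop) (fun z => ?_)
  have : 0 < 1 + ‖z‖ / T := by positivity
  positivity

lemma wt_lintegral (ν : Measure E) [ν.IsAddHaarMeasure] :
    ∃ S : ℝ, 0 ≤ S ∧ ∀ T : ℝ, 0 < T →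
      ∫⁻ z, ENNReal.ofReal (wt (Module.finrank ℝ E + 1) T z) ∂ν =
        ENNReal.ofReal (T ^ Module.finrank ℝ E * S) := by
  have h := finite_integral_one_add_norm (μ := ν) (E := E)
    (r := ((Module.finrank ℝ E + 1 : ℕ) : ℝ)) (by push_cast; linarith)
  set S := ∫⁻ z, ENNReal.ofReal (wt (Module.finrank ℝ E + 1) 1 z) ∂ν with hS
  have hfin : S < ⊤ := by
    refine lt_of_le_of_lt (le_of_eq ?_) h
    refine lintegral_congr fun z => ?_
    congr 1
    have : 0 ≤ 1 + ‖z‖ := by positivity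
    rw [Real.rpow_neg this, Real.rpow_natCast, wt, div_one]
  refine ⟨S.toReal, ENNReal.toReal_nonneg, fun T hT => ?_⟩
  have h2 := lint_comp_smul ν (inv_pos.2 hT)
    (fun z => ENNReal.ofReal (wt (Module.finrank ℝ E + 1) 1 z))
  rw [← hS] at h2
  rw [ENNReal.ofReal_mul (by positivity), ENNReal.ofReal_toReal hfin.ne]
  rw [inv_pow, inv_inv] at h2
  rw [← h2]
  refine lintegral_congr fun z => ?_
  congr 1
  simp only [wt, norm_smul, norm_inv, Real.norm_eq_abs, abs_of_pos hT, div_one]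
  rw [div_eq_inv_mul]

lemma wt_shift (N : ℕ) {σ : ℝ} (hσ : 1 ≤ σ) (z w : E) (h : ‖z - w‖ ≤ 1) :
    wt N σ z ≤ 2 ^ N * wt N σ w := by
  have hσ0 : 0 < σ := by linarith
  unfold wt
  rw [← div_eq_mul_inv, inv_eq_one_div, div_le_div_iff₀ (by positivity) (by positivity),
    one_mul, ← mul_pow]
  gcongr
  have h1 : ‖w‖ ≤ ‖z‖ + 1 := by
    have := norm_sub_norm_le w z
    rw [norm_sub_rev] at this; linarith
  have h2 : ‖w‖ / σ ≤ ‖z‖ / σ + 1 := by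
    rw [div_add_one hσ0.ne']; gcongr; linarith
  have : 0 ≤ ‖z‖ / σ := by positivity
  linarith

/-- a smooth normalized bump with all needed properties -/
lemma exists_bump (N : ℕ) (ν : Measure E) [ν.IsAddHaarMeasure] :
    ∃ (γ : E → ℂ) (Γ : ℝ), 0 < Γ ∧ ContDiff ℝ (⊤ : ℕ∞) γ ∧ HasCompactSupport γ ∧
      tsupport γ ⊆ Metric.closedBall 0 (1 / 2) ∧ Integrable γ ν ∧ ∫ x, γ x ∂ν = 1 ∧
      (∀ x, γ (-x) = γ x) ∧ ∀ j ≤ N, ∀ y, ‖iteratedFDeriv ℝ j γ y‖ ≤ Γ := by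
  let b : ContDiffBump (0 : E) := ⟨1 / 4, 1 / 2, by norm_num, by norm_num⟩
  let γ : E → ℂ := fun x => (b.normed ν x : ℂ)
  have hsm : ContDiff ℝ (⊤ : ℕ∞) γ :=
    Complex.ofRealCLM.contDiff.comp (b.contDiff_normed)
  have hts : tsupport γ ⊆ tsupport (b.normed ν) := by
    apply closure_mono
    intro x hx
    simp only [Function.mem_support, γ] at hx ⊢
    exact fun h => hx (by rw [h]; simp)
  have hcs : HasCompactSupport γ := b.hasCompactSupport_normed.mono
    (by
      intro x hx
      simp only [Function.mem_support, γ] at hx ⊢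
      exact fun h => hx (by rw [h]; simp))
  have hb : ∀ j : ℕ, ∃ B : ℝ, ∀ y, ‖iteratedFDeriv ℝ j γ y‖ ≤ B := fun j => by
    have hc : Continuous (iteratedFDeriv ℝ j γ) :=
      hsm.continuous_iteratedFDeriv (by exact_mod_cast le_top)
    exact hc.bounded_above_of_compact_support (hcs.iteratedFDeriv j)
  choose B hB using hb
  refine ⟨γ, 1 + ∑ j ∈ Finset.range (N + 1), |B j|, by positivity, hsm, hcs, ?_, ?_, ?_, ?_, ?_⟩
  · refine hts.trans ?_
    rw [b.tsupport_normed_eq]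
  · exact b.integrable_normed.ofReal
  · have := b.integral_normed (μ := ν)
    simp only [γ]
    rw [integral_complex_ofReal, this]; simp
  · intro x; simp only [γ]; rw [b.normed_neg]
  · intro j hj y
    refine (hB j y).trans ((le_abs_self _).trans ?_)
    have := Finset.single_le_sum (f := fun j => |B j|) (fun i _ => abs_nonneg _)
      (Finset.mem_range.2 (Nat.lt_succ_of_le hj))
    linarith

lemma piece_bound (N : ℕ) {γ : E → ℂ} {Γ : ℝ} (hγ : ContDiff ℝ (⊤ : ℕ∞) γ)
    (hts : tsupport γ ⊆ Metric.closedBall 0 (1 / 2))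
    (hΓ : ∀ j ≤ N, ∀ y, ‖iteratedFDeriv ℝ j γ y‖ ≤ Γ) (hΓ0 : 0 < Γ)
    {σ K : ℝ} (hσ : 1 ≤ σ) (hK : 0 ≤ K) {h : E → ℂ} (hh : ContDiff ℝ (⊤ : ℕ∞) h)
    (hhb : ∀ j ≤ N, ∀ z, ‖iteratedFDeriv ℝ j h z‖ ≤ K * wt N σ z) (p x : E) :
    ContDiff ℝ (⊤ : ℕ∞) (fun y => γ (y - p) * h (y - x)) ∧
    HasCompactSupport (fun y => γ (y - p) * h (y - x)) ∧
    tsupport (fun y => γ (y - p) * h (y - x)) ⊆ Metric.ball p 1 ∧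
    ∀ j ≤ N, ∀ y, ‖iteratedFDeriv ℝ j (fun y => γ (y - p) * h (y - x)) y‖ ≤
      2 ^ N * (Γ * (K * (2 ^ N * wt N σ (p - x)))) := by
  have hσ0 : 0 < σ := by linarith
  have hg1 : ContDiff ℝ (⊤ : ℕ∞) (fun y => γ (y - p)) := hγ.comp (contDiff_id.sub contDiff_const)
  have hh1 : ContDiff ℝ (⊤ : ℕ∞) (fun y => h (y - x)) := hh.comp (contDiff_id.sub contDiff_const)
  have hsub : tsupport (fun y => γ (y - p) * h (y - x)) ⊆ Metric.closedBall p (1 / 2) := by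
    apply closure_minimal _ Metric.isClosed_closedBall
    intro y hy
    have h1 : γ (y - p) ≠ 0 := fun h0 => hy (by simp [h0])
    have h2 := hts (subset_closure (Function.mem_support.2 h1))
    rw [mem_closedBall_zero_iff] at h2
    rwa [Metric.mem_closedBall, dist_eq_norm]
  refine ⟨hg1.mul hh1, ?_, ?_, ?_⟩
  · exact (isCompact_closedBall p (1 / 2)).of_isClosed_subset (isClosed_tsupport _) hsub
  · exact hsub.trans (Metric.closedBall_subset_ball (by norm_num))
  · intro j hj y
    have hw0 := wt_nonneg N hσ0 (p - x)
    by_cases hy : y ∈ Metric.closedBall p (1 / 2)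
    · rw [Metric.mem_closedBall, dist_eq_norm] at hy
      have h1 := norm_iteratedFDeriv_mul_bound (n := j) (y := y) isOpen_univ hg1.contDiffOn hh1
        (Set.mem_univ y) (κ := Γ) (M := K * (2 ^ N * wt N σ (p - x)))
        (fun i hi => by
          rw [iteratedFDeriv_comp_sub]; exact hΓ i (hi.trans hj) _)
        (fun i hi => by
          rw [iteratedFDeriv_comp_sub]
          refine (hhb i (hi.trans hj) _).trans ?_
          gcongr
          refine wt_shift N hσ _ _ ?_
          rw [sub_sub_sub_cancel_right]; linarith)
      refine h1.trans ?_
      gcongr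
      · norm_num
    · have : y ∉ tsupport (iteratedFDeriv ℝ j (fun y => γ (y - p) * h (y - x))) := fun hc =>
        hy (hsub (tsupport_iteratedFDeriv_subset (𝕜 := ℝ) j hc))
      rw [image_eq_zero_of_notMem_tsupport this, norm_zero]
      positivity

lemma fubini_bump (ν : Measure E) [ν.IsAddHaarMeasure] {γ F : E → ℂ} (hγ : Integrable γ ν)
    (h1 : ∫ x, γ x ∂ν = 1) (hev : ∀ x, γ (-x) = γ x) (hF : Integrable F ν) :
    ∫ y, F y ∂ν = ∫ p, ∫ y, F y * γ (y - p) ∂ν ∂ν := by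
  have hint := Integrable.convolution_integrand (ContinuousLinearMap.mul ℝ ℂ) hF hγ
  have := integral_integral_swap (f := fun p y => F y * γ (p - y)) (μ := ν) (ν := ν) hint
  have h2 : ∀ p, ∫ y, F y * γ (y - p) ∂ν = ∫ y, F y * γ (p - y) ∂ν := fun p =>
    integral_congr_ae (Filter.Eventually.of_forall fun y => by
      simp only; rw [← hev, neg_sub])
  simp_rw [h2]
  rw [this]
  refine integral_congr_ae (Filter.Eventually.of_forall fun y => ?_)
  simp only
  rw [integral_const_mul, integral_sub_right_eq_self γ y, h1, mul_one]

lemma main_conv (m : ℝ) (hm : 2 ≤ m) (μ : E → ℝ)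
    (hsmooth : ContDiffOn ℝ (⊤ : ℕ∞) μ {x | x ≠ 0})
    (hhom : ∀ c : ℝ, 0 < c → ∀ x : E, x ≠ 0 → μ (c • x) = c ^ m • μ x)
    (hhess : ∀ x : E, ‖x‖ = 1 → Function.Injective (fderiv ℝ (fderiv ℝ μ) x))
    (ν : Measure E) [ν.IsAddHaarMeasure] :
    ∃ C : ℝ, 0 ≤ C ∧ ∀ (t : ℝ), 0 < t → t ≤ 1 → ∀ (ξ : E) (σ K : ℝ), 1 ≤ σ → 0 ≤ K →
      ∀ h : E → ℂ, ContDiff ℝ (⊤ : ℕ∞) h →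
      (∀ j ≤ Module.finrank ℝ E + 1, ∀ z,
        ‖iteratedFDeriv ℝ j h z‖ ≤ K * wt (Module.finrank ℝ E + 1) σ z) →
      ∫⁻ x, ‖∫ y, Complex.exp (((2 * π * (t * μ y - ⟪ξ, y⟫) : ℝ) : ℂ) * Complex.I) *
        h (y - x) ∂ν‖ₑ ∂ν ≤
        ENNReal.ofReal (C * K * σ ^ Module.finrank ℝ E *
          (t ^ (-(2 / m))) ^ Module.finrank ℝ E) := by
  set n := Module.finrank ℝ E with hn
  set N := n + 1 with hN
  obtain ⟨I, C, hC, hkey⟩ := key_bound N m hm μ hsmooth hhom hhess ν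
  obtain ⟨S, hS0, hS⟩ := wt_lintegral (E := E) ν
  rw [← hn, ← hN] at hS
  obtain ⟨γ, Γ, hΓ, hγs, hγc, hγt, hγi, hγ1, hγev, hγb⟩ := exists_bump N ν
  have hμmeas : Measurable μ := measurable_of_continuousOn_compl_singleton 0
    (hsmooth.continuousOn)
  refine ⟨C * (2 ^ N * (Γ * 2 ^ N)) * S * S * (1 + I.card), by positivity, ?_⟩
  intro t ht ht1 ξ σ K hσ hK h hh hhb
  obtain ⟨cen, hcen⟩ := hkey t ht ht1 ξ
  have hσ0 : 0 < σ := by linarith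
  have hT : 0 < t ^ (-(2 / m)) := Real.rpow_pos_of_pos ht _
  set T := t ^ (-(2 / m)) with hTd
  set G : E → ℂ := fun y =>
    Complex.exp (((2 * π * (t * μ y - ⟪ξ, y⟫) : ℝ) : ℂ) * Complex.I) with hG
  have hGm : Measurable G := by
    have h1 : Measurable fun y : E => 2 * π * (t * μ y - ⟪ξ, y⟫) := by
      have h2 : Measurable fun y : E => ⟪ξ, y⟫ := by
        have : Continuous fun y : E => ⟪ξ, y⟫ := by fun_prop
        exact this.measurable
      exact ((hμmeas.const_mul t).sub h2).const_mul _
    exact ((Complex.measurable_ofReal.comp h1).mul_const _).cexp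
  have hGn : ∀ y, ‖G y‖ = 1 := fun y => Complex.norm_exp_ofReal_mul_I _
  have hwi : Integrable (wt N σ : E → ℝ) ν := by
    refine ⟨(continuous_wt N hσ0).aestronglyMeasurable, ?_⟩
    rw [hasFiniteIntegral_iff_ofReal (Filter.Eventually.of_forall (wt_nonneg N hσ0)), hS σ hσ0]
    exact ENNReal.ofReal_lt_top
  have hhi : Integrable h ν := by
    refine (hwi.const_mul K).mono' hh.continuous.aestronglyMeasurable
      (Filter.Eventually.of_forall fun z => ?_)
    have := hhb 0 (Nat.zero_le _) z
    rwa [norm_iteratedFDeriv_zero] at this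
  have hFi : ∀ x, Integrable (fun y => G y * h (y - x)) ν := fun x =>
    (hhi.comp_sub_right x).bdd_mul (c := 1) hGm.aestronglyMeasurable
      (Filter.Eventually.of_forall fun y => (hGn y).le)
  set A : ℝ := C * (2 ^ N * (Γ * (K * 2 ^ N))) with hA
  have hA0 : 0 ≤ A := by positivity
  set W : E → ℝ := fun p => wt N T p + ∑ u ∈ I, wt N T (p - cen u) with hW
  have hW0 : ∀ p, 0 ≤ W p := fun p =>
    add_nonneg (wt_nonneg N hT p) (Finset.sum_nonneg fun u _ => wt_nonneg N hT _)
  have hWc : Continuous W := (continuous_wt N hT).add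
    (continuous_finsetSum _ fun u _ => (continuous_wt N hT).comp (continuous_id.sub continuous_const))
  have hpt : ∀ x, ‖∫ y, G y * h (y - x) ∂ν‖ₑ ≤
      ∫⁻ p, ENNReal.ofReal A * (ENNReal.ofReal (W p) * ENNReal.ofReal (wt N σ (p - x))) ∂ν := by
    intro x
    rw [fubini_bump ν hγi hγ1 hγev (hFi x)]
    refine (enorm_integral_le_lintegral_enorm _).trans (lintegral_mono fun p => ?_)
    obtain ⟨q1, q2, q3, q4⟩ := piece_bound N hγs hγt hγb hΓ hσ hK hh hhb p x
    have hb := hcen p _ q1 q2 q3 _ q4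
    rw [← ENNReal.ofReal_mul (hW0 p), ← ENNReal.ofReal_mul hA0, ← ofReal_norm]
    apply ENNReal.ofReal_le_ofReal
    have e1 : ∫ y, G y * h (y - x) * γ (y - p) ∂ν = ∫ y, G y * (γ (y - p) * h (y - x)) ∂ν :=
      integral_congr_ae (Filter.Eventually.of_forall fun y => by simp only; ring)
    rw [e1]
    refine hb.trans (le_of_eq ?_)
    simp only [hA, hW]; ring
  calc _ ≤ ∫⁻ x, ∫⁻ p, ENNReal.ofReal A *
        (ENNReal.ofReal (W p) * ENNReal.ofReal (wt N σ (p - x))) ∂ν ∂ν := lintegral_mono hpt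
    _ = ∫⁻ p, ∫⁻ x, ENNReal.ofReal A *
        (ENNReal.ofReal (W p) * ENNReal.ofReal (wt N σ (p - x))) ∂ν ∂ν := by
      apply lintegral_lintegral_swap
      apply Measurable.aemeasurable
      have m1 : Measurable fun q : E × E => W q.2 := (hWc.comp continuous_snd).measurable
      have m2 : Measurable fun q : E × E => wt N σ (q.2 - q.1) :=
        ((continuous_wt N hσ0).comp (continuous_snd.sub continuous_fst)).measurable
      exact (m1.ennreal_ofReal.mul m2.ennreal_ofReal).const_mul _
    _ = ∫⁻ p, ENNReal.ofReal A * (ENNReal.ofReal (W p) * ENNReal.ofReal (σ ^ n * S)) ∂ν := by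
      refine lintegral_congr fun p => ?_
      rw [lintegral_const_mul' _ _ ENNReal.ofReal_ne_top,
        lintegral_const_mul' _ _ ENNReal.ofReal_ne_top,
        lintegral_sub_left_eq_self (fun z => ENNReal.ofReal (wt N σ z)) p, hS σ hσ0]
    _ = ENNReal.ofReal A * ((∫⁻ p, ENNReal.ofReal (W p) ∂ν) * ENNReal.ofReal (σ ^ n * S)) := by
      rw [lintegral_const_mul' _ _ ENNReal.ofReal_ne_top,
        lintegral_mul_const' _ _ ENNReal.ofReal_ne_top]
    _ = ENNReal.ofReal A * (ENNReal.ofReal ((1 + I.card) * (T ^ n * S)) *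
          ENNReal.ofReal (σ ^ n * S)) := by
      congr 2
      have e : ∀ p, ENNReal.ofReal (W p) = ENNReal.ofReal (wt N T p) +
          ∑ u ∈ I, ENNReal.ofReal (wt N T (p - cen u)) := fun p => by
        simp only [hW]
        rw [ENNReal.ofReal_add (wt_nonneg N hT p)
          (Finset.sum_nonneg fun u _ => wt_nonneg N hT _),
          ENNReal.ofReal_sum_of_nonneg (fun u _ => wt_nonneg N hT _)]
      simp_rw [e]
      have mw : Measurable (wt N T : E → ℝ) := (continuous_wt N hT).measurable
      have mm : ∀ u : E, Measurable fun p : E => ENNReal.ofReal (wt N T (p - cen u)) := fun u =>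
        (mw.comp (measurable_id.sub_const (cen u))).ennreal_ofReal
      rw [lintegral_add_left mw.ennreal_ofReal, lintegral_finsetSum _ (fun u _ => mm u)]
      have e2 : ∀ u ∈ I, ∫⁻ p, ENNReal.ofReal (wt N T (p - cen u)) ∂ν =
          ENNReal.ofReal (T ^ n * S) := fun u _ => by
        rw [lintegral_sub_right_eq_self (fun z => ENNReal.ofReal (wt N T z)) (cen u), hS T hT]
      rw [Finset.sum_congr rfl e2, hS T hT, Finset.sum_const, nsmul_eq_mul, add_mul,
        ENNReal.ofReal_add (by positivity) (by positivity), one_mul,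
        ENNReal.ofReal_mul (p := (I.card : ℝ)) (by positivity), ENNReal.ofReal_natCast]
    _ ≤ _ := by
      rw [← ENNReal.ofReal_mul (by positivity), ← ENNReal.ofReal_mul hA0]
      apply ENNReal.ofReal_le_ofReal
      apply le_of_eq
      simp only [hA]; ring

end Assembly

section Final

lemma schwartz_scaled {E : Type} [NormedAddCommGroup E] [InnerProductSpace ℝ E]
    [FiniteDimensional ℝ E] (g : SchwartzMap E ℂ) (N : ℕ) :
    ∃ K : ℝ, 0 ≤ K ∧ ∀ L : ℝ, 1 ≤ L →
      ContDiff ℝ (⊤ : ℕ∞) (fun z : E => (starRingEnd ℂ) (g (L⁻¹ • z))) ∧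
      ∀ j ≤ N, ∀ z : E,
        ‖iteratedFDeriv ℝ j (fun z : E => (starRingEnd ℂ) (g (L⁻¹ • z))) z‖ ≤ K * wt N L z := by
  refine ⟨2 ^ N * ((Finset.Iic (N, N)).sup fun m => SchwartzMap.seminorm ℝ m.1 m.2) g,
    by positivity, fun L hL => ?_⟩
  have hL0 : 0 < L := by linarith
  have hgs : ContDiff ℝ (⊤ : ℕ∞) g := g.smooth _
  have h1 : ContDiff ℝ (⊤ : ℕ∞) (fun z : E => g (L⁻¹ • z)) :=
    hgs.comp (contDiff_const_smul _)
  refine ⟨Complex.conjCLE.contDiff.comp h1, fun j hj z => ?_⟩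
  have h2 := LinearIsometryEquiv.norm_iteratedFDeriv_comp_left (𝕜 := ℝ) Complex.conjLIE
    (fun z : E => g (L⁻¹ • z)) z j
  have h3 : (⇑Complex.conjLIE ∘ fun z : E => g (L⁻¹ • z)) =
    fun z : E => (starRingEnd ℂ) (g (L⁻¹ • z)) := by
    ext z; simp
  rw [h3] at h2
  rw [h2, iteratedFDeriv_comp_const_smul _ (g.smooth j)]
  have h4 := SchwartzMap.one_add_le_sup_seminorm_apply (𝕜 := ℝ) (m := (N, N)) (k := N) (n := j)
    le_rfl hj g (L⁻¹ • z)
  simp only at h4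
  rw [norm_smul]
  have h5 : ‖L⁻¹ ^ j‖ ≤ 1 := by
    rw [norm_pow, norm_inv, Real.norm_eq_abs, abs_of_pos hL0]
    exact pow_le_one₀ (by positivity) (inv_le_one_of_one_le₀ hL)
  have h6 : ‖L⁻¹ • z‖ = ‖z‖ / L := by
    rw [norm_smul, norm_inv, Real.norm_eq_abs, abs_of_pos hL0, div_eq_inv_mul]
  rw [h6] at h4
  unfold wt
  rw [← div_eq_mul_inv, le_div_iff₀ (by positivity)]
  calc _ ≤ 1 * ‖iteratedFDeriv ℝ j g (L⁻¹ • z)‖ * (1 + ‖z‖ / L) ^ N := by gcongr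
    _ ≤ _ := by rw [one_mul, mul_comm]; exact h4

lemma scaled_bound (d : ℕ) (hd : 1 ≤ d) (m : ℝ) (hm : 2 ≤ m)
    (μ : EuclideanSpace ℝ (Fin d) → ℝ)
    (hsmooth : ContDiffOn ℝ (⊤ : ℕ∞) μ {x | x ≠ 0})
    (hhom : ∀ c : ℝ, 0 < c → ∀ x : EuclideanSpace ℝ (Fin d), x ≠ 0 →
      μ (c • x) = c ^ m * μ x)
    (hhess : ∀ x : EuclideanSpace ℝ (Fin d), ‖x‖ = 1 →
      Function.Bijective ⇑(fderiv ℝ (fderiv ℝ μ) x))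
    (Ftμ : ℝ → EuclideanSpace ℝ (Fin d) → ℂ)
    (hFtμ : ∀ t : ℝ, ∀ y : EuclideanSpace ℝ (Fin d), y ≠ 0 →
      Ftμ t y = Complex.exp (((2 * Real.pi * (t * μ y) : ℝ) : ℂ) * Complex.I))
    (g : SchwartzMap (EuclideanSpace ℝ (Fin d)) ℂ) :
    ∃ C : ℝ, 0 < C ∧ ∀ s L : ℝ, 0 < s → s ≤ 1 → 1 ≤ L → ∀ ξ : EuclideanSpace ℝ (Fin d),
      (∫⁻ x : EuclideanSpace ℝ (Fin d),
        ‖∫ (y : EuclideanSpace ℝ (Fin d)),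
            Complex.exp (-(((2 * Real.pi * ⟪ξ, y⟫ : ℝ) : ℂ) * Complex.I)) * Ftμ (s * L ^ m) y *
              (starRingEnd ℂ) (g (y - x))‖ₑ ∂volume) ≤
      ENNReal.ofReal (C * ((L ^ d)⁻¹ * (s ^ (-(2 / m))) ^ d)) := by
  have hfr : Module.finrank ℝ (EuclideanSpace ℝ (Fin d)) = d := finrank_euclideanSpace_fin
  obtain ⟨C, hC, hconv⟩ := main_conv m hm μ hsmooth hhom (fun x hx => (hhess x hx).1) volume
  rw [hfr] at hconv
  obtain ⟨K, hK, hg⟩ := schwartz_scaled g (d + 1)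
  refine ⟨C * K + 1, by positivity, fun s L hs hs1 hL ξ => ?_⟩
  have hL0 : 0 < L := by linarith
  obtain ⟨hh, hhb⟩ := hg L hL
  have hmain := hconv s hs hs1 (L⁻¹ • ξ) L K hL hK _ hh hhb
  set h : EuclideanSpace ℝ (Fin d) → ℂ := fun z => (starRingEnd ℂ) (g (L⁻¹ • z)) with hhd
  set Φ : EuclideanSpace ℝ (Fin d) → EuclideanSpace ℝ (Fin d) → ℂ := fun w z =>
    Complex.exp (((2 * π * (s * μ z - ⟪L⁻¹ • ξ, z⟫) : ℝ) : ℂ) * Complex.I) * h (z - w) with hΦ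
  haveI : Nonempty (Fin d) := ⟨⟨0, hd⟩⟩
  have hae : ∀ᵐ y : EuclideanSpace ℝ (Fin d), y ≠ 0 := by
    have : (volume : Measure (EuclideanSpace ℝ (Fin d))) {0} = 0 := measure_singleton 0
    exact compl_mem_ae_iff.2 this
  have hin : ∀ x : EuclideanSpace ℝ (Fin d), ∫ (y : EuclideanSpace ℝ (Fin d)),
            Complex.exp (-(((2 * Real.pi * ⟪ξ, y⟫ : ℝ) : ℂ) * Complex.I)) * Ftμ (s * L ^ m) y *
              (starRingEnd ℂ) (g (y - x)) = (L ^ d)⁻¹ • ∫ z, Φ (L • x) z := by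
    intro x
    have h1 := Measure.integral_comp_smul volume (Φ (L • x)) L
    rw [hfr, abs_of_pos (by positivity)] at h1
    rw [← h1]
    refine integral_congr_ae ?_
    filter_upwards [hae] with y hy
    simp only [hΦ, hhd]
    rw [hFtμ _ y hy, ← smul_sub, smul_smul, inv_mul_cancel₀ hL0.ne', one_smul, ← Complex.exp_add,
      hhom L hL0 y hy, real_inner_smul_left, real_inner_smul_right]
    congr 2
    have : s * (L ^ m * μ y) - L⁻¹ * (L * ⟪ξ, y⟫) = s * L ^ m * μ y - ⟪ξ, y⟫ := by
      field_simp
    rw [this]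
    push_cast
    ring
  simp_rw [hin]
  have he : ∀ x : EuclideanSpace ℝ (Fin d), ‖(L ^ d)⁻¹ • ∫ z, Φ (L • x) z‖ₑ =
      ENNReal.ofReal ((L ^ d)⁻¹) * ‖∫ z, Φ (L • x) z‖ₑ := fun x => by
    rw [enorm_smul, Real.enorm_eq_ofReal (by positivity)]
  simp_rw [he]
  rw [lintegral_const_mul' _ _ ENNReal.ofReal_ne_top,
    lint_comp_smul volume hL0 (fun w => ‖∫ z, Φ w z‖ₑ), hfr]
  have hi : 0 ≤ (L ^ d)⁻¹ := by positivity
  calc _ ≤ ENNReal.ofReal ((L ^ d)⁻¹) * (ENNReal.ofReal ((L ^ d)⁻¹) *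
        ENNReal.ofReal (C * K * L ^ d * (s ^ (-(2 / m))) ^ d)) := by gcongr
    _ ≤ _ := by
      rw [← ENNReal.ofReal_mul hi, ← ENNReal.ofReal_mul hi]
      apply ENNReal.ofReal_le_ofReal
      have hs' : 0 ≤ (s ^ (-(2 / m))) ^ d := by positivity
      have e : (L ^ d)⁻¹ * ((L ^ d)⁻¹ * (C * K * L ^ d * (s ^ (-(2 / m))) ^ d)) =
        C * K * ((L ^ d)⁻¹ * (s ^ (-(2 / m))) ^ d) := by
        field_simp
      rw [e]
      gcongr
      linarith

end Final

/-- Under hypotheses (H), the dispersive bound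
`sup_ξ ∫ |V_g F_{tμ}(x,ξ)| dx ≤ C max{t^{-d/m}, t^{-2d/m}}` holds for all `t > 0`, where
`F_{tμ}(y) = e^{2πitμ(y)}` (with `F_{tμ}(0) = 1`); i.e. the fundamental solution of the free
higher-order dispersive equation satisfies `‖E(t,·)‖_{W^{1,∞}} ≤ C max{t^{-2d/m}, t^{-d/m}}`. -/
theorem fresnel_time_dispersive_bound (d : ℕ) (hd : 1 ≤ d) (m : ℝ) (hm : 2 ≤ m)
    (μ : EuclideanSpace ℝ (Fin d) → ℝ)
    (hsmooth : ContDiffOn ℝ (⊤ : ℕ∞) μ {x | x ≠ 0})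
    (hhom : ∀ c : ℝ, 0 < c → ∀ x : EuclideanSpace ℝ (Fin d), x ≠ 0 →
      μ (c • x) = c ^ m * μ x)
    (hhess : ∀ x : EuclideanSpace ℝ (Fin d), ‖x‖ = 1 →
      Function.Bijective ⇑(fderiv ℝ (fderiv ℝ μ) x))
    (Ftμ : ℝ → EuclideanSpace ℝ (Fin d) → ℂ)
    (hFtμ : ∀ t : ℝ, ∀ y : EuclideanSpace ℝ (Fin d), y ≠ 0 →
      Ftμ t y = Complex.exp (((2 * Real.pi * (t * μ y) : ℝ) : ℂ) * Complex.I))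
    (hFtμ0 : ∀ t : ℝ, Ftμ t 0 = 1)
    (g : SchwartzMap (EuclideanSpace ℝ (Fin d)) ℂ) (hg : g ≠ 0) :
    ∃ C : ℝ, 0 < C ∧ ∀ t : ℝ, 0 < t → ∀ ξ : EuclideanSpace ℝ (Fin d),
      (∫⁻ x : EuclideanSpace ℝ (Fin d),
        (‖∫ (y : EuclideanSpace ℝ (Fin d)),
            Complex.exp (-(((2 * Real.pi * ⟪ξ, y⟫ : ℝ) : ℂ) * Complex.I)) * Ftμ t y *
              (starRingEnd ℂ) (g (y - x))‖₊ : ℝ≥0∞) ∂volume) ≤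
      ENNReal.ofReal (C * max (t ^ (-((d : ℝ) / m))) (t ^ (-(2 * (d : ℝ) / m)))) := by
  obtain ⟨C, hC, hb⟩ := scaled_bound d hd m hm μ hsmooth hhom hhess Ftμ hFtμ g
  have hm0 : 0 < m := by linarith
  refine ⟨C, hC, fun t ht ξ => ?_⟩
  rcases le_total t 1 with ht1 | ht1
  · have h := hb t 1 ht ht1 le_rfl ξ
    simp only [Real.one_rpow, mul_one, one_pow, inv_one, one_mul] at h
    refine le_trans h (ENNReal.ofReal_le_ofReal ?_)
    gcongr
    refine le_trans (le_of_eq ?_) (le_max_right _ _)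
    rw [← Real.rpow_natCast, ← Real.rpow_mul ht.le]
    congr 1
    ring
  · have hL : 1 ≤ t ^ (1 / m) := Real.one_le_rpow ht1 (by positivity)
    have h := hb 1 (t ^ (1 / m)) one_pos le_rfl hL ξ
    have e1 : (t ^ (1 / m)) ^ m = t := by
      rw [← Real.rpow_mul ht.le, one_div_mul_cancel hm0.ne', Real.rpow_one]
    rw [e1] at h
    simp only [Real.one_rpow, mul_one, one_pow, one_mul] at h
    refine le_trans h (ENNReal.ofReal_le_ofReal ?_)
    gcongr
    refine le_trans (le_of_eq ?_) (le_max_left _ _)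
    rw [← Real.rpow_natCast, ← Real.rpow_mul ht.le, ← Real.rpow_neg ht.le]
    congr 1
    ring
end
end

section
/- Let m ≥ 2 and μ ∈ A^m(ℝ^d), and let F_μ(y) = e^{2πiμ(y)}. Let g be a smooth compactly supported function on ℝ^d with supp(g) contained in the closed unit ball. Then there exists A > 0 such that for every N ≥ 0 there exists C > 0 with the following property: for all (x,ξ) ∈ ℝ^d × ℝ^d with |ξ − ∇μ(x)| ≥ A|x|^{m−2}, one has |V_g F_μ(x,ξ)| ≤ C ⟨ξ − ∇μ(x)⟩^{-N}. -/
open MeasureTheory Real Complex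
open scoped ENNReal RealInnerProductSpace
noncomputable section

section fam
variable {E : Type*} [NormedAddCommGroup E] [NormedSpace ℝ E] {ι : Type*}

def DD (u : ι → E) (F : ι → E → ℂ) : ι → E → ℂ := fun p y => fderiv ℝ (F p) y (u p)

def Bdd0 (U : ι → Set E) (F : ι → E → ℂ) : Prop := ∃ C : ℝ, ∀ p, ∀ y ∈ U p, ‖F p y‖ ≤ C

def Good (u : ι → E) (U : ι → Set E) : ℕ → (ι → E → ℂ) → Prop
  | 0, F => Bdd0 U F
  | n+1, F => Bdd0 U F ∧ Good u U n (DD u F)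

def Smo (U : ι → Set E) (F : ι → E → ℂ) : Prop := ∀ p, ContDiffOn ℝ (⊤ : ℕ∞) (F p) (U p)

variable {u : ι → E} {U : ι → Set E}

lemma Good.bdd {n : ℕ} {F : ι → E → ℂ} (h : Good u U n F) : Bdd0 U F := by
  cases n with
  | zero => exact h
  | succ n => exact h.1

lemma Good.pred {n : ℕ} {F : ι → E → ℂ} (h : Good u U (n+1) F) : Good u U n F := by
  induction n generalizing F with
  | zero => exact h.1
  | succ n ih => exact ⟨h.1, ih h.2⟩

lemma Good.congr (hU : ∀ p, IsOpen (U p)) {n : ℕ} {F G : ι → E → ℂ} (h : Good u U n F)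
    (hFG : ∀ p, ∀ y ∈ U p, F p y = G p y) : Good u U n G := by
  have key : ∀ {F G : ι → E → ℂ}, Bdd0 U F → (∀ p, ∀ y ∈ U p, F p y = G p y) → Bdd0 U G := by
    rintro F G ⟨C, hC⟩ h
    exact ⟨C, fun p y hy => by rw [← h p y hy]; exact hC p y hy⟩
  induction n generalizing F G with
  | zero => exact key h hFG
  | succ n ih =>
    refine ⟨key h.1 hFG, ih h.2 ?_⟩
    intro p y hy
    have : F p =ᶠ[nhds y] G p := by
      filter_upwards [(hU p).mem_nhds hy] with z hz using hFG p z hz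
    simp only [DD, this.fderiv_eq]

lemma Smo.diffAt (hU : ∀ p, IsOpen (U p)) {F : ι → E → ℂ} (h : Smo U F) {p : ι} {y : E} (hy : y ∈ U p) :
    DifferentiableAt ℝ (F p) y :=
  ((h p).contDiffAt ((hU p).mem_nhds hy)).differentiableAt (by simp)

lemma Smo.dd (hU : ∀ p, IsOpen (U p)) {F : ι → E → ℂ} (h : Smo U F) : Smo U (DD u F) := by
  intro p
  exact ((h p).fderiv_of_isOpen (hU p) (m := (⊤ : ℕ∞)) (by simp)).clm_apply contDiffOn_const

lemma Smo.mul {F G : ι → E → ℂ} (hF : Smo U F) (hG : Smo U G) :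
    Smo U (fun p y => F p y * G p y) := fun p => (hF p).mul (hG p)

lemma Good.add (hU : ∀ p, IsOpen (U p)) {n : ℕ} {F G : ι → E → ℂ} (hF : Good u U n F) (hG : Good u U n G)
    (sF : Smo U F) (sG : Smo U G) : Good u U n (fun p y => F p y + G p y) := by
  have key : ∀ {F G : ι → E → ℂ}, Bdd0 U F → Bdd0 U G → Bdd0 U (fun p y => F p y + G p y) := by
    rintro F G ⟨C, hC⟩ ⟨C', hC'⟩
    exact ⟨C + C', fun p y hy => (norm_add_le _ _).trans (add_le_add (hC p y hy) (hC' p y hy))⟩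
  induction n generalizing F G with
  | zero => exact key hF hG
  | succ n ih =>
    refine ⟨key hF.1 hG.1, (ih hF.2 hG.2 (sF.dd hU) (sG.dd hU)).congr hU ?_⟩
    intro p y hy
    simp only [DD]
    rw [fderiv_fun_add (sF.diffAt hU hy) (sG.diffAt hU hy)]
    rfl

lemma Good.mul (hU : ∀ p, IsOpen (U p)) {n : ℕ} {F G : ι → E → ℂ} (hF : Good u U n F) (hG : Good u U n G)
    (sF : Smo U F) (sG : Smo U G) : Good u U n (fun p y => F p y * G p y) := by
  have key : ∀ {F G : ι → E → ℂ}, Bdd0 U F → Bdd0 U G → Bdd0 U (fun p y => F p y * G p y) := by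
    rintro F G ⟨C, hC⟩ ⟨C', hC'⟩
    refine ⟨C * C', fun p y hy => ?_⟩
    rw [norm_mul]
    exact mul_le_mul (hC p y hy) (hC' p y hy) (norm_nonneg _) ((norm_nonneg _).trans (hC p y hy))
  induction n generalizing F G with
  | zero => exact key hF hG
  | succ n ih =>
    refine ⟨key hF.1 hG.1, ((ih hF.pred hG.2 sF (sG.dd hU)).add hU
      (ih hG.pred hF.2 sG (sF.dd hU)) (sF.mul (sG.dd hU)) (sG.mul (sF.dd hU))).congr hU ?_⟩
    intro p y hy
    simp only [DD]
    rw [fderiv_fun_mul (sF.diffAt hU hy) (sG.diffAt hU hy)]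
    simp

lemma Good.inv (hU : ∀ p, IsOpen (U p)) {n : ℕ} {a : ι → E → ℂ} (ha : ∀ n, Good u U n a) (sa : Smo U a)
    (h0 : ∀ p, ∀ y ∈ U p, 1/2 ≤ ‖a p y‖) : Good u U n (fun p y => (a p y)⁻¹) := by
  have hne : ∀ p, ∀ y ∈ U p, a p y ≠ 0 := by
    intro p y hy h
    have := h0 p y hy
    rw [h, norm_zero] at this
    norm_num at this
  have hb : Bdd0 U (fun p y => (a p y)⁻¹) := by
    refine ⟨2, fun p y hy => ?_⟩
    rw [norm_inv]
    have := h0 p y hy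
    exact inv_le_of_inv_le₀ (by norm_num) (by linarith)
  have sb : Smo U (fun p y => (a p y)⁻¹) := fun p => (sa p).inv (hne p)
  have sm : Smo U (fun (p : ι) (y : E) => (-1 : ℂ)) := fun p => contDiffOn_const
  have gm : ∀ n, Good u U n (fun (p : ι) (y : E) => (-1 : ℂ)) := by
    have hc : ∀ n (c : ℂ), Good u U n (fun (p : ι) (y : E) => c) := by
      intro n
      induction n with
      | zero => exact fun c => ⟨‖c‖, fun _ _ _ => le_rfl⟩
      | succ n ih =>
        refine fun c => ⟨⟨‖c‖, fun _ _ _ => le_rfl⟩, (ih 0).congr hU ?_⟩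
        intro p y hy
        simp [DD]
    exact fun n => hc n _
  induction n with
  | zero => exact hb
  | succ n ih =>
    refine ⟨hb, ((gm n).mul hU ((ih.mul hU ih sb sb).mul hU (ha (n+1)).2 (sb.mul sb) (sa.dd hU))
      sm ((sb.mul sb).mul (sa.dd hU))).congr hU ?_⟩
    intro p y hy
    have h1 : HasFDerivAt (a p) (fderiv ℝ (a p) y) y := (sa.diffAt hU hy).hasFDerivAt
    have h2 := (hasFDerivAt_inv' (𝕜 := ℝ) (hne p y hy)).comp y h1
    have h3 : fderiv ℝ (fun y => (a p y)⁻¹) y = _ := h2.fderiv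
    simp only [DD]
    rw [h3]
    simp
    ring
end fam

section fam2
variable {E : Type*} [NormedAddCommGroup E] [NormedSpace ℝ E] {ι : Type*}

lemma hasFDerivAt_iter {V : Type*} [NormedAddCommGroup V] [NormedSpace ℝ V] {h : E → V}
    (hh : ContDiff ℝ (⊤ : ℕ∞) h) (k : ℕ) (v y : E) :
    DifferentiableAt ℝ (fun y => iteratedFDeriv ℝ k h y (fun _ => v)) y ∧
    fderiv ℝ (fun y => iteratedFDeriv ℝ k h y (fun _ => v)) y v =
      iteratedFDeriv ℝ (k+1) h y (fun _ => v) := by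
  have h1 : DifferentiableAt ℝ (iteratedFDeriv ℝ k h) y :=
    (hh.differentiable_iteratedFDeriv (m := k) (by exact_mod_cast ENat.natCast_lt_top k)) y
  have h2 := h1.hasFDerivAt.continuousMultilinear_apply_const (fun _ => v)
  refine ⟨h2.differentiableAt, ?_⟩
  rw [h2.fderiv, iteratedFDeriv_succ_apply_left]
  rfl

lemma good_iter {u : ι → E} {U : ι → Set E} (hU : ∀ p, IsOpen (U p)) (hu : ∀ p, ‖u p‖ ≤ 1)
    (H : ι → E → ℂ) (hH : ∀ p, ContDiff ℝ (⊤ : ℕ∞) (H p)) (s : ι → ℂ) (k₀ : ℕ)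
    (hb : ∀ k, k₀ ≤ k → ∃ C : ℝ, ∀ p, ∀ y ∈ U p, ‖s p‖ * ‖iteratedFDeriv ℝ k (H p) y‖ ≤ C)
    (n k : ℕ) (hk : k₀ ≤ k) :
    Good u U n (fun p y => s p * iteratedFDeriv ℝ k (H p) y (fun _ => u p)) := by
  have key : ∀ k, k₀ ≤ k → Bdd0 U (fun p y => s p * iteratedFDeriv ℝ k (H p) y (fun _ => u p)) := by
    intro k hk
    obtain ⟨C, hC⟩ := hb k hk
    refine ⟨C, fun p y hy => le_trans ?_ (hC p y hy)⟩
    rw [norm_mul]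
    refine mul_le_mul_of_nonneg_left ?_ (norm_nonneg _)
    refine ((iteratedFDeriv ℝ k (H p) y).le_opNorm _).trans ?_
    refine mul_le_of_le_one_right (norm_nonneg _) ?_
    exact Finset.prod_le_one (fun _ _ => norm_nonneg _) (fun _ _ => hu p)
  induction n generalizing k with
  | zero => exact key k hk
  | succ n ih =>
    refine ⟨key k hk, (ih (k+1) (by omega)).congr hU ?_⟩
    intro p y hy
    obtain ⟨h1, h2⟩ := hasFDerivAt_iter (hH p) k (u p) y
    simp only [DD]
    rw [fderiv_const_mul h1]
    simp [h2]

variable [FiniteDimensional ℝ E] [MeasurableSpace E] [BorelSpace E] (ν : Measure E)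
  [ν.IsAddHaarMeasure]

lemma osc_decay (u c : ι → E) (lam : ι → ℝ) (hlam : ∀ p, 0 < lam p) (φ : ι → E → ℝ)
    (hφ : ∀ p, ContDiff ℝ (⊤ : ℕ∞) (φ p)) (a : ι → E → ℂ)
    (hφa : ∀ p y, ((fderiv ℝ (φ p) y (u p) : ℝ) : ℂ) = -(lam p : ℂ) * a p y)
    (sa : ∀ p, ContDiff ℝ (⊤ : ℕ∞) (a p))
    (ha0 : ∀ p, ∀ y ∈ Metric.ball (c p) 2, 1/2 ≤ ‖a p y‖)
    (ha : ∀ n, Good u (fun p => Metric.ball (c p) 2) n a) (n : ℕ) (f : ι → E → ℂ)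
    (sf : ∀ p, ContDiff ℝ (⊤ : ℕ∞) (f p))
    (tf : ∀ p, tsupport (f p) ⊆ Metric.closedBall (c p) 1)
    (gf : ∀ n, Good u (fun p => Metric.ball (c p) 2) n (f)) :
    ∃ C : ℝ, 0 ≤ C ∧ ∀ p, ‖∫ y, Complex.exp (((2 * Real.pi * φ p y : ℝ) : ℂ) * Complex.I) * f p y ∂ν‖
      ≤ C * ((lam p)⁻¹) ^ n := by
  have hU : ∀ p, IsOpen (Metric.ball (c p) 2) := fun p => Metric.isOpen_ball
  have hEn : ∀ p y, ‖Complex.exp (((2 * Real.pi * φ p y : ℝ) : ℂ) * Complex.I)‖ = 1 :=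
    fun p y => Complex.norm_exp_ofReal_mul_I _
  have hne : ∀ p, ∀ y ∈ Metric.ball (c p) 2, a p y ≠ 0 := by
    intro p y hy h
    have := ha0 p y hy
    rw [h, norm_zero] at this
    norm_num at this
  have hsub : ∀ p, Metric.closedBall (c p) 1 ⊆ Metric.ball (c p) 2 :=
    fun p => Metric.closedBall_subset_ball (by norm_num)
  induction n generalizing f with
  | zero =>
    obtain ⟨C, hC⟩ := gf 0
    refine ⟨max C 0 * ν.real (Metric.closedBall 0 1), by positivity, fun p => ?_⟩
    rw [← setIntegral_eq_integral_of_forall_compl_eq_zero (s := Metric.closedBall (c p) 1),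
      pow_zero, mul_one, ← Measure.addHaar_real_closedBall_center ν (c p)]
    · refine norm_setIntegral_le_of_norm_le_const measure_closedBall_lt_top ?_
      intro y hy
      rw [norm_mul, hEn, one_mul]
      exact (hC p y (hsub p hy)).trans (le_max_left _ _)
    · intro y hy
      rw [image_eq_zero_of_notMem_tsupport (fun h => hy (tf p h)), mul_zero]
  | succ n ih =>
    set h : ι → E → ℂ := fun p y => f p y * (a p y)⁻¹ with hh
    have th : ∀ p, tsupport (h p) ⊆ tsupport (f p) := fun p => tsupport_mul_subset_left
    have sh : ∀ p, ContDiff ℝ (⊤ : ℕ∞) (h p) := by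
      intro p
      rw [contDiff_iff_contDiffAt]
      intro y
      by_cases hy : y ∈ tsupport (f p)
      · exact (sf p).contDiffAt.mul ((sa p).contDiffAt.inv (hne p y (hsub p (tf p hy))))
      · have : h p =ᶠ[nhds y] fun _ => 0 :=
          notMem_tsupport_iff_eventuallyEq.mp (fun h' => hy (th p h'))
        exact contDiffAt_const.congr_of_eventuallyEq this
    have Sa : Smo (fun p => Metric.ball (c p) 2) a := fun p => (sa p).contDiffOn
    have Sf : Smo (fun p => Metric.ball (c p) 2) f := fun p => (sf p).contDiffOn
    have gh : ∀ n, Good u (fun p => Metric.ball (c p) 2) n h := fun n =>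
      (gf n).mul hU (Good.inv hU ha Sa ha0) Sf (fun p => (sa p).contDiffOn.inv (hne p))
    obtain ⟨C, hC0, hC⟩ := ih (DD u h)
      (fun p => ((sh p).fderiv_right (m := (⊤ : ℕ∞)) (by simp)).clm_apply contDiff_const)
      (fun p => (tsupport_fderiv_apply_subset ℝ (u p)).trans ((th p).trans (tf p)))
      (fun n => (gh (n+1)).2)
    refine ⟨C, hC0, fun p => ?_⟩
    set e : E → ℂ := fun y => Complex.exp (((2 * Real.pi * φ p y : ℝ) : ℂ) * Complex.I) with he
    have se : ContDiff ℝ (⊤ : ℕ∞) e := by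
      have : ContDiff ℝ (⊤ : ℕ∞) (fun y => ((2 * Real.pi * φ p y : ℝ) : ℂ)) :=
        Complex.ofRealCLM.contDiff.comp (contDiff_const.mul (hφ p))
      exact (this.mul contDiff_const).cexp
    have hde : ∀ y, fderiv ℝ e y (u p) = -(2 * Real.pi * Complex.I * lam p) * (e y * a p y) := by
      intro y
      have h1 : HasFDerivAt (φ p) (fderiv ℝ (φ p) y) y :=
        ((hφ p).differentiable (by simp) y).hasFDerivAt
      have h2 := (((Complex.ofRealCLM.hasFDerivAt.comp y (h1.const_mul (2 * Real.pi))).mul_const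
        Complex.I)).cexp
      have h3 : fderiv ℝ e y = _ := h2.fderiv
      rw [h3]
      simp [hφa, he]
      ring
    have cs : HasCompactSupport (h p) :=
      HasCompactSupport.of_support_subset_isCompact (isCompact_closedBall (c p) 1)
        ((subset_tsupport _).trans ((th p).trans (tf p)))
    have cse : Continuous (fun y => fderiv ℝ e y (u p)) :=
      (se.continuous_fderiv (by simp)).clm_apply continuous_const
    have csh : Continuous (fun y => fderiv ℝ (h p) y (u p)) :=
      ((sh p).continuous_fderiv (by simp)).clm_apply continuous_const
    have ibp := integral_mul_fderiv_eq_neg_fderiv_mul_of_integrable (μ := ν) (f := e) (g := h p)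
      (v := u p)
      ((cse.mul (sh p).continuous).integrable_of_hasCompactSupport cs.mul_left)
      ((se.continuous.mul csh).integrable_of_hasCompactSupport (cs.fderiv_apply ℝ (u p)).mul_left)
      ((se.continuous.mul (sh p).continuous).integrable_of_hasCompactSupport cs.mul_left)
      (fun y _ => se.differentiable (by simp) y) (fun y _ => (sh p).differentiable (by simp) y)
    have e2 : ∫ y, fderiv ℝ e y (u p) * h p y ∂ν =
        -(2 * Real.pi * Complex.I * lam p) * ∫ y, e y * f p y ∂ν := by
      rw [← integral_const_mul]
      congr 1
      ext y
      rw [hde]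
      by_cases hy : y ∈ tsupport (f p)
      · have := hne p y (hsub p (tf p hy))
        simp only [hh]
        field_simp
      · simp [hh, image_eq_zero_of_notMem_tsupport hy]
    rw [e2] at ibp
    have h4 := hC p
    change ‖∫ y, e y * fderiv ℝ (h p) y (u p) ∂ν‖ ≤ _ at h4
    rw [ibp, neg_mul, neg_neg, norm_mul] at h4
    have h5 : ‖(2 * Real.pi * Complex.I * lam p : ℂ)‖ = 2 * Real.pi * lam p := by
      simp [abs_of_pos (hlam p), abs_of_pos Real.pi_pos]
    rw [h5] at h4
    have h6 : lam p * ‖∫ y, e y * f p y ∂ν‖ ≤ C * ((lam p)⁻¹)^n := by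
      refine le_trans ?_ h4
      refine mul_le_mul_of_nonneg_right ?_ (norm_nonneg _)
      nlinarith [Real.pi_gt_three, hlam p]
    rw [pow_succ, ← mul_assoc, ← div_eq_mul_inv, le_div_iff₀ (hlam p), mul_comm]
    exact h6
end fam2

/-- Uniform bound of the derivatives of order at least two on a ball of radius two. -/
lemma symbol_bound {E : Type*} [NormedAddCommGroup E] {m : ℝ} (hm : 2 ≤ m) {n : ℕ} (hn : 2 ≤ n)
    {A lam : ℝ} (hA : 0 < A) {x z : E} (hz : z ∈ Metric.ball x 2)
    (h1 : A ≤ lam) (h2 : A * ‖x‖ ^ (m - 2) ≤ lam) :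
    (1 + ‖z‖ ^ 2) ^ ((m - (n : ℝ)) / 2) ≤ 10 ^ ((m - 2) / 2) * (lam / A) := by
  have hn' : (2 : ℝ) ≤ n := by exact_mod_cast hn
  have hzx : ‖z‖ ≤ ‖x‖ + 2 := by
    have : ‖z - x‖ < 2 := by simpa [dist_eq_norm] using hz
    have := norm_le_norm_add_norm_sub' z x
    linarith
  set M := max 1 ‖x‖ with hM
  have hM1 : 1 ≤ M := le_max_left _ _
  have hMx : ‖x‖ ≤ M := le_max_right _ _
  have hzM : ‖z‖ ≤ 3 * M := by linarith
  have hp : (0 : ℝ) ≤ (m - 2) / 2 := by linarith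
  have hMl : M ^ (m - 2) ≤ lam / A := by
    rw [le_div_iff₀ hA]
    rcases le_total ‖x‖ 1 with h | h
    · rw [hM, max_eq_left h, Real.one_rpow]; linarith
    · rw [hM, max_eq_right h]; linarith
  calc (1 + ‖z‖ ^ 2) ^ ((m - (n : ℝ)) / 2) ≤ (1 + ‖z‖ ^ 2) ^ ((m - 2) / 2) :=
        Real.rpow_le_rpow_of_exponent_le (by nlinarith [norm_nonneg z]) (by linarith)
    _ ≤ (10 * M ^ 2) ^ ((m - 2) / 2) :=
        Real.rpow_le_rpow (by positivity) (by nlinarith [norm_nonneg z]) hp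
    _ = 10 ^ ((m - 2) / 2) * M ^ (m - 2) := by
        rw [Real.mul_rpow (by norm_num) (by positivity), ← Real.rpow_natCast M 2,
          ← Real.rpow_mul (by linarith)]
        congr 2
        push_cast
        ring
    _ ≤ _ := mul_le_mul_of_nonneg_left hMl (by positivity)

lemma norm_iter_ofReal {E : Type*} [NormedAddCommGroup E] [NormedSpace ℝ E] {μ : E → ℝ}
    (hsm : ContDiff ℝ (⊤ : ℕ∞) μ) (k : ℕ) (y : E) :
    ‖iteratedFDeriv ℝ k (fun y => ((μ y : ℝ) : ℂ)) y‖ = ‖iteratedFDeriv ℝ k μ y‖ :=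
  Complex.ofRealLI.norm_iteratedFDeriv_comp_left (f := μ) (hsm.contDiffAt (x := y))
    (i := k) (by exact_mod_cast le_top)

lemma fderiv_ofReal {E : Type*} [NormedAddCommGroup E] [NormedSpace ℝ E] {μ : E → ℝ}
    (hsm : ContDiff ℝ (⊤ : ℕ∞) μ) (y v : E) :
    fderiv ℝ (fun y => ((μ y : ℝ) : ℂ)) y v = ((fderiv ℝ μ y v : ℝ) : ℂ) := by
  have h1 : HasFDerivAt μ (fderiv ℝ μ y) y := (hsm.differentiable (by simp) y).hasFDerivAt
  have h2 : fderiv ℝ (fun y => ((μ y : ℝ) : ℂ)) y = _ :=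
    (Complex.ofRealCLM.hasFDerivAt.comp y h1).fderiv
  rw [h2]
  rfl

lemma main_decay (d : ℕ) (m : ℝ) (hm : 2 ≤ m)
    (μ : EuclideanSpace ℝ (Fin d) → ℝ) (hsm : ContDiff ℝ (⊤ : ℕ∞) μ)
    (hA : ∀ n : ℕ, ∃ C : ℝ, ∀ x : EuclideanSpace ℝ (Fin d),
      ‖iteratedFDeriv ℝ n μ x‖ ≤ C * (1 + ‖x‖ ^ 2) ^ ((m - (n : ℝ)) / 2))
    (g : EuclideanSpace ℝ (Fin d) → ℂ) (hg : ContDiff ℝ (⊤ : ℕ∞) g)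
    (hsupp : tsupport g ⊆ Metric.closedBall (0 : EuclideanSpace ℝ (Fin d)) 1) :
    ∃ A : ℝ, 1 ≤ A ∧ ∀ n : ℕ, ∃ C : ℝ, 0 ≤ C ∧
      ∀ x ξ : EuclideanSpace ℝ (Fin d),
        A * ‖x‖ ^ (m - 2) ≤ ‖ξ - gradient μ x‖ → A ≤ ‖ξ - gradient μ x‖ →
        ‖∫ (y : EuclideanSpace ℝ (Fin d)),
            Complex.exp (((2 * Real.pi * (μ y - ⟪ξ, y⟫) : ℝ) : ℂ) * Complex.I) *
              (g (y - x))‖ ≤ C * (‖ξ - gradient μ x‖⁻¹) ^ n := by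
  obtain ⟨C₂, hC₂⟩ := hA 2
  set T : ℝ := 10 ^ ((m - 2) / 2) with hT
  have hT0 : 0 < T := by positivity
  set A : ℝ := 4 * (|C₂| * T + 1) with hAdef
  have hA1 : 1 ≤ A := by
    have : 0 ≤ |C₂| * T := by positivity
    linarith
  have hA0 : 0 < A := by linarith
  refine ⟨A, hA1, fun n => ?_⟩
  let E := EuclideanSpace ℝ (Fin d)
  let ι := {p : E × E // A * ‖p.1‖ ^ (m - 2) ≤ ‖p.2 - gradient μ p.1‖ ∧
    A ≤ ‖p.2 - gradient μ p.1‖}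
  let lam : ι → ℝ := fun p => ‖p.1.2 - gradient μ p.1.1‖
  have hlA : ∀ p : ι, A ≤ lam p := fun p => p.2.2
  have hlam : ∀ p : ι, 0 < lam p := fun p => hA0.trans_le (hlA p)
  let c : ι → E := fun p => p.1.1
  let u : ι → E := fun p => (lam p)⁻¹ • (p.1.2 - gradient μ p.1.1)
  have hu : ∀ p, ‖u p‖ = 1 := by
    intro p
    simp only [u]
    rw [norm_smul, norm_inv, Real.norm_of_nonneg (hlam p).le]
    exact inv_mul_cancel₀ (hlam p).ne'
  let U : ι → Set E := fun p => Metric.ball (c p) 2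
  have hU : ∀ p, IsOpen (U p) := fun p => Metric.isOpen_ball
  let φ : ι → E → ℝ := fun p y => μ y - ⟪p.1.2, y⟫
  have hφ : ∀ p, ContDiff ℝ (⊤ : ℕ∞) (φ p) := fun p =>
    hsm.sub (contDiff_const.inner ℝ contDiff_id)
  let M : E → ℂ := fun y => ((μ y : ℝ) : ℂ)
  have sM : ContDiff ℝ (⊤ : ℕ∞) M := Complex.ofRealCLM.contDiff.comp hsm
  let s : ι → ℂ := fun p => -((lam p : ℂ))⁻¹
  have hs : ∀ p, ‖s p‖ = (lam p)⁻¹ := by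
    intro p
    simp only [s, norm_neg, norm_inv, Complex.norm_real]
    rw [Real.norm_of_nonneg (hlam p).le]
  let a : ι → E → ℂ := fun p y => s p * iteratedFDeriv ℝ 1 M y (fun _ => u p) +
    (1 + (lam p : ℂ)⁻¹ * ((fderiv ℝ μ (c p) (u p) : ℝ) : ℂ))
  have a_eq : ∀ p y, a p y =
      ((1 - (lam p)⁻¹ * (fderiv ℝ μ y (u p) - fderiv ℝ μ (c p) (u p)) : ℝ) : ℂ) := by
    intro p y
    simp only [a, s, M]
    rw [iteratedFDeriv_one_apply, fderiv_ofReal hsm]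
    push_cast
    ring
  have sit : ∀ p, ContDiff ℝ (⊤ : ℕ∞) (fun y => iteratedFDeriv ℝ 1 M y (fun _ => u p)) := by
    intro p
    simp only [iteratedFDeriv_one_apply]
    exact (sM.fderiv_right (m := (⊤ : ℕ∞)) (by simp)).clm_apply contDiff_const
  have sa : ∀ p, ContDiff ℝ (⊤ : ℕ∞) (a p) := fun p =>
    (contDiff_const.mul (sit p)).add contDiff_const
  have hφa : ∀ p y, ((fderiv ℝ (φ p) y (u p) : ℝ) : ℂ) = -(lam p : ℂ) * a p y := by
    intro p y
    rw [a_eq]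
    have h1 : HasFDerivAt μ (fderiv ℝ μ y) y := (hsm.differentiable (by simp) y).hasFDerivAt
    have h2 : HasFDerivAt (φ p) (fderiv ℝ μ y - innerSL ℝ p.1.2) y :=
      h1.sub (innerSL ℝ p.1.2).hasFDerivAt
    have h3 : fderiv ℝ μ (c p) (u p) = ⟪gradient μ p.1.1, u p⟫ := by
      have := (hsm.differentiable (by simp) p.1.1).hasGradientAt.hasFDerivAt.fderiv
      simp only [c]
      rw [this]
      simp
    have h4 : ⟪p.1.2 - gradient μ p.1.1, u p⟫ = lam p := by
      simp only [u]
      rw [inner_smul_right, real_inner_self_eq_norm_sq]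
      change (lam p)⁻¹ * (lam p) ^ 2 = lam p
      have := (hlam p).ne'
      field_simp
    rw [inner_sub_left] at h4
    rw [h2.fderiv]
    norm_cast
    have h5 : (fderiv ℝ μ y - innerSL ℝ p.1.2) (u p) = fderiv ℝ μ y (u p) - ⟪p.1.2, u p⟫ := rfl
    rw [h5, h3]
    have h6 : lam p * (lam p)⁻¹ = 1 := mul_inv_cancel₀ (hlam p).ne'
    linear_combination (-(fderiv ℝ μ y (u p)) + ⟪gradient μ p.1.1, u p⟫) * h6 - h4
  have hder : ∀ k, 2 ≤ k → ∃ C : ℝ, ∀ p, ∀ y ∈ U p,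
      ‖s p‖ * ‖iteratedFDeriv ℝ k M y‖ ≤ C := by
    intro k hk
    obtain ⟨C, hC⟩ := hA k
    refine ⟨|C| * (T / A), fun p y hy => ?_⟩
    have h1 := symbol_bound hm hk hA0 hy (hlA p) p.2.1
    have h2 : ‖iteratedFDeriv ℝ k M y‖ ≤ |C| * (T * (lam p / A)) := by
      rw [norm_iter_ofReal hsm]
      exact (hC y).trans (mul_le_mul (le_abs_self C) h1 (by positivity) (abs_nonneg C))
    rw [hs]
    have hl := hlam p
    calc (lam p)⁻¹ * ‖iteratedFDeriv ℝ k M y‖ ≤ (lam p)⁻¹ * (|C| * (T * (lam p / A))) :=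
          mul_le_mul_of_nonneg_left h2 (by positivity)
      _ = _ := by field_simp
  have hdiff : ∀ p, ∀ y ∈ U p,
      |(lam p)⁻¹ * (fderiv ℝ μ y (u p) - fderiv ℝ μ (c p) (u p))| ≤ 1/2 := by
    intro p y hy
    have hl := hlam p
    have hdf : ContDiff ℝ (⊤ : ℕ∞) (fderiv ℝ μ) := hsm.fderiv_right (m := (⊤ : ℕ∞)) (by simp)
    have h1 : ‖fderiv ℝ μ y - fderiv ℝ μ (c p)‖ ≤ (|C₂| * (T * (lam p / A))) * ‖y - c p‖ := by
      refine Convex.norm_image_sub_le_of_norm_fderiv_le (𝕜 := ℝ) (s := U p)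
        (fun z _ => hdf.differentiable (by simp) z) ?_ (convex_ball _ _)
        (Metric.mem_ball_self (by norm_num)) hy
      intro z hz
      have h1 := symbol_bound hm le_rfl hA0 hz (hlA p) p.2.1
      have h3 : ‖fderiv ℝ (fderiv ℝ μ) z‖ = ‖iteratedFDeriv ℝ 2 μ z‖ := by
        rw [← norm_iteratedFDeriv_one, norm_iteratedFDeriv_fderiv]
      rw [h3]
      exact (hC₂ z).trans (mul_le_mul (le_abs_self C₂) h1 (by positivity) (abs_nonneg C₂))
    have h2 : ‖y - c p‖ ≤ 2 := by
      have : ‖y - c p‖ < 2 := mem_ball_iff_norm.mp hy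
      exact this.le
    have h3 : |fderiv ℝ μ y (u p) - fderiv ℝ μ (c p) (u p)| ≤ lam p / 2 := by
      have := (fderiv ℝ μ y - fderiv ℝ μ (c p)).le_opNorm (u p)
      rw [hu, mul_one] at this
      refine (this.trans h1).trans ?_
      calc (|C₂| * (T * (lam p / A))) * ‖y - c p‖ ≤ (|C₂| * (T * (lam p / A))) * 2 :=
            mul_le_mul_of_nonneg_left h2 (by positivity)
        _ = lam p * (2 * (|C₂| * T) / A) := by ring
        _ ≤ lam p * (1/2) := by
            refine mul_le_mul_of_nonneg_left ?_ hl.le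
            rw [div_le_iff₀ hA0, hAdef]
            linarith
        _ = _ := by ring
    rw [abs_mul, abs_of_pos (inv_pos.mpr hl)]
    calc _ ≤ (lam p)⁻¹ * (lam p / 2) := mul_le_mul_of_nonneg_left h3 (by positivity)
      _ = 1/2 := by field_simp
  have ha0 : ∀ p, ∀ y ∈ U p, 1/2 ≤ ‖a p y‖ := by
    intro p y hy
    rw [a_eq, Complex.norm_real, Real.norm_eq_abs]
    have := abs_le.mp (hdiff p y hy)
    exact le_trans (by linarith) (le_abs_self _)
  have haB : Bdd0 U a := by
    refine ⟨2, fun p y hy => ?_⟩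
    rw [a_eq, Complex.norm_real, Real.norm_eq_abs]
    have := abs_le.mp (hdiff p y hy)
    rw [abs_le]
    constructor <;> linarith
  have ha : ∀ n, Good u U n a := by
    intro n
    cases n with
    | zero => exact haB
    | succ n =>
      refine ⟨haB, (good_iter hU (fun p => (hu p).le) (fun _ => M) (fun _ => sM) s 2 hder n 2
        le_rfl).congr hU ?_⟩
      intro p y hy
      obtain ⟨h1, h2⟩ := hasFDerivAt_iter sM 1 (u p) y
      simp only [DD, a]
      rw [fderiv_add_const, fderiv_const_mul h1]
      exact congrArg (fun z => s p * z) h2.symm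
  let f : ι → E → ℂ := fun p y => g (y - c p)
  have sf : ∀ p, ContDiff ℝ (⊤ : ℕ∞) (f p) := fun p => hg.comp (contDiff_id.sub contDiff_const)
  have tf : ∀ p, tsupport (f p) ⊆ Metric.closedBall (c p) 1 := by
    intro p
    refine closure_minimal ?_ Metric.isClosed_closedBall
    intro y hy
    have := hsupp (subset_tsupport g (show y - c p ∈ Function.support g from hy))
    exact mem_closedBall_iff_norm.mpr (mem_closedBall_zero_iff.mp this)
  have csg : HasCompactSupport g :=
    HasCompactSupport.of_support_subset_isCompact (isCompact_closedBall 0 1)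
      ((subset_tsupport _).trans hsupp)
  have gf : ∀ n, Good u U n f := by
    intro n
    refine (good_iter hU (fun p => (hu p).le) f sf (fun _ => 1) 0 ?_ n 0 le_rfl).congr hU ?_
    · intro k _
      have hc : Continuous (iteratedFDeriv ℝ k g) :=
        hg.continuous_iteratedFDeriv (m := k) (by exact_mod_cast le_top)
      obtain ⟨C, hC⟩ := hc.bounded_above_of_compact_support (csg.iteratedFDeriv k)
      refine ⟨C, fun p y _ => ?_⟩
      simp only [norm_one, one_mul, f]
      rw [iteratedFDeriv_comp_sub]
      exact hC _
    · intro p y _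
      simp
  obtain ⟨C, hC0, hC⟩ := osc_decay volume u c lam hlam φ hφ a hφa sa ha0 ha n f sf tf gf
  exact ⟨C, hC0, fun x ξ h1 h2 => hC ⟨(x, ξ), h1, h2⟩⟩

/-- Let `μ ∈ A^m(ℝ^d)` with `m ≥ 2` (symbol-type estimates
`‖D^n μ(x)‖ ≲ ⟨x⟩^{m-n}` for every `n`) and let `g` be smooth with support in the closed unit
ball. Then there is `A > 0` such that for every `N ≥ 0` there is `C > 0` with
`|V_g F_μ(x,ξ)| ≤ C ⟨ξ − ∇μ(x)⟩^{-N}` whenever `|ξ − ∇μ(x)| ≥ A|x|^{m−2}`, where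
`F_μ(y) = e^{2πiμ(y)}`. -/
theorem fresnel_nonstationary_decay (d : ℕ) (m : ℝ) (hm : 2 ≤ m)
    (μ : EuclideanSpace ℝ (Fin d) → ℝ) (hsm : ContDiff ℝ (⊤ : ℕ∞) μ)
    (hA : ∀ n : ℕ, ∃ C : ℝ, ∀ x : EuclideanSpace ℝ (Fin d),
      ‖iteratedFDeriv ℝ n μ x‖ ≤ C * (1 + ‖x‖ ^ 2) ^ ((m - (n : ℝ)) / 2))
    (g : EuclideanSpace ℝ (Fin d) → ℂ) (hg : ContDiff ℝ (⊤ : ℕ∞) g)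
    (hsupp : tsupport g ⊆ Metric.closedBall (0 : EuclideanSpace ℝ (Fin d)) 1) :
    ∃ A : ℝ, 0 < A ∧ ∀ N : ℝ, 0 ≤ N → ∃ C : ℝ, 0 < C ∧
      ∀ x ξ : EuclideanSpace ℝ (Fin d),
        A * ‖x‖ ^ (m - 2) ≤ ‖ξ - gradient μ x‖ →
        ‖∫ (y : EuclideanSpace ℝ (Fin d)),
            Complex.exp (-(((2 * Real.pi * ⟪ξ, y⟫ : ℝ) : ℂ) * Complex.I)) *
              Complex.exp (((2 * Real.pi * μ y : ℝ) : ℂ) * Complex.I) *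
              (starRingEnd ℂ) (g (y - x))‖ ≤
          C * (1 + ‖ξ - gradient μ x‖ ^ 2) ^ (-(N / 2)) := by
  have hg' : ContDiff ℝ (⊤ : ℕ∞) (fun y => (starRingEnd ℂ) (g y)) :=
    Complex.conjCLE.contDiff.comp hg
  have hsupp' : tsupport (fun y => (starRingEnd ℂ) (g y)) ⊆
      Metric.closedBall (0 : EuclideanSpace ℝ (Fin d)) 1 :=
    (tsupport_comp_subset (g := fun z : ℂ => (starRingEnd ℂ) z) (by simp) g).trans hsupp
  obtain ⟨A, hA1, H⟩ := main_decay d m hm μ hsm hA _ hg' hsupp'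
  refine ⟨A, by linarith, fun N hN => ?_⟩
  obtain ⟨C, hC0, hC⟩ := H ⌈N⌉₊
  set K : ℝ := ∫ y, ‖g y‖ with hK
  have hK0 : 0 ≤ K := integral_nonneg (fun y => norm_nonneg _)
  refine ⟨C * 2 ^ (N / 2) + (K + 1) * (1 + A ^ 2) ^ (N / 2), by positivity, fun x ξ hx => ?_⟩
  have e1 : ∀ y : EuclideanSpace ℝ (Fin d),
      Complex.exp (-(((2 * Real.pi * ⟪ξ, y⟫ : ℝ) : ℂ) * Complex.I)) *
        Complex.exp (((2 * Real.pi * μ y : ℝ) : ℂ) * Complex.I) =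
      Complex.exp (((2 * Real.pi * (μ y - ⟪ξ, y⟫) : ℝ) : ℂ) * Complex.I) := by
    intro y
    rw [← Complex.exp_add]
    congr 1
    push_cast
    ring
  simp only [e1]
  set lam := ‖ξ - gradient μ x‖ with hlam
  have hl0 : 0 ≤ lam := norm_nonneg _
  have hpos : 0 < 1 + lam ^ 2 := by positivity
  rw [add_mul]
  rcases le_or_gt A lam with h | h
  · refine (hC x ξ hx h).trans ?_
    have hl1 : 1 ≤ lam := hA1.trans h
    have h1 : (lam⁻¹) ^ ⌈N⌉₊ ≤ 2 ^ (N / 2) * (1 + lam ^ 2) ^ (-(N / 2)) := by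
      have hN' : N ≤ (⌈N⌉₊ : ℝ) := Nat.le_ceil N
      calc (lam⁻¹) ^ ⌈N⌉₊ = lam ^ (-(⌈N⌉₊ : ℝ)) := by
            rw [Real.rpow_neg hl0, Real.rpow_natCast, inv_pow]
        _ ≤ lam ^ (-N) := Real.rpow_le_rpow_of_exponent_le hl1 (by linarith)
        _ = (lam ^ 2) ^ (-(N / 2)) := by
            rw [← Real.rpow_natCast lam 2, ← Real.rpow_mul hl0]
            congr 1
            push_cast
            ring
        _ ≤ ((1 + lam ^ 2) / 2) ^ (-(N / 2)) :=
            Real.rpow_le_rpow_of_nonpos (by positivity) (by nlinarith) (by linarith)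
        _ = _ := by
            rw [Real.div_rpow hpos.le (by norm_num), Real.rpow_neg (x := 2) (by norm_num)]
            field_simp
    have h2 : 0 ≤ (K + 1) * (1 + A ^ 2) ^ (N / 2) * (1 + lam ^ 2) ^ (-(N / 2)) := by positivity
    have h3 := mul_le_mul_of_nonneg_left h1 hC0
    rw [← mul_assoc] at h3
    linarith
  · have h1 : ‖∫ (y : EuclideanSpace ℝ (Fin d)),
        Complex.exp (((2 * Real.pi * (μ y - ⟪ξ, y⟫) : ℝ) : ℂ) * Complex.I) *
          (starRingEnd ℂ) (g (y - x))‖ ≤ K := by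
      refine (norm_integral_le_integral_norm _).trans (le_of_eq ?_)
      rw [hK, ← integral_sub_right_eq_self (fun y => ‖g y‖) x]
      congr 1
      ext y
      rw [norm_mul, Complex.norm_exp_ofReal_mul_I, one_mul, RCLike.norm_conj]
    have h2 : 1 ≤ (1 + A ^ 2) ^ (N / 2) * (1 + lam ^ 2) ^ (-(N / 2)) := by
      rw [Real.rpow_neg hpos.le, ← div_eq_mul_inv, one_le_div (by positivity)]
      exact Real.rpow_le_rpow hpos.le (by nlinarith) (by linarith)
    have h3 : 0 ≤ C * 2 ^ (N / 2) * (1 + lam ^ 2) ^ (-(N / 2)) := by positivity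
    have h4 := mul_le_mul_of_nonneg_left h2 (show 0 ≤ K + 1 by linarith)
    rw [← mul_assoc] at h4
    linarith
end
end

section
/- Let μ : ℝ^d∖{0} → ℝ be a positively homogeneous C² function of degree m ≥ 2 (μ(λx) = λ^m μ(x) for λ > 0, x ≠ 0) such that the Hessian ∇²μ(x) is invertible for every x with |x| = 1. Then for every x₀ ∈ ℝ^d with |x₀| = 1 there exist ε > 0 and a constant C > 0 such that, with Γ := {u ∈ ℝ^d∖{0} : |u/|u| − x₀| < ε}, for all x, y ∈ Γ one has |∇μ(x) − ∇μ(y)| ≥ C |x−y| (|x|^{m−2} + |y|^{m−2}). -/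
open MeasureTheory Real Complex
open scoped ENNReal RealInnerProductSpace

noncomputable section

lemma aux_inner {E : Type*} [NormedAddCommGroup E] [InnerProductSpace ℝ E]
    (v x₀ : E) (hx₀ : ‖x₀‖ = 1) (a b : ℝ) (ha : 0 ≤ a) (hb : 0 ≤ b)
    (h : |⟪v, x₀⟫| ≤ 1 / 2 * ‖v‖) :
    1 / 2 * (a * ‖v‖ + b) ≤ ‖a • v + b • x₀‖ := by
  have h1 : ‖a • v + b • x₀‖ ^ 2 = a ^ 2 * ‖v‖ ^ 2 + 2 * (a * b * ⟪v, x₀⟫) + b ^ 2 := by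
    rw [norm_add_sq_real, norm_smul, norm_smul, hx₀, inner_smul_left, inner_smul_right,
      Real.norm_of_nonneg ha, Real.norm_of_nonneg hb]
    simp
    ring
  have h2 : -(1 / 2 * ‖v‖) ≤ ⟪v, x₀⟫ := (abs_le.mp h).1
  have h3 : a * b * (-(1 / 2 * ‖v‖)) ≤ a * b * ⟪v, x₀⟫ :=
    mul_le_mul_of_nonneg_left h2 (mul_nonneg ha hb)
  refine abs_le_of_sq_le_sq' ?_ (norm_nonneg _) |>.2
  rw [h1]
  nlinarith [sq_nonneg (a * ‖v‖ - b)]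

lemma aux_orth {E : Type*} [NormedAddCommGroup E] [InnerProductSpace ℝ E]
    (x y x₀ : E) (hx : ‖x‖ = 1) (hy : ‖y‖ = 1) (h1 : ‖x - x₀‖ ≤ 1 / 2) (h2 : ‖y - x₀‖ ≤ 1 / 2) :
    |⟪x - y, x₀⟫| ≤ 1 / 2 * ‖x - y‖ := by
  have e0 : ⟪x - y, x + y⟫ = 0 := by
    rw [inner_sub_left, inner_add_right, inner_add_right, real_inner_self_eq_norm_sq,
      real_inner_self_eq_norm_sq, hx, hy, real_inner_comm x y]
    ring
  have e1 : 2 * ⟪x - y, x₀⟫ = -⟪x - y, x - x₀⟫ - ⟪x - y, y - x₀⟫ := by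
    have : ⟪x - y, x + y⟫ = ⟪x - y, x - x₀⟫ + ⟪x - y, y - x₀⟫ + 2 * ⟪x - y, x₀⟫ := by
      rw [inner_sub_right, inner_sub_right, inner_add_right]; ring
    linarith
  have i1 := abs_real_inner_le_norm (x - y) (x - x₀)
  have i2 := abs_real_inner_le_norm (x - y) (y - x₀)
  have n := norm_nonneg (x - y)
  have j1 := i1.trans (mul_le_mul_of_nonneg_left h1 n)
  have j2 := i2.trans (mul_le_mul_of_nonneg_left h2 n)
  rw [abs_le] at *
  constructor <;> linarith [j1.1, j1.2, j2.1, j2.2]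

/-- The core estimate, with `x` on the sphere and `t • y` inside the unit ball. -/
lemma aux_core {E G : Type*} [NormedAddCommGroup E] [InnerProductSpace ℝ E]
    [NormedAddCommGroup G] [NormedSpace ℝ G] (F : E → G) (A : E →L[ℝ] G) (α k : ℝ)
    (hα : 0 < α) (hk : 1 ≤ k) (hA : ∀ w, α * ‖w‖ ≤ ‖A w‖) (x₀ x y : E) (hx₀ : ‖x₀‖ = 1)
    (hE : A x₀ = k • F x₀) (hx : ‖x‖ = 1) (hy : ‖y‖ = 1)
    (h1 : ‖x - x₀‖ ≤ 1 / 2) (h2 : ‖y - x₀‖ ≤ 1 / 2)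
    (hF : ‖F x - F x₀‖ ≤ α / (4 * k))
    (hF2 : ‖F x - F y - A (x - y)‖ ≤ α / (4 * k) * ‖x - y‖)
    (t : ℝ) (ht : 0 < t) (ht1 : t ≤ 1) :
    α / (12 * k) * ‖x - t • y‖ ≤ ‖F x - t ^ k • F y‖ := by
  have hk0 : 0 < k := by linarith
  set s : ℝ := t ^ k with hs
  have hs0 : 0 ≤ s := by positivity
  have hst : s ≤ t := by
    have := Real.rpow_le_rpow_of_exponent_ge ht ht1 hk
    rwa [Real.rpow_one] at this
  have hs1 : 0 ≤ 1 - s := by linarith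
  have key := aux_inner (x - y) x₀ hx₀ s ((1 - s) / k) hs0 (by positivity)
    (aux_orth x y x₀ hx hy h1 h2)
  set w := s • (x - y) + ((1 - s) / k) • x₀ with hw
  have hN := norm_nonneg (x - y)
  have hN2 : ‖x - y‖ ≤ 2 := (norm_sub_le _ _).trans (by rw [hx, hy]; norm_num)
  set S := s * ‖x - y‖ + (1 - s) with hS
  have hwS : 1 / (2 * k) * S ≤ ‖w‖ := by
    refine le_trans ?_ key
    have e : 1 / (2 * k) * S = 1 / 2 * (s * ‖x - y‖ / k + (1 - s) / k) := by
      rw [hS]; field_simp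
    rw [e]
    have : s * ‖x - y‖ / k ≤ s * ‖x - y‖ := div_le_self (by positivity) hk
    linarith
  have hid : F x - s • F y = A w + (s • (F x - F y - A (x - y)) + (1 - s) • (F x - F x₀)) := by
    have : A w = s • A (x - y) + (1 - s) • F x₀ := by
      rw [hw, map_add, map_smul, map_smul, hE, smul_smul, div_mul_cancel₀ _ hk0.ne']
    rw [this]
    module
  have herr : ‖s • (F x - F y - A (x - y)) + (1 - s) • (F x - F x₀)‖ ≤ α / (4 * k) * S := by
    refine (norm_add_le _ _).trans ?_
    rw [norm_smul, norm_smul, Real.norm_of_nonneg hs0, Real.norm_of_nonneg hs1]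
    have a1 := mul_le_mul_of_nonneg_left hF2 hs0
    have a2 := mul_le_mul_of_nonneg_left hF hs1
    calc _ ≤ _ := add_le_add a1 a2
      _ = _ := by rw [hS]; ring
  have hlow : α / (4 * k) * S ≤ ‖F x - s • F y‖ := by
    rw [hid]
    have b1 := norm_sub_le (A w + (s • (F x - F y - A (x - y)) + (1 - s) • (F x - F x₀)))
      (s • (F x - F y - A (x - y)) + (1 - s) • (F x - F x₀))
    rw [add_sub_cancel_right] at b1
    have b2 := hA w
    have b3 := mul_le_mul_of_nonneg_left hwS hα.le
    have b4 : α * (1 / (2 * k) * S) = α / (4 * k) * S + α / (4 * k) * S := by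
      field_simp; ring
    linarith
  refine le_trans ?_ hlow
  have hd : ‖x - t • y‖ ≤ 3 * S := by
    have : x - t • y = t • (x - y) + (1 - t) • x := by module
    rw [this]
    refine (norm_add_le _ _).trans ?_
    rw [norm_smul, norm_smul, Real.norm_of_nonneg ht.le, Real.norm_of_nonneg (by linarith), hx, hS]
    nlinarith
  calc α / (12 * k) * ‖x - t • y‖ ≤ α / (12 * k) * (3 * S) := by gcongr
    _ = _ := by field_simp; ring

/-- The estimate for all pairs with `‖y‖ ≤ ‖x‖`. -/
lemma aux_scale {E G : Type*} [NormedAddCommGroup E] [NormedSpace ℝ E]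
    [NormedAddCommGroup G] [NormedSpace ℝ G] (F : E → G) (c m : ℝ) (hm : 2 ≤ m) (hc : 0 < c)
    (hF : ∀ r : ℝ, 0 < r → ∀ x : E, x ≠ 0 → F (r • x) = r ^ (m - 1) • F x)
    (x y : E) (hx : x ≠ 0) (hy : y ≠ 0) (hxy : ‖y‖ ≤ ‖x‖)
    (h : ∀ t : ℝ, 0 < t → t ≤ 1 → c * ‖‖x‖⁻¹ • x - t • (‖y‖⁻¹ • y)‖ ≤
      ‖F (‖x‖⁻¹ • x) - t ^ (m - 1) • F (‖y‖⁻¹ • y)‖) :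
    c / 2 * ‖x - y‖ * (‖x‖ ^ (m - 2) + ‖y‖ ^ (m - 2)) ≤ ‖F x - F y‖ := by
  have nx : 0 < ‖x‖ := norm_pos_iff.mpr hx
  have ny : 0 < ‖y‖ := norm_pos_iff.mpr hy
  have hx' : ‖x‖⁻¹ • x ≠ 0 := smul_ne_zero (by positivity) hx
  have hy' : ‖y‖⁻¹ • y ≠ 0 := smul_ne_zero (by positivity) hy
  have h0 := h (‖y‖ / ‖x‖) (by positivity) ((div_le_one nx).mpr hxy)
  rw [← hF _ (by positivity) _ hy', smul_smul,
    show ‖y‖ / ‖x‖ * ‖y‖⁻¹ = ‖x‖⁻¹ by field_simp, hF _ (by positivity) _ hx,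
    hF _ (by positivity) _ hy, ← smul_sub, ← smul_sub, norm_smul, norm_smul,
    Real.norm_of_nonneg (by positivity), Real.norm_of_nonneg (by positivity),
    Real.inv_rpow nx.le] at h0
  have p : 0 < ‖x‖ ^ (m - 1) := by positivity
  have h1 := mul_le_mul_of_nonneg_left h0 p.le
  rw [mul_inv_cancel_left₀ p.ne'] at h1
  have e : ‖x‖ ^ (m - 1) = ‖x‖ ^ (m - 2) * ‖x‖ := by
    rw [← Real.rpow_add_one nx.ne']; congr 1; ring
  rw [e, show ‖x‖ ^ (m - 2) * ‖x‖ * (c * (‖x‖⁻¹ * ‖x - y‖)) = c * ‖x - y‖ * ‖x‖ ^ (m - 2) by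
    field_simp] at h1
  refine le_trans ?_ h1
  have q : ‖y‖ ^ (m - 2) ≤ ‖x‖ ^ (m - 2) := Real.rpow_le_rpow ny.le hxy (by linarith)
  have q2 := mul_le_mul_of_nonneg_left q (mul_nonneg hc.le (norm_nonneg (x - y)))
  linarith

/-- Let `μ` be a positively homogeneous `C²` function of degree `m ≥ 2` on
`ℝ^d∖{0}` with invertible Hessian at every point of the unit sphere. Then every `x₀` on the
unit sphere has a conic neighbourhood `Γ = {u ≠ 0 : |u/|u| − x₀| < ε}` on which
`|∇μ(x) − ∇μ(y)| ≥ C|x−y|(|x|^{m−2} + |y|^{m−2})`. -/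
theorem conic_gradient_lower_bound (d : ℕ) (m : ℝ) (hm : 2 ≤ m)
    (μ : EuclideanSpace ℝ (Fin d) → ℝ)
    (hC2 : ContDiffOn ℝ (2 : ℕ∞) μ {x | x ≠ 0})
    (hhom : ∀ c : ℝ, 0 < c → ∀ x : EuclideanSpace ℝ (Fin d), x ≠ 0 →
      μ (c • x) = c ^ m * μ x)
    (hhess : ∀ x : EuclideanSpace ℝ (Fin d), ‖x‖ = 1 →
      Function.Bijective ⇑(fderiv ℝ (fderiv ℝ μ) x))
    (x₀ : EuclideanSpace ℝ (Fin d)) (hx₀ : ‖x₀‖ = 1) :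
    ∃ ε : ℝ, 0 < ε ∧ ∃ C : ℝ, 0 < C ∧
      ∀ x y : EuclideanSpace ℝ (Fin d), x ≠ 0 → y ≠ 0 →
        ‖‖x‖⁻¹ • x - x₀‖ < ε → ‖‖y‖⁻¹ • y - x₀‖ < ε →
        C * ‖x - y‖ * (‖x‖ ^ (m - 2) + ‖y‖ ^ (m - 2)) ≤ ‖gradient μ x - gradient μ y‖ := by
  have hopen : IsOpen {x : EuclideanSpace ℝ (Fin d) | x ≠ 0} := isOpen_ne
  have hx₀0 : x₀ ≠ 0 := by
    intro h; rw [h, norm_zero] at hx₀; exact zero_ne_one hx₀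
  -- homogeneity of the derivative
  have hF : ∀ r : ℝ, 0 < r → ∀ x : EuclideanSpace ℝ (Fin d), x ≠ 0 →
      fderiv ℝ μ (r • x) = r ^ (m - 1) • fderiv ℝ μ x := by
    intro r hr x hx
    have e1 : (fun z => μ (r • z)) =ᶠ[nhds x] fun z => r ^ m * μ z := by
      filter_upwards [hopen.mem_nhds hx] with z hz
      exact hhom r hr z hz
    have e2 := e1.fderiv_eq (𝕜 := ℝ)
    have hd : DifferentiableAt ℝ μ x :=
      (hC2.contDiffAt (hopen.mem_nhds hx)).differentiableAt (by norm_num)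
    rw [fderiv_comp_smul, fderiv_const_mul hd] at e2
    have e3 : fderiv ℝ μ (r • x) = r⁻¹ • (r • fderiv ℝ μ (r • x)) := by
      rw [smul_smul, inv_mul_cancel₀ hr.ne', one_smul]
    rw [e3, e2, smul_smul, Real.rpow_sub_one hr.ne']
    congr 1
    field_simp
  have hC1 : ContDiffAt ℝ 1 (fderiv ℝ μ) x₀ :=
    (hC2.contDiffAt (hopen.mem_nhds hx₀0)).fderiv_right (by norm_num)
  have hstr : HasStrictFDerivAt (fderiv ℝ μ) (fderiv ℝ (fderiv ℝ μ) x₀) x₀ :=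
    hC1.hasStrictFDerivAt (by norm_num)
  have hinj := (hhess x₀ hx₀).1
  set A := fderiv ℝ (fderiv ℝ μ) x₀ with hAdef
  -- Euler
  have hE : A x₀ = (m - 1) • fderiv ℝ μ x₀ := by
    have d1 : HasDerivAt (fun t : ℝ => fderiv ℝ μ (t • x₀)) (A x₀) 1 := by
      have g : HasDerivAt (fun t : ℝ => t • x₀) x₀ 1 := by
        simpa using (hasDerivAt_id (1 : ℝ)).smul_const x₀
      have h' : HasFDerivAt (fderiv ℝ μ) A ((1 : ℝ) • x₀) := by
        rw [one_smul]; exact hstr.hasFDerivAt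
      exact h'.comp_hasDerivAt (1 : ℝ) g
    have d2 : HasDerivAt (fun t : ℝ => t ^ (m - 1) • fderiv ℝ μ x₀)
        ((m - 1) • fderiv ℝ μ x₀) 1 := by
      have := (Real.hasDerivAt_rpow_const (x := 1) (p := m - 1) (Or.inl one_ne_zero)).smul_const
        (fderiv ℝ μ x₀)
      simpa using this
    have e : (fun t : ℝ => fderiv ℝ μ (t • x₀)) =ᶠ[nhds 1]
        fun t : ℝ => t ^ (m - 1) • fderiv ℝ μ x₀ := by
      filter_upwards [lt_mem_nhds (zero_lt_one' ℝ)] with t ht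
      exact hF t ht x₀ hx₀0
    exact d1.unique (d2.congr_of_eventuallyEq e)
  obtain ⟨K, hK, hAK⟩ := A.toLinearMap.exists_antilipschitzWith (LinearMap.ker_eq_bot.mpr hinj)
  have hKp : (0 : ℝ) < K := by exact_mod_cast hK
  have hA : ∀ w, (K : ℝ)⁻¹ * ‖w‖ ≤ ‖A w‖ := by
    intro w
    have := hAK.le_mul_dist w 0
    simp only [map_zero, dist_zero_right] at this
    rw [inv_mul_le_iff₀ hKp]
    exact this
  have hη : (0 : ℝ) < (K : ℝ)⁻¹ / (4 * (m - 1)) := by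
    have : 0 < m - 1 := by linarith
    positivity
  have hc : (0 : ℝ) < (K : ℝ)⁻¹ / (12 * (m - 1)) := by
    have : 0 < m - 1 := by linarith
    positivity
  obtain ⟨s, hs, happ⟩ := hstr.approximates_deriv_on_nhds
    (c := ⟨(K : ℝ)⁻¹ / (4 * (m - 1)), hη.le⟩) (Or.inr (by exact_mod_cast hη))
  obtain ⟨ε₁, hε₁, hs⟩ := Metric.mem_nhds_iff.mp hs
  obtain ⟨ε₂, hε₂, hcont⟩ := Metric.continuousAt_iff.mp hC1.continuousAt _ hη
  refine ⟨min (1 / 2) (min ε₁ ε₂), by positivity, (K : ℝ)⁻¹ / (12 * (m - 1)) / 2, by positivity, ?_⟩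
  have hgrad : ∀ x y, ‖gradient μ x - gradient μ y‖ = ‖fderiv ℝ μ x - fderiv ℝ μ y‖ := by
    intro x y
    simp only [gradient]
    rw [← map_sub, LinearIsometryEquiv.norm_map]
  have main : ∀ x y : EuclideanSpace ℝ (Fin d), x ≠ 0 → y ≠ 0 → ‖y‖ ≤ ‖x‖ →
      ‖‖x‖⁻¹ • x - x₀‖ < min (1 / 2) (min ε₁ ε₂) → ‖‖y‖⁻¹ • y - x₀‖ < min (1 / 2) (min ε₁ ε₂) →
      (K : ℝ)⁻¹ / (12 * (m - 1)) / 2 * ‖x - y‖ * (‖x‖ ^ (m - 2) + ‖y‖ ^ (m - 2)) ≤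
        ‖fderiv ℝ μ x - fderiv ℝ μ y‖ := by
    intro x y hx hy hxy h1 h2
    simp only [lt_min_iff] at h1 h2
    refine aux_scale (fderiv ℝ μ) _ m hm hc hF x y hx hy hxy ?_
    intro t ht ht1
    refine aux_core (fderiv ℝ μ) A _ (m - 1) (inv_pos.mpr hKp) (by linarith) hA x₀ _ _ hx₀ hE
      (by rw [norm_smul, norm_inv, norm_norm, inv_mul_cancel₀ (norm_ne_zero_iff.mpr hx)]) (by rw [norm_smul, norm_inv, norm_norm, inv_mul_cancel₀ (norm_ne_zero_iff.mpr hy)]) h1.1.le h2.1.le ?_ ?_ t ht ht1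
    · rw [← dist_eq_norm]
      exact (hcont (by rw [dist_eq_norm]; exact h1.2.2)).le
    · exact happ _ (hs (by rw [Metric.mem_ball, dist_eq_norm]; exact h1.2.1))
        _ (hs (by rw [Metric.mem_ball, dist_eq_norm]; exact h2.2.1))
  intro x y hx hy h1 h2
  rw [hgrad]
  rcases le_total ‖y‖ ‖x‖ with h | h
  · exact main x y hx hy h h1 h2
  · have := main y x hy hx h h2 h1
    rwa [norm_sub_rev y x, add_comm, norm_sub_rev (fderiv ℝ μ y)] at this
end
end

section
/- Assume (H). Then there exists a constant c > 0 such that |∇μ(x)| ≥ c |x|^{m−1} for every x ∈ ℝ^d with x ≠ 0. -/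
open MeasureTheory Real Complex
open scoped ENNReal RealInnerProductSpace

noncomputable section

/-- Under hypotheses (H), the gradient of `μ` satisfies the lower bound
`|∇μ(x)| ≥ c|x|^{m−1}` for all `x ≠ 0`. -/
theorem gradient_lower_bound (d : ℕ) (hd : 1 ≤ d) (m : ℝ) (hm : 2 ≤ m)
    (μ : EuclideanSpace ℝ (Fin d) → ℝ)
    (hsmooth : ContDiffOn ℝ (⊤ : ℕ∞) μ {x | x ≠ 0})
    (hhom : ∀ c : ℝ, 0 < c → ∀ x : EuclideanSpace ℝ (Fin d), x ≠ 0 →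
      μ (c • x) = c ^ m * μ x)
    (hhess : ∀ x : EuclideanSpace ℝ (Fin d), ‖x‖ = 1 →
      Function.Bijective ⇑(fderiv ℝ (fderiv ℝ μ) x)) :
    ∃ c : ℝ, 0 < c ∧ ∀ x : EuclideanSpace ℝ (Fin d), x ≠ 0 →
      c * ‖x‖ ^ (m - 1) ≤ ‖gradient μ x‖ := by
  have hopen : IsOpen {x : EuclideanSpace ℝ (Fin d) | x ≠ 0} := isOpen_ne
  have hC : ∀ x : EuclideanSpace ℝ (Fin d), x ≠ 0 → ContDiffAt ℝ (⊤ : ℕ∞) μ x :=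
    fun x hx => hsmooth.contDiffAt (hopen.mem_nhds hx)
  have hD : ∀ x : EuclideanSpace ℝ (Fin d), x ≠ 0 → DifferentiableAt ℝ μ x :=
    fun x hx => (hC x hx).differentiableAt (by simp)
  have hG : ∀ x : EuclideanSpace ℝ (Fin d), x ≠ 0 →
      DifferentiableAt ℝ (fderiv ℝ μ) x := fun x hx =>
    ((hC x hx).fderiv_right (m := 1) (WithTop.coe_le_coe.2 (le_top : (1 + 1 : ℕ∞) ≤ ⊤))).differentiableAt (by simp)
  have hGhom : ∀ c : ℝ, 0 < c → ∀ x : EuclideanSpace ℝ (Fin d), x ≠ 0 →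
      fderiv ℝ μ (c • x) = c ^ (m - 1) • fderiv ℝ μ x := by
    intro c hc x hx
    have hcx : c • x ≠ 0 := smul_ne_zero hc.ne' hx
    have h1 : HasFDerivAt (fun y => μ (c • y))
        ((fderiv ℝ μ (c • x)).comp (c • ContinuousLinearMap.id ℝ (EuclideanSpace ℝ (Fin d)))) x :=
      HasFDerivAt.comp x (hD _ hcx).hasFDerivAt ((hasFDerivAt_id x).const_smul c)
    have h2 : HasFDerivAt (fun y => c ^ m * μ y) (c ^ m • fderiv ℝ μ x) x :=
      (hD x hx).hasFDerivAt.const_mul _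
    have h3 : (fun y => μ (c • y)) =ᶠ[nhds x] (fun y => c ^ m * μ y) := by
      filter_upwards [hopen.mem_nhds hx] with y hy using hhom c hc y hy
    have h4 := h1.unique (h2.congr_of_eventuallyEq h3)
    ext v
    have h5 := congrArg (fun L => L v) h4
    simp only [ContinuousLinearMap.comp_apply, ContinuousLinearMap.smul_apply,
      ContinuousLinearMap.id_apply, map_smul, smul_eq_mul] at h5 ⊢
    rw [Real.rpow_sub_one hc.ne', div_mul_eq_mul_div, eq_div_iff hc.ne']
    linarith
  have hne : ∀ x : EuclideanSpace ℝ (Fin d), ‖x‖ = 1 → fderiv ℝ μ x ≠ 0 := by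
    intro x hx h0
    have hx0 : x ≠ 0 := by
      rintro rfl
      simp at hx
    have h1 : HasDerivAt (fun t : ℝ => t • x) x 1 := by
      simpa using (hasDerivAt_id (1 : ℝ)).smul_const x
    have h2 : HasDerivAt (fun t : ℝ => fderiv ℝ μ (t • x)) (fderiv ℝ (fderiv ℝ μ) x x) 1 := by
      have h : HasFDerivAt (fderiv ℝ μ) (fderiv ℝ (fderiv ℝ μ) x) ((1 : ℝ) • x) := by
        rw [one_smul]
        exact (hG x hx0).hasFDerivAt
      exact h.comp_hasDerivAt (1 : ℝ) h1
    have h3 : (fun t : ℝ => fderiv ℝ μ (t • x)) =ᶠ[nhds 1] fun _ => 0 := by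
      filter_upwards [lt_mem_nhds (zero_lt_one' ℝ)] with t ht
      rw [hGhom t ht x hx0, h0, smul_zero]
    have h4 := h2.unique ((hasDerivAt_const (1 : ℝ) _).congr_of_eventuallyEq h3)
    exact hx0 ((hhess x hx).1 (by rw [h4, map_zero]))
  have hnorm : ∀ x, ‖gradient μ x‖ = ‖fderiv ℝ μ x‖ := fun x => by
    simp [gradient]
  have : Nonempty (Fin d) := ⟨⟨0, hd⟩⟩
  have hcont : ContinuousOn (fun x => ‖fderiv ℝ μ x‖)
      (Metric.sphere (0 : EuclideanSpace ℝ (Fin d)) 1) := by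
    intro x hx
    exact (hG x (by rintro rfl; simp at hx)).continuousAt.norm.continuousWithinAt
  obtain ⟨x0, hx0, hmin⟩ := (isCompact_sphere (0 : EuclideanSpace ℝ (Fin d)) 1).exists_isMinOn
    (NormedSpace.sphere_nonempty.2 zero_le_one) hcont
  refine ⟨‖fderiv ℝ μ x0‖, norm_pos_iff.2 (hne x0 (by simpa using hx0)), ?_⟩
  intro x hx
  have hpos : 0 < ‖x‖ := norm_pos_iff.2 hx
  have hu : ‖x‖⁻¹ • x ∈ Metric.sphere (0 : EuclideanSpace ℝ (Fin d)) 1 := by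
    simp [norm_smul, hpos.ne']
  have h1 : ‖fderiv ℝ μ x0‖ ≤ ‖fderiv ℝ μ (‖x‖⁻¹ • x)‖ := hmin hu
  have h2 := hGhom ‖x‖ hpos (‖x‖⁻¹ • x) (smul_ne_zero (inv_ne_zero hpos.ne') hx)
  rw [smul_inv_smul₀ hpos.ne'] at h2
  rw [hnorm, h2, norm_smul, Real.norm_of_nonneg (Real.rpow_nonneg hpos.le _), mul_comm]
  exact mul_le_mul_of_nonneg_left h1 (Real.rpow_nonneg hpos.le _)
end
end

section
/- Assume (H). Then for every A > 0 one has sup_{ξ∈ℝ^d} λ({x ∈ ℝ^d : |x| ≥ 1 and |ξ − ∇μ(x)| ≤ A|x|^{m−2}}) < ∞, where λ denotes Lebesgue measure on ℝ^d; that is, the Lebesgue measure of the sets {x : |x| ≥ 1, |ξ − ∇μ(x)| ≤ A|x|^{m−2}} is bounded uniformly in ξ ∈ ℝ^d. -/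
open MeasureTheory Real Complex
open scoped ENNReal RealInnerProductSpace

noncomputable section

/-- The derivative of a homogeneous function is homogeneous. -/
lemma umb_fderiv_hom {E : Type*} [NormedAddCommGroup E] [NormedSpace ℝ E]
    (m : ℝ) (μ : E → ℝ)
    (hsmooth : ContDiffOn ℝ (⊤ : ℕ∞) μ {x | x ≠ 0})
    (hhom : ∀ c : ℝ, 0 < c → ∀ x : E, x ≠ 0 → μ (c • x) = c ^ m * μ x)
    (c : ℝ) (hc : 0 < c) (x : E) (hx : x ≠ 0) :
    fderiv ℝ μ (c • x) = c ^ (m - 1) • fderiv ℝ μ x := by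
  have hopen : IsOpen {x : E | x ≠ 0} := isOpen_ne
  have hd : DifferentiableAt ℝ μ x :=
    (hsmooth.contDiffAt (hopen.mem_nhds hx)).differentiableAt (by simp)
  have h1 : (fun y => μ (c • y)) =ᶠ[nhds x] fun y => c ^ m * μ y := by
    filter_upwards [hopen.mem_nhds hx] with y hy using hhom c hc y hy
  have h2 := h1.fderiv_eq (𝕜 := ℝ)
  rw [fderiv_comp_smul, fderiv_const_mul hd] at h2
  rw [Real.rpow_sub hc, Real.rpow_one, div_eq_inv_mul, mul_smul, ← h2, smul_smul,
    inv_mul_cancel₀ hc.ne', one_smul]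

/-- Uniform local lower Lipschitz bound on the sphere. -/
lemma umb_local {E : Type*} [NormedAddCommGroup E] [NormedSpace ℝ E] [FiniteDimensional ℝ E]
    (μ : E → ℝ)
    (hsmooth : ContDiffOn ℝ (⊤ : ℕ∞) μ {x | x ≠ 0})
    (hhess : ∀ x : E, ‖x‖ = 1 → Function.Bijective ⇑(fderiv ℝ (fderiv ℝ μ) x)) :
    ∃ κ > 0, ∃ δ > 0, ∀ x ∈ Metric.sphere (0 : E) 1, ∀ y, ‖y - x‖ ≤ δ →
      κ * ‖y - x‖ ≤ ‖fderiv ℝ μ y - fderiv ℝ μ x‖ := by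
  refine (isCompact_sphere (0 : E) 1).induction_on
    (p := fun s => ∃ κ > 0, ∃ δ > 0, ∀ x ∈ s, ∀ y, ‖y - x‖ ≤ δ →
      κ * ‖y - x‖ ≤ ‖fderiv ℝ μ y - fderiv ℝ μ x‖) ?_ ?_ ?_ ?_
  · exact ⟨1, one_pos, 1, one_pos, by simp⟩
  · rintro s t hst ⟨κ, hκ, δ, hδ, h⟩
    exact ⟨κ, hκ, δ, hδ, fun x hx => h x (hst hx)⟩
  · rintro s t ⟨κ, hκ, δ, hδ, h⟩ ⟨κ', hκ', δ', hδ', h'⟩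
    refine ⟨min κ κ', lt_min hκ hκ', min δ δ', lt_min hδ hδ', ?_⟩
    rintro x (hx | hx) y hy
    · exact (mul_le_mul_of_nonneg_right (min_le_left _ _) (norm_nonneg _)).trans
        (h x hx y (hy.trans (min_le_left _ _)))
    · exact (mul_le_mul_of_nonneg_right (min_le_right _ _) (norm_nonneg _)).trans
        (h' x hx y (hy.trans (min_le_right _ _)))
  · intro x hx
    have hx1 : ‖x‖ = 1 := by simpa using hx
    have hx0 : x ≠ 0 := by
      rintro rfl
      simp at hx1
    have hopen : IsOpen {x : E | x ≠ 0} := isOpen_ne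
    have hc : ContDiffAt ℝ 1 (fderiv ℝ μ) x :=
      (hsmooth.contDiffAt (hopen.mem_nhds hx0)).fderiv_right (m := 1) (by
        norm_cast)
    have hs : HasStrictFDerivAt (fderiv ℝ μ) (fderiv ℝ (fderiv ℝ μ) x) x :=
      hc.hasStrictFDerivAt (by simp)
    obtain ⟨K, hK, hanti⟩ := (fderiv ℝ (fderiv ℝ μ) x).toLinearMap.exists_antilipschitzWith
      (LinearMap.ker_eq_bot.mpr (hhess x hx1).1)
    have hK' : (0 : ℝ) < K := hK
    have hlo := Asymptotics.isLittleO_iff.mp hs.isLittleO (c := (2 * (K : ℝ))⁻¹) (by positivity)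
    obtain ⟨ε, hε, hball⟩ := Metric.eventually_nhds_iff_ball.mp hlo
    refine ⟨Metric.ball x (ε / 2), mem_nhdsWithin_of_mem_nhds (Metric.ball_mem_nhds _ (by positivity)),
      (2 * (K : ℝ))⁻¹, by positivity, ε / 4, by positivity, ?_⟩
    intro z hz y hy
    have hyx : y ∈ Metric.ball x ε := by
      rw [Metric.mem_ball] at hz ⊢
      rw [← dist_eq_norm] at hy
      linarith [dist_triangle y z x]
    have hzx : z ∈ Metric.ball x ε := Metric.ball_subset_ball (by linarith) hz
    have h1 := hball (y, z) (by rw [← ball_prod_same]; exact ⟨hyx, hzx⟩)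
    simp only at h1
    have h2 : ‖y - z‖ ≤ K * ‖fderiv ℝ (fderiv ℝ μ) x (y - z)‖ := by
      have := hanti.le_mul_dist (y - z) 0
      simpa using this
    have h3 : ‖fderiv ℝ (fderiv ℝ μ) x (y - z)‖ ≤ ‖fderiv ℝ μ y - fderiv ℝ μ z‖ +
        (2 * (K : ℝ))⁻¹ * ‖y - z‖ := by
      have h4 := norm_sub_norm_le (fderiv ℝ (fderiv ℝ μ) x (y - z))
        (fderiv ℝ μ y - fderiv ℝ μ z)
      rw [norm_sub_rev (fderiv ℝ (fderiv ℝ μ) x (y - z))] at h4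
      linarith
    have h5 : (K : ℝ)⁻¹ * ‖y - z‖ ≤ ‖fderiv ℝ (fderiv ℝ μ) x (y - z)‖ := by
      rw [inv_mul_le_iff₀ hK']; exact h2
    have h6 : (K : ℝ)⁻¹ = 2 * (2 * (K : ℝ))⁻¹ := by field_simp
    rw [h6] at h5
    linarith

/-- Combinatorial / covering step. -/
lemma umb_cover (d : ℕ) (Λ δ K R : ℝ) (hΛ : 1 ≤ Λ) (hδ : 0 < δ) (hR : 0 < R) :
    ∃ M : ℝ≥0∞, M < ⊤ ∧ ∀ S : Set (EuclideanSpace ℝ (Fin d)),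
      (∀ x ∈ S, ∀ y ∈ S, R ≤ ‖x‖ → R ≤ ‖y‖ → ‖x‖ ≤ Λ * ‖y‖) →
      (∀ x ∈ S, ∀ y ∈ S, R ≤ ‖x‖ → R ≤ ‖y‖ → ‖y - x‖ ≤ δ * ‖x‖ → ‖y - x‖ ≤ K) →
      volume S ≤ M := by
  have hΛ0 : 0 < Λ := by linarith
  obtain ⟨t, -, htf, hcov⟩ := (isCompact_closedBall (0 : EuclideanSpace ℝ (Fin d)) Λ).finite_cover_balls
    (e := δ / (2 * Λ)) (by positivity)
  refine ⟨volume (Metric.closedBall (0 : EuclideanSpace ℝ (Fin d)) R) +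
    htf.toFinset.card • volume (Metric.closedBall (0 : EuclideanSpace ℝ (Fin d)) K), ?_, ?_⟩
  · rw [nsmul_eq_mul]
    exact ENNReal.add_lt_top.mpr ⟨measure_closedBall_lt_top,
      ENNReal.mul_lt_top (ENNReal.natCast_lt_top _) measure_closedBall_lt_top⟩
  intro S h1 h2
  by_cases hne : ∃ x0 ∈ S, R ≤ ‖x0‖
  swap
  · push Not at hne
    refine (measure_mono ?_).trans le_self_add
    intro x hx
    simpa using (hne x hx).le
  obtain ⟨x0, hx0, hx0R⟩ := hne
  set ρ := ‖x0‖ with hρ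
  have hρ0 : 0 < ρ := by linarith
  have hsub : S ⊆ Metric.closedBall 0 R ∪ ⋃ z ∈ htf.toFinset,
      {x | x ∈ S ∧ R ≤ ‖x‖ ∧ ρ⁻¹ • x ∈ Metric.ball z (δ / (2 * Λ))} := by
    intro x hx
    by_cases hxR : R ≤ ‖x‖
    · right
      have hmem : ρ⁻¹ • x ∈ Metric.closedBall (0 : EuclideanSpace ℝ (Fin d)) Λ := by
        rw [mem_closedBall_zero_iff, norm_smul, norm_inv, Real.norm_of_nonneg hρ0.le,
          inv_mul_le_iff₀ hρ0, mul_comm]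
        exact h1 x hx x0 hx0 hxR hx0R
      have := hcov hmem
      simp only [Set.mem_iUnion] at this ⊢
      obtain ⟨z, hz, hzz⟩ := this
      exact ⟨z, by simpa using hz, hx, hxR, hzz⟩
    · left
      simpa using (not_le.mp hxR).le
  refine (measure_mono hsub).trans ((measure_union_le _ _).trans ?_)
  gcongr
  refine (measure_biUnion_finset_le _ _).trans ?_
  refine Finset.sum_le_card_nsmul _ _ _ ?_
  intro z hz
  by_cases hn : ∃ w, w ∈ S ∧ R ≤ ‖w‖ ∧ ρ⁻¹ • w ∈ Metric.ball z (δ / (2 * Λ))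
  swap
  · push Not at hn
    have : {x | x ∈ S ∧ R ≤ ‖x‖ ∧ ρ⁻¹ • x ∈ Metric.ball z (δ / (2 * Λ))} = ∅ := by
      ext x
      simp only [Set.mem_ofPred_eq, Set.mem_empty_iff_false, iff_false]
      rintro ⟨a, b, c⟩
      exact hn x a b c
    rw [this]; simp
  obtain ⟨w, hw, hwR, hwz⟩ := hn
  have : volume (Metric.closedBall (0 : EuclideanSpace ℝ (Fin d)) K) = volume (Metric.closedBall w K) :=
    (Measure.addHaar_closedBall_center _ _ _).symm
  rw [this]
  refine measure_mono ?_
  rintro x ⟨hx, hxR, hxz⟩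
  rw [Metric.mem_closedBall, dist_eq_norm]
  refine h2 w hw x hx hwR hxR ?_
  have hlt : dist (ρ⁻¹ • x) (ρ⁻¹ • w) ≤ δ / Λ := by
    rw [Metric.mem_ball] at hxz hwz
    have := dist_triangle_right (ρ⁻¹ • x) (ρ⁻¹ • w) z
    have e : δ / Λ = δ / (2 * Λ) + δ / (2 * Λ) := by field_simp; ring
    linarith
  rw [dist_eq_norm, ← smul_sub, norm_smul, norm_inv, Real.norm_of_nonneg hρ0.le,
    inv_mul_le_iff₀ hρ0] at hlt
  refine hlt.trans ?_
  have := h1 x0 hx0 w hw hx0R hwR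
  calc ρ * (δ / Λ) ≤ (Λ * ‖w‖) * (δ / Λ) := by gcongr
    _ = δ * ‖w‖ := by field_simp

/-- Under hypotheses (H), for every `A > 0` the Lebesgue measure of the sets
`{x : |x| ≥ 1, |ξ − ∇μ(x)| ≤ A|x|^{m−2}}` is bounded uniformly with respect to `ξ ∈ ℝ^d`. -/
theorem uniform_measure_bound (d : ℕ) (hd : 1 ≤ d) (m : ℝ) (hm : 2 ≤ m)
    (μ : EuclideanSpace ℝ (Fin d) → ℝ)
    (hsmooth : ContDiffOn ℝ (⊤ : ℕ∞) μ {x | x ≠ 0})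
    (hhom : ∀ c : ℝ, 0 < c → ∀ x : EuclideanSpace ℝ (Fin d), x ≠ 0 →
      μ (c • x) = c ^ m * μ x)
    (hhess : ∀ x : EuclideanSpace ℝ (Fin d), ‖x‖ = 1 →
      Function.Bijective ⇑(fderiv ℝ (fderiv ℝ μ) x)) :
    ∀ A : ℝ, 0 < A →
      (⨆ ξ : EuclideanSpace ℝ (Fin d),
        volume {x : EuclideanSpace ℝ (Fin d) |
          1 ≤ ‖x‖ ∧ ‖ξ - gradient μ x‖ ≤ A * ‖x‖ ^ (m - 2)}) < ⊤ := by
  intro A hA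
  have hF := umb_fderiv_hom m μ hsmooth hhom
  obtain ⟨κ, hκ, δ₀, hδ₀, hloc₀⟩ := umb_local μ hsmooth hhess
  -- shrink the radius so that it is less than one
  obtain ⟨δ, hδ, hδ1, hloc⟩ : ∃ δ : ℝ, 0 < δ ∧ δ < 1 ∧
      ∀ x ∈ Metric.sphere (0 : EuclideanSpace ℝ (Fin d)) 1, ∀ y, ‖y - x‖ ≤ δ →
      κ * ‖y - x‖ ≤ ‖fderiv ℝ μ y - fderiv ℝ μ x‖ :=
    ⟨min δ₀ (1 / 2), lt_min hδ₀ (by norm_num), (min_le_right _ _).trans_lt (by norm_num),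
      fun x hx y hy => hloc₀ x hx y (hy.trans (min_le_left _ _))⟩
  -- unit vectors
  have hunit : ∀ x : EuclideanSpace ℝ (Fin d), x ≠ 0 →
      ‖x‖⁻¹ • x ∈ Metric.sphere (0 : EuclideanSpace ℝ (Fin d)) 1 := by
    intro x hx
    rw [mem_sphere_zero_iff_norm, norm_smul, norm_inv, norm_norm,
      inv_mul_cancel₀ (norm_ne_zero_iff.mpr hx)]
  -- scaling
  have hscale : ∀ x y : EuclideanSpace ℝ (Fin d), x ≠ 0 → y ≠ 0 →
      fderiv ℝ μ y = ‖x‖ ^ (m - 1) • fderiv ℝ μ (‖x‖⁻¹ • y) := by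
    intro x y hx hy
    have hx' := norm_pos_iff.mpr hx
    rw [← hF _ hx' _ (smul_ne_zero (inv_ne_zero hx'.ne') hy), smul_smul,
      mul_inv_cancel₀ hx'.ne', one_smul]
  have hopen : IsOpen {x : EuclideanSpace ℝ (Fin d) | x ≠ 0} := isOpen_ne
  -- upper bound
  obtain ⟨C, hC⟩ : ∃ C, ∀ x ∈ Metric.sphere (0 : EuclideanSpace ℝ (Fin d)) 1,
      ‖fderiv ℝ μ x‖ ≤ C := by
    refine (isCompact_sphere _ _).exists_bound_of_continuousOn ?_
    refine (hsmooth.continuousOn_fderiv_of_isOpen hopen (by simp)).mono ?_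
    rintro x hx rfl
    simp at hx
  have hup : ∀ x : EuclideanSpace ℝ (Fin d), x ≠ 0 →
      ‖fderiv ℝ μ x‖ ≤ max C 0 * ‖x‖ ^ (m - 1) := by
    intro x hx
    rw [hscale x x hx hx, norm_smul, Real.norm_of_nonneg (by positivity), mul_comm]
    gcongr
    exact (hC _ (hunit x hx)).trans (le_max_left _ _)
  -- lower bound
  obtain ⟨c, hc, hlow⟩ : ∃ c : ℝ, 0 < c ∧ ∀ x : EuclideanSpace ℝ (Fin d), x ≠ 0 →
      c * ‖x‖ ^ (m - 1) ≤ ‖fderiv ℝ μ x‖ := by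
    have hpos : 0 < (1 + δ) ^ (m - 1) - 1 := by
      have := Real.one_lt_rpow (x := 1 + δ) (z := m - 1) (by linarith) (by linarith)
      linarith
    refine ⟨κ * δ / ((1 + δ) ^ (m - 1) - 1), by positivity, ?_⟩
    intro x hx
    rw [hscale x x hx hx, norm_smul, Real.norm_of_nonneg (by positivity), mul_comm]
    gcongr
    have hu := hunit x hx
    set u := ‖x‖⁻¹ • x
    have hu1 : ‖u‖ = 1 := by simpa using hu
    have hu0 : u ≠ 0 := by
      rw [← norm_pos_iff, hu1]; exact one_pos
    have e : (1 + δ) • u - u = δ • u := by rw [add_smul, one_smul]; abel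
    have en : ‖(1 + δ) • u - u‖ = δ := by
      rw [e, norm_smul, hu1, Real.norm_of_nonneg hδ.le, mul_one]
    have h := hloc u hu ((1 + δ) • u) en.le
    rw [en, hF _ (by linarith) u hu0] at h
    have e2 : (1 + δ) ^ (m - 1) • fderiv ℝ μ u - fderiv ℝ μ u =
        ((1 + δ) ^ (m - 1) - 1) • fderiv ℝ μ u := by rw [sub_smul, one_smul]
    rw [e2, norm_smul, Real.norm_of_nonneg hpos.le] at h
    rw [div_le_iff₀ hpos]
    linarith
  -- scaled local lower Lipschitz bound
  have hlip : ∀ x y : EuclideanSpace ℝ (Fin d), x ≠ 0 → y ≠ 0 → ‖y - x‖ ≤ δ * ‖x‖ →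
      κ * ‖x‖ ^ (m - 2) * ‖y - x‖ ≤ ‖fderiv ℝ μ y - fderiv ℝ μ x‖ := by
    intro x y hx hy hxy
    have hx' := norm_pos_iff.mpr hx
    have e : ‖‖x‖⁻¹ • y - ‖x‖⁻¹ • x‖ = ‖x‖⁻¹ * ‖y - x‖ := by
      rw [← smul_sub, norm_smul, norm_inv, norm_norm]
    have h := hloc _ (hunit x hx) (‖x‖⁻¹ • y) (by
      rw [e, inv_mul_le_iff₀ hx', mul_comm]; exact hxy)
    rw [e] at h
    rw [hscale x y hx hy, hscale x x hx hx, ← smul_sub, norm_smul,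
      Real.norm_of_nonneg (by positivity)]
    calc κ * ‖x‖ ^ (m - 2) * ‖y - x‖ = ‖x‖ ^ (m - 1) * (κ * (‖x‖⁻¹ * ‖y - x‖)) := by
          have : ‖x‖ ^ (m - 1) = ‖x‖ ^ (m - 2) * ‖x‖ := by
            rw [← Real.rpow_add_one hx'.ne']; congr 1; ring
          rw [this]; field_simp
      _ ≤ _ := by gcongr
  set C' := max C 0
  have hC' : 0 ≤ C' := le_max_right _ _
  set Λ := max 1 (2 * (C' + A) / c) with hΛdef
  have hΛ : 1 ≤ Λ := le_max_left _ _
  set R := max 1 (2 * A / c) with hRdef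
  have hR : 1 ≤ R := le_max_left _ _
  obtain ⟨M, hM, hcover⟩ := umb_cover d Λ δ (A * (2 ^ (m - 2) + 1) / κ) R hΛ hδ (by linarith)
  refine lt_of_le_of_lt (iSup_le fun ξ => hcover _ ?_ ?_) hM
  all_goals
    rintro x ⟨hx1, hx⟩ y ⟨hy1, hy⟩ hxR hyR
    have hx' : 0 < ‖x‖ := by linarith
    have hy' : 0 < ‖y‖ := by linarith
    have hx0 : x ≠ 0 := norm_pos_iff.mp hx'
    have hy0 : y ≠ 0 := norm_pos_iff.mp hy'
    have hg : ∀ z, ‖ξ - gradient μ z‖ =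
        ‖InnerProductSpace.toDual ℝ _ ξ - fderiv ℝ μ z‖ := by
      intro z
      rw [← (InnerProductSpace.toDual ℝ (EuclideanSpace ℝ (Fin d))).norm_map, map_sub]
      simp [gradient]
    rw [hg] at hx hy
    set ℓ := InnerProductSpace.toDual ℝ (EuclideanSpace ℝ (Fin d)) ξ
    have hpow : ∀ z : EuclideanSpace ℝ (Fin d), 0 < ‖z‖ →
        ‖z‖ ^ (m - 1) = ‖z‖ ^ (m - 2) * ‖z‖ := by
      intro z hz
      rw [← Real.rpow_add_one hz.ne']; congr 1; ring
  · by_contra! hcon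
    have k1 : c / 2 * ‖x‖ ^ (m - 1) ≤ ‖ℓ‖ := by
      have a1 := hlow x hx0
      have a2 := norm_sub_norm_le (fderiv ℝ μ x) ℓ
      rw [norm_sub_rev] at a2
      have a3 : A * ‖x‖ ^ (m - 2) ≤ c / 2 * ‖x‖ ^ (m - 1) := by
        have : 2 * A / c ≤ ‖x‖ := (le_max_right _ _).trans hxR
        rw [div_le_iff₀ hc] at this
        rw [hpow x hx']
        have : A ≤ c / 2 * ‖x‖ := by linarith
        calc A * ‖x‖ ^ (m - 2) ≤ (c / 2 * ‖x‖) * ‖x‖ ^ (m - 2) := by gcongr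
          _ = _ := by ring
      linarith
    have k2 : ‖ℓ‖ ≤ (C' + A) * ‖y‖ ^ (m - 1) := by
      have a1 := hup y hy0
      have a2 := norm_sub_norm_le ℓ (fderiv ℝ μ y)
      have a3 : A * ‖y‖ ^ (m - 2) ≤ A * ‖y‖ ^ (m - 1) := by
        have := Real.rpow_le_rpow_of_exponent_le hy1 (show m - 2 ≤ m - 1 by linarith)
        gcongr
      linarith
    have k3 : Λ * ‖y‖ ^ (m - 1) < ‖x‖ ^ (m - 1) := by
      calc Λ * ‖y‖ ^ (m - 1) ≤ Λ ^ (m - 1) * ‖y‖ ^ (m - 1) := by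
            gcongr
            exact Real.self_le_rpow_of_one_le hΛ (by linarith)
        _ = (Λ * ‖y‖) ^ (m - 1) := by
            rw [Real.mul_rpow (by linarith) hy'.le]
        _ < _ := Real.rpow_lt_rpow (by positivity) hcon (by linarith)
    have k4 : 2 * (C' + A) / c ≤ Λ := le_max_right _ _
    rw [div_le_iff₀ hc] at k4
    have hyp : 0 < ‖y‖ ^ (m - 1) := by positivity
    nlinarith [mul_lt_mul_of_pos_left k3 hc, mul_le_mul_of_nonneg_right k4 hyp.le]
  · intro hxy
    have h1 := hlip x y hx0 hy0 hxy
    have h2 : ‖fderiv ℝ μ y - fderiv ℝ μ x‖ ≤ ‖ℓ - fderiv ℝ μ x‖ + ‖ℓ - fderiv ℝ μ y‖ := by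
      have := norm_sub_le (ℓ - fderiv ℝ μ x) (ℓ - fderiv ℝ μ y)
      rwa [sub_sub_sub_cancel_left] at this
    have h3 : ‖y‖ ≤ 2 * ‖x‖ := by
      have := norm_sub_norm_le y x
      nlinarith
    have h4 : ‖y‖ ^ (m - 2) ≤ 2 ^ (m - 2) * ‖x‖ ^ (m - 2) := by
      rw [← Real.mul_rpow (by norm_num) hx'.le]
      exact Real.rpow_le_rpow hy'.le h3 (by linarith)
    have hp : 0 < ‖x‖ ^ (m - 2) := by positivity
    have h5 : (κ * ‖y - x‖) * ‖x‖ ^ (m - 2) ≤ (A * (2 ^ (m - 2) + 1)) * ‖x‖ ^ (m - 2) := by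
      have := mul_le_mul_of_nonneg_left h4 hA.le
      linarith
    have h6 := le_of_mul_le_mul_right h5 hp
    rw [le_div_iff₀ hκ]
    linarith
end
end

section
/- Assume (H). Then for every x₀ ∈ ℝ^d with |x₀| = 1 there exists ε > 0 such that, with Γ := {u ∈ ℝ^d∖{0} : |u/|u| − x₀| < ε}, for every real N > d one has sup_{ξ∈ℝ^d} ∫_{{x ∈ Γ : |x| ≥ 1}} ⟨ξ − ∇μ(x)⟩^{-N} dx < ∞. -/
open MeasureTheory Real Complex
open scoped ENNReal RealInnerProductSpace

noncomputable section

/-- Homogeneity passes to the derivative. -/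
lemma fderiv_homog {E F : Type*} [NormedAddCommGroup E] [NormedSpace ℝ E]
    [NormedAddCommGroup F] [NormedSpace ℝ F] (f : E → F) (p : ℝ)
    (h : ∀ c : ℝ, 0 < c → ∀ x : E, x ≠ 0 → f (c • x) = c ^ p • f x)
    (c : ℝ) (hc : 0 < c) (x : E) (hx : x ≠ 0)
    (hd : DifferentiableAt ℝ f x) :
    fderiv ℝ f (c • x) = c ^ (p - 1) • fderiv ℝ f x := by
  have h1 : fderiv ℝ (fun y => f (c • y)) x = fderiv ℝ (fun y => c ^ p • f y) x := by
    apply Filter.EventuallyEq.fderiv_eq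
    filter_upwards [isOpen_ne.mem_nhds hx] with y hy
    exact h c hc y hy
  rw [fderiv_comp_smul, fderiv_fun_const_smul hd] at h1
  rw [Real.rpow_sub_one hc.ne', div_eq_inv_mul, mul_smul, ← h1, smul_smul,
    inv_mul_cancel₀ hc.ne', one_smul]

/-- The unit-sphere distance in terms of the inner product. -/
lemma cone_iff {E : Type*} [NormedAddCommGroup E] [InnerProductSpace ℝ E]
    (x₀ z : E) (h0 : ‖x₀‖ = 1) (hz : z ≠ 0) (ε : ℝ) (hε : 0 < ε) :
    ‖‖z‖⁻¹ • z - x₀‖ < ε ↔ (1 - ε ^ 2 / 2) * ‖z‖ < inner ℝ z x₀ := by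
  have hp : 0 < ‖z‖ := norm_pos_iff.2 hz
  have h1 : ‖‖z‖⁻¹ • z - x₀‖ ^ 2 = 2 - 2 * (‖z‖⁻¹ * inner ℝ z x₀) := by
    rw [norm_sub_sq_real, norm_smul, inner_smul_left, h0, norm_inv, norm_norm,
      inv_mul_cancel₀ hp.ne']
    simp
    ring
  rw [← sq_lt_sq₀ (norm_nonneg _) hε.le, h1]
  have h2 : inner ℝ z x₀ = (‖z‖⁻¹ * inner ℝ z x₀) * ‖z‖ := by field_simp
  rw [h2]
  rw [mul_lt_mul_iff_left₀ hp]
  rw [← h2]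
  constructor <;> intro h <;> linarith

set_option maxHeartbeats 2000000 in
/-- Global lower Lipschitz bound for the derivative on a truncated conic neighbourhood. -/
lemma antilip {E : Type*} [NormedAddCommGroup E] [InnerProductSpace ℝ E]
    [FiniteDimensional ℝ E] (m : ℝ) (hm : 2 ≤ m) (μ : E → ℝ)
    (hsmooth : ContDiffOn ℝ (⊤ : ℕ∞) μ {x | x ≠ 0})
    (hhom : ∀ c : ℝ, 0 < c → ∀ x : E, x ≠ 0 → μ (c • x) = c ^ m * μ x)
    (hhess : ∀ x : E, ‖x‖ = 1 → Function.Bijective ⇑(fderiv ℝ (fderiv ℝ μ) x))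
    (x₀ : E) (h0 : ‖x₀‖ = 1) :
    ∃ ε : ℝ, 0 < ε ∧ ∃ c : ℝ, 0 < c ∧ ∀ x y : E,
      1 ≤ ‖x‖ → ‖‖x‖⁻¹ • x - x₀‖ < ε → 1 ≤ ‖y‖ → ‖‖y‖⁻¹ • y - x₀‖ < ε →
      c * ‖x - y‖ ≤ ‖fderiv ℝ μ x - fderiv ℝ μ y‖ := by
  have hopen : IsOpen {x : E | x ≠ 0} := isOpen_ne
  have hG : ContDiffOn ℝ (⊤ : ℕ∞) (fderiv ℝ μ) {x | x ≠ 0} :=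
    hsmooth.fderiv_of_isOpen hopen (by exact_mod_cast le_top)
  have hH : ContDiffOn ℝ (⊤ : ℕ∞) (fderiv ℝ (fderiv ℝ μ)) {x | x ≠ 0} :=
    hG.fderiv_of_isOpen hopen (by exact_mod_cast le_top)
  have dμ : ∀ x : E, x ≠ 0 → DifferentiableAt ℝ μ x := fun x hx =>
    (hsmooth.differentiableOn (by simp)).differentiableAt (hopen.mem_nhds hx)
  have dG : ∀ x : E, x ≠ 0 → DifferentiableAt ℝ (fderiv ℝ μ) x := fun x hx =>
    (hG.differentiableOn (by simp)).differentiableAt (hopen.mem_nhds hx)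
  have Ghom : ∀ c : ℝ, 0 < c → ∀ x : E, x ≠ 0 →
      fderiv ℝ μ (c • x) = c ^ (m - 1) • fderiv ℝ μ x := fun c hc x hx =>
    fderiv_homog μ m (fun c hc x hx => by rw [hhom c hc x hx, smul_eq_mul]) c hc x hx (dμ x hx)
  have Hhom : ∀ c : ℝ, 0 < c → ∀ x : E, x ≠ 0 →
      fderiv ℝ (fderiv ℝ μ) (c • x) = c ^ (m - 1 - 1) • fderiv ℝ (fderiv ℝ μ) x :=
    fun c hc x hx => fderiv_homog _ (m - 1) Ghom c hc x hx (dG x hx)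
  have hx0 : x₀ ≠ 0 := by
    intro h; simp [h] at h0
  set A := fderiv ℝ (fderiv ℝ μ) x₀ with hA
  obtain ⟨K, hK, hAK⟩ := LinearMap.exists_antilipschitzWith (A : E →ₗ[ℝ] (E →L[ℝ] ℝ))
    (LinearMap.ker_eq_bot.2 (hhess x₀ h0).1)
  have hAv : ∀ v : E, ‖v‖ ≤ K * ‖A v‖ := by
    intro v
    have := hAK.le_mul_dist v 0
    simpa using this
  have hK' : (0 : ℝ) < K := by exact_mod_cast hK
  have hcont : ContinuousAt (fderiv ℝ (fderiv ℝ μ)) x₀ :=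
    hH.continuousOn.continuousAt (hopen.mem_nhds hx0)
  obtain ⟨δ, hδ, hδ'⟩ := (Metric.continuousAt_iff (α := E) (β := E →L[ℝ] E →L[ℝ] ℝ)
    (f := fderiv ℝ (fderiv ℝ μ)) (a := x₀)).1 hcont (1 / (2 * K)) (by positivity)
  refine ⟨min δ 1, by positivity, (1 / 2 : ℝ) ^ (m - 2) * (1 / (2 * K)), by positivity, ?_⟩
  set ε := min δ 1 with hε
  have hεp : 0 < ε := by positivity
  have hε1 : ε ≤ 1 := min_le_right _ _
  have hεδ : ε ≤ δ := min_le_left _ _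
  intro x y hx hx' hy hy'
  have hxn : x ≠ 0 := by rintro rfl; simp at hx; linarith
  have hyn : y ≠ 0 := by rintro rfl; simp at hy; linarith
  rw [cone_iff x₀ x h0 hxn ε hεp] at hx'
  rw [cone_iff x₀ y h0 hyn ε hεp] at hy'
  have hθ : (1 / 2 : ℝ) ≤ 1 - ε ^ 2 / 2 := by nlinarith
  set v := x - y with hv
  rcases eq_or_ne v 0 with hv0 | hv0
  · rw [hv0]; simp
  have hvp : 0 < ‖v‖ := norm_pos_iff.2 hv0
  have hAvp : 0 < ‖A v‖ := by
    by_contra hcon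
    have := hAv v
    nlinarith [norm_nonneg (A v)]
  -- points on the segment
  have hseg : ∀ t : ℝ, 0 ≤ t → t ≤ 1 → 1 / 2 ≤ ‖y + t • v‖ ∧
      ‖‖y + t • v‖⁻¹ • (y + t • v) - x₀‖ < ε := by
    intro t ht0 ht1
    have e : y + t • v = (1 - t) • y + t • x := by rw [hv]; module
    have hin : inner ℝ (y + t • v) x₀ = (1 - t) * inner ℝ y x₀ + t * inner ℝ x x₀ := by
      rw [e, inner_add_left, inner_smul_left, inner_smul_left]; simp
    have hno : ‖y + t • v‖ ≤ (1 - t) * ‖y‖ + t * ‖x‖ := by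
      rw [e]
      refine (norm_add_le _ _).trans ?_
      rw [norm_smul, norm_smul, Real.norm_of_nonneg ht0, Real.norm_of_nonneg (by linarith)]
    have hyi : 1 / 2 < inner ℝ y x₀ := by nlinarith
    have hxi : 1 / 2 < inner ℝ x x₀ := by nlinarith
    have hzi : 1 / 2 ≤ inner ℝ (y + t • v) x₀ := by rw [hin]; nlinarith
    have hz : 1 / 2 ≤ ‖y + t • v‖ := by
      have := real_inner_le_norm (y + t • v) x₀
      rw [h0, mul_one] at this
      linarith
    have hzn : y + t • v ≠ 0 := by
      intro h; rw [h, norm_zero] at hz; linarith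
    refine ⟨hz, ?_⟩
    rw [cone_iff x₀ _ h0 hzn ε hεp, hin]
    have s1 : (1 - ε ^ 2 / 2) * ‖y + t • v‖ ≤ (1 - ε ^ 2 / 2) * ((1 - t) * ‖y‖ + t * ‖x‖) :=
      mul_le_mul_of_nonneg_left hno (by linarith)
    have s2 : 0 < (1 - t) * (inner ℝ y x₀ - (1 - ε ^ 2 / 2) * ‖y‖)
        + t * (inner ℝ x x₀ - (1 - ε ^ 2 / 2) * ‖x‖) := by
      rcases ht0.eq_or_lt with h | h
      · rw [← h]; simp; linarith
      · have := mul_pos h (sub_pos.2 hx')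
        have := mul_nonneg (sub_nonneg.2 ht1) (sub_pos.2 hy').le
        linarith
    nlinarith
  set w : E := (InnerProductSpace.toDual ℝ E).symm (A v) with hw
  have hwn : ‖w‖ = ‖A v‖ := LinearIsometryEquiv.norm_map _ _
  have hAw : A v w = ‖A v‖ ^ 2 := by
    have : A v w = inner ℝ w w := by
      rw [hw, InnerProductSpace.toDual_symm_apply]
    rw [this, real_inner_self_eq_norm_sq, hwn]
  have hder : ∀ t : ℝ, 0 ≤ t → t ≤ 1 →
      HasDerivAt (fun t : ℝ => fderiv ℝ μ (y + t • v) w)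
        (fderiv ℝ (fderiv ℝ μ) (y + t • v) v w) t := by
    intro t ht0 ht1
    have hzn : y + t • v ≠ 0 := by
      intro h
      have := (hseg t ht0 ht1).1
      rw [h, norm_zero] at this; linarith
    have h1 : HasDerivAt (fun t : ℝ => y + t • v) v t := by
      simpa using ((hasDerivAt_id t).smul_const v).const_add y
    have h2 := (dG _ hzn).hasFDerivAt.comp_hasDerivAt t h1
    exact ((ContinuousLinearMap.apply ℝ ℝ w).hasFDerivAt.comp_hasDerivAt t h2)
  obtain ⟨t, ht, hmvt⟩ := exists_hasDerivAt_eq_slope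
    (fun t : ℝ => fderiv ℝ μ (y + t • v) w)
    (fun t : ℝ => fderiv ℝ (fderiv ℝ μ) (y + t • v) v w) (zero_lt_one' ℝ)
    (fun t ht => (hder t ht.1 ht.2).continuousAt.continuousWithinAt)
    (fun t ht => hder t ht.1.le ht.2.le)
  obtain ⟨hz, hzc⟩ := hseg t ht.1.le ht.2.le
  set z := y + t • v with hzdef
  have hzp : 0 < ‖z‖ := by linarith
  have hzn : z ≠ 0 := norm_pos_iff.1 hzp
  have hω : ‖z‖⁻¹ • z ≠ 0 := smul_ne_zero (inv_ne_zero hzp.ne') hzn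
  have hHz := Hhom ‖z‖ hzp (‖z‖⁻¹ • z) hω
  rw [smul_smul, mul_inv_cancel₀ hzp.ne', one_smul] at hHz
  set B := fderiv ℝ (fderiv ℝ μ) (‖z‖⁻¹ • z) with hB
  have hBA : ‖B - A‖ < 1 / (2 * K) := by
    have := hδ' (x := ‖z‖⁻¹ • z) (by rw [dist_eq_norm]; linarith)
    exact (dist_eq_norm B A).symm.trans_lt this
  have hval : fderiv ℝ (fderiv ℝ μ) z v w = ‖z‖ ^ (m - 2) * B v w := by
    rw [hHz]
    simp only [smul_apply, smul_eq_mul]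
    congr 2; ring
  have hslope : fderiv ℝ (fderiv ℝ μ) z v w = (fderiv ℝ μ x - fderiv ℝ μ y) w := by
    rw [hmvt]
    have : y + v = x := by rw [hv]; abel
    simp [this]
  have hBv : ‖v‖ / (2 * K) * ‖A v‖ ≤ B v w := by
    have e1 : B v w = A v w + (B - A) v w := by simp
    have e2 : |(B - A) v w| ≤ ‖B - A‖ * ‖v‖ * ‖w‖ := by
      rw [← Real.norm_eq_abs]; exact (B - A).le_opNorm₂ v w
    have e3 : ‖B - A‖ * ‖v‖ * ‖w‖ ≤ 1 / (2 * K) * ‖v‖ * ‖A v‖ := by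
      rw [hwn]; gcongr
    have e4 : ‖v‖ / K ≤ ‖A v‖ := by
      rw [div_le_iff₀ hK', mul_comm]; exact hAv v
    have e5 : ‖v‖ / K * ‖A v‖ ≤ ‖A v‖ ^ 2 := by
      rw [sq]; gcongr
    have e6 : ‖v‖ / K * ‖A v‖ = ‖v‖ / (2 * K) * ‖A v‖ + 1 / (2 * K) * ‖v‖ * ‖A v‖ := by
      field_simp; ring
    have e7 := neg_abs_le ((B - A) v w)
    rw [e1, hAw]
    linarith
  have hpow : (1 / 2 : ℝ) ^ (m - 2) ≤ ‖z‖ ^ (m - 2) :=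
    Real.rpow_le_rpow (by norm_num) hz (by linarith)
  have hfin : (1 / 2 : ℝ) ^ (m - 2) * (‖v‖ / (2 * K) * ‖A v‖) ≤
      ‖fderiv ℝ μ x - fderiv ℝ μ y‖ * ‖A v‖ := by
    calc (1 / 2 : ℝ) ^ (m - 2) * (‖v‖ / (2 * K) * ‖A v‖)
        ≤ ‖z‖ ^ (m - 2) * B v w := by gcongr
      _ = (fderiv ℝ μ x - fderiv ℝ μ y) w := by rw [← hval, hslope]
      _ ≤ ‖(fderiv ℝ μ x - fderiv ℝ μ y) w‖ := Real.le_norm_self _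
      _ ≤ ‖fderiv ℝ μ x - fderiv ℝ μ y‖ * ‖w‖ := ContinuousLinearMap.le_opNorm _ _
      _ = _ := by rw [hwn]
  refine le_of_mul_le_mul_right ?_ hAvp
  refine le_trans (le_of_eq ?_) hfin
  ring

/-- Pointwise comparison of brackets. -/
lemma bracket_bound (c R s N : ℝ) (hc : 0 < c) (hR : 0 ≤ R) (hs : 0 ≤ s) (hN : 0 ≤ N)
    (h : c * s ≤ 2 * R + 1) :
    (1 + R ^ 2) ^ (-(N / 2)) ≤ (1 + 3 / c) ^ N * (1 + s) ^ (-N) := by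
  have h1 : 1 + s ≤ (1 + 3 / c) * √(1 + R ^ 2) := by
    have a : 1 ≤ √(1 + R ^ 2) := Real.one_le_sqrt.2 (by nlinarith)
    have b : R ≤ √(1 + R ^ 2) := Real.le_sqrt_of_sq_le (by linarith)
    have e : s ≤ 3 / c * √(1 + R ^ 2) := by
      rw [div_mul_eq_mul_div, le_div_iff₀ hc]; linarith
    linarith
  have h2 : (1 + R ^ 2) ^ (-(N / 2)) = (√(1 + R ^ 2)) ^ (-N) := by
    rw [Real.sqrt_eq_rpow, ← Real.rpow_mul (by positivity)]
    congr 1; ring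
  have hq : 0 < √(1 + R ^ 2) := by positivity
  rw [h2, Real.rpow_neg hq.le, Real.rpow_neg (by positivity), ← div_eq_mul_inv,
    inv_eq_one_div, div_le_div_iff₀ (by positivity) (by positivity), one_mul,
    ← Real.mul_rpow (by positivity) hq.le]
  exact Real.rpow_le_rpow (by positivity) h1 hN

/-- Under hypotheses (H), every `x₀` on the unit sphere has a conic
neighbourhood `Γ = {u ≠ 0 : |u/|u| − x₀| < ε}` such that, for every real `N > d`,
`sup_ξ ∫_{x ∈ Γ, |x| ≥ 1} ⟨ξ − ∇μ(x)⟩^{-N} dx < ∞`. -/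
theorem conic_japanese_bracket_integral (d : ℕ) (hd : 1 ≤ d) (m : ℝ) (hm : 2 ≤ m)
    (μ : EuclideanSpace ℝ (Fin d) → ℝ)
    (hsmooth : ContDiffOn ℝ (⊤ : ℕ∞) μ {x | x ≠ 0})
    (hhom : ∀ c : ℝ, 0 < c → ∀ x : EuclideanSpace ℝ (Fin d), x ≠ 0 →
      μ (c • x) = c ^ m * μ x)
    (hhess : ∀ x : EuclideanSpace ℝ (Fin d), ‖x‖ = 1 →
      Function.Bijective ⇑(fderiv ℝ (fderiv ℝ μ) x)) :
    ∀ x₀ : EuclideanSpace ℝ (Fin d), ‖x₀‖ = 1 →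
      ∃ ε : ℝ, 0 < ε ∧ ∀ N : ℝ, (d : ℝ) < N →
        (⨆ ξ : EuclideanSpace ℝ (Fin d),
          ∫⁻ x in {x : EuclideanSpace ℝ (Fin d) | 1 ≤ ‖x‖ ∧ ‖‖x‖⁻¹ • x - x₀‖ < ε},
            ENNReal.ofReal ((1 + ‖ξ - gradient μ x‖ ^ 2) ^ (-(N / 2))) ∂volume) < ⊤ := by
  intro x₀ h0
  obtain ⟨ε, hε, c, hc, hanti⟩ := antilip m hm μ hsmooth hhom hhess x₀ h0
  refine ⟨ε, hε, fun N hN => ?_⟩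
  have hN0 : 0 ≤ N := (Nat.cast_nonneg d).trans hN.le
  set S : Set (EuclideanSpace ℝ (Fin d)) := {x | 1 ≤ ‖x‖ ∧ ‖‖x‖⁻¹ • x - x₀‖ < ε} with hS
  have hSm : MeasurableSet S := by
    apply MeasurableSet.inter
    · exact measurableSet_le measurable_const measurable_norm
    · exact measurableSet_lt (((measurable_norm.inv.smul measurable_id).sub_const x₀).norm)
        measurable_const
  have hx0S : x₀ ∈ S := by simp [hS, h0, hε]
  have hgrad : ∀ x y, ‖gradient μ x - gradient μ y‖ = ‖fderiv ℝ μ x - fderiv ℝ μ y‖ := by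
    intro x y
    unfold gradient
    rw [← map_sub, LinearIsometryEquiv.norm_map]
  have hfinite : ∫⁻ x : EuclideanSpace ℝ (Fin d), ENNReal.ofReal ((1 + ‖x‖) ^ (-N)) < ⊤ :=
    finite_integral_one_add_norm (by simpa using hN)
  refine lt_of_le_of_lt (b := ENNReal.ofReal ((1 + 3 / c) ^ N) *
    ∫⁻ x : EuclideanSpace ℝ (Fin d), ENNReal.ofReal ((1 + ‖x‖) ^ (-N))) ?_
    (ENNReal.mul_lt_top ENNReal.ofReal_lt_top hfinite)
  refine iSup_le fun ξ => ?_
  obtain ⟨y, hyS, hy⟩ : ∃ y ∈ S, ∀ x ∈ S, ‖ξ - gradient μ y‖ ≤ ‖ξ - gradient μ x‖ + 1 := by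
    set T := (fun x => ‖ξ - gradient μ x‖) '' S
    have hne : T.Nonempty := ⟨_, x₀, hx0S, rfl⟩
    have hbd : BddBelow T := ⟨0, by rintro _ ⟨x, -, rfl⟩; exact norm_nonneg _⟩
    obtain ⟨_, ⟨y, hyS, rfl⟩, hy⟩ := exists_lt_of_csInf_lt hne (lt_add_one (sInf T))
    refine ⟨y, hyS, fun x hx => ?_⟩
    have := csInf_le hbd ⟨x, hx, rfl⟩
    simp only at hy this
    linarith
  calc ∫⁻ x in S, ENNReal.ofReal ((1 + ‖ξ - gradient μ x‖ ^ 2) ^ (-(N / 2)))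
      ≤ ∫⁻ x in S, ENNReal.ofReal ((1 + 3 / c) ^ N) * ENNReal.ofReal ((1 + ‖x - y‖) ^ (-N)) := by
        refine setLIntegral_mono' hSm fun x hx => ?_
        rw [← ENNReal.ofReal_mul (by positivity)]
        refine ENNReal.ofReal_le_ofReal
          (bracket_bound c _ _ N hc (norm_nonneg _) (norm_nonneg _) hN0 ?_)
        have h1 := hanti x y hx.1 hx.2 hyS.1 hyS.2
        rw [← hgrad] at h1
        have h2 : ‖gradient μ x - gradient μ y‖ ≤ ‖ξ - gradient μ y‖ + ‖ξ - gradient μ x‖ := by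
          have : gradient μ x - gradient μ y = (ξ - gradient μ y) - (ξ - gradient μ x) := by abel
          rw [this]; exact norm_sub_le _ _
        have h3 := hy x hx
        linarith
    _ ≤ ∫⁻ x, ENNReal.ofReal ((1 + 3 / c) ^ N) * ENNReal.ofReal ((1 + ‖x - y‖) ^ (-N)) :=
        setLIntegral_le_lintegral _ _
    _ = ENNReal.ofReal ((1 + 3 / c) ^ N) * ∫⁻ x, ENNReal.ofReal ((1 + ‖x - y‖) ^ (-N)) :=
        lintegral_const_mul' _ _ ENNReal.ofReal_ne_top
    _ = _ := by
        rw [lintegral_sub_right_eq_self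
          (fun x : EuclideanSpace ℝ (Fin d) => ENNReal.ofReal ((1 + ‖x‖) ^ (-N))) y]
end
end

section
/- Let Q be a real symmetric d×d matrix with det Q = 0, and set μ_Q(x) := (1/2) x·Qx and F(x) := e^{2πi μ_Q(x)}. Then there exists a nonzero Schwartz function g : ℝ^d → ℂ such that ∫_{ℝ^d} |V_g F(x,ξ)| dx = ∞ for every ξ ∈ ℝ^d. (In particular F ∉ M^{1,∞}(ℝ^d), so invertibility of the Hessian is necessary in the main theorem.) -/
open MeasureTheory Real Complex
open scoped ENNReal RealInnerProductSpace

noncomputable section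

lemma aux_iter {E : Type*} [NormedAddCommGroup E] [NormedSpace ℝ E] (q : E → ℂ)
    (hq : q.HasTemperateGrowth) (n : ℕ) :
    ∃ (k : ℕ) (C : ℝ), 0 ≤ C ∧ ∀ m ≤ n, ∀ x,
      ‖iteratedFDeriv ℝ m (fun x => Complex.exp (q x)) x‖
        ≤ C * (1 + ‖x‖) ^ k * ‖Complex.exp (q x)‖ := by
  have hexp : ContDiff ℝ ((⊤ : ℕ∞) : WithTop ℕ∞) (fun x => Complex.exp (q x)) := hq.1.cexp
  have hdq : Differentiable ℝ q := hq.1.differentiable (by simp)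
  have hfd : fderiv ℝ (fun x => Complex.exp (q x))
      = fun x => Complex.exp (q x) • fderiv ℝ q x := by
    funext x
    exact ((hdq x).hasFDerivAt.cexp).fderiv
  have hq' : ContDiff ℝ ((⊤ : ℕ∞) : WithTop ℕ∞) (fderiv ℝ q) := hq.1.fderiv_right (by simp)
  induction n with
  | zero =>
    refine ⟨0, 1, by norm_num, fun m hm x => ?_⟩
    obtain rfl : m = 0 := by omega
    simp
  | succ n ih =>
    obtain ⟨k, C, hC, h⟩ := ih
    obtain ⟨k', C', hC', h'⟩ := hq.norm_iteratedFDeriv_le_uniform (n + 1)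
    refine ⟨k + k', C + ∑ i ∈ Finset.range (n + 1), (n.choose i : ℝ) * C * C', by positivity,
      fun m hm x => ?_⟩
    have h1 : (1 : ℝ) ≤ 1 + ‖x‖ := by simp
    rcases Nat.lt_or_ge n m with hlt | hle
    · obtain rfl : m = n + 1 := by omega
      rw [← norm_iteratedFDeriv_fderiv, hfd]
      refine (norm_iteratedFDeriv_smul_le hexp hq' x
        (by exact_mod_cast le_top)).trans ?_
      calc _ ≤ ∑ i ∈ Finset.range (n + 1), (n.choose i : ℝ) * C * C' *
              (1 + ‖x‖) ^ (k + k') * ‖Complex.exp (q x)‖ := by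
            refine Finset.sum_le_sum fun i hi => ?_
            have hi' : i < n + 1 := Finset.mem_range.1 hi
            rw [norm_iteratedFDeriv_fderiv]
            have e1 := h i (by omega) x
            have e2 := h' (n - i + 1) (by omega) x
            calc _ ≤ (n.choose i : ℝ) * (C * (1 + ‖x‖) ^ k * ‖Complex.exp (q x)‖)
                  * (C' * (1 + ‖x‖) ^ k') := by gcongr
              _ = _ := by ring
        _ = (∑ i ∈ Finset.range (n + 1), (n.choose i : ℝ) * C * C') *
              (1 + ‖x‖) ^ (k + k') * ‖Complex.exp (q x)‖ := by
            rw [Finset.sum_mul, Finset.sum_mul]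
        _ ≤ _ := by
            gcongr
            linarith
    · refine (h m hle x).trans ?_
      have : (1 + ‖x‖) ^ k ≤ (1 + ‖x‖) ^ (k + k') := pow_le_pow_right₀ h1 (by omega)
      have h3 : 0 ≤ ∑ i ∈ Finset.range (n + 1), (n.choose i : ℝ) * C * C' := by positivity
      gcongr
      linarith

lemma aux_decay (N : ℕ) (r : ℝ) (hr : 0 ≤ r) :
    (1 + r) ^ N * Real.exp (-Real.pi * r ^ 2) ≤ N.factorial * Real.exp 2 := by
  have h1 := Real.pow_div_factorial_le_exp (x := 1 + r) (by linarith) N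
  have hf : (0 : ℝ) < N.factorial := by positivity
  rw [div_le_iff₀ hf] at h1
  have h2 : Real.exp (1 + r) * Real.exp (-Real.pi * r ^ 2) ≤ Real.exp 2 := by
    rw [← Real.exp_add]
    apply Real.exp_le_exp.2
    nlinarith [Real.pi_gt_three, sq_nonneg (r - 1), sq_nonneg r]
  calc _ ≤ Real.exp (1 + r) * N.factorial * Real.exp (-Real.pi * r ^ 2) := by gcongr
    _ = N.factorial * (Real.exp (1 + r) * Real.exp (-Real.pi * r ^ 2)) := by ring
    _ ≤ _ := by gcongr

lemma aux_schwartz {E : Type*} [NormedAddCommGroup E] [NormedSpace ℝ E] (q : E → ℂ)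
    (hq : q.HasTemperateGrowth) (hre : ∀ x, (q x).re = -Real.pi * ‖x‖ ^ 2) :
    ∃ g : SchwartzMap E ℂ, ∀ x, g x = Complex.exp (q x) := by
  refine ⟨⟨fun x => Complex.exp (q x), hq.1.cexp, fun k n => ?_⟩, fun x => rfl⟩
  obtain ⟨m, C, hC, h⟩ := aux_iter q hq n
  refine ⟨C * ((k + m).factorial * Real.exp 2), fun x => ?_⟩
  have h1 := h n le_rfl x
  rw [Complex.norm_exp, hre] at h1
  have h2 := aux_decay (k + m) ‖x‖ (norm_nonneg x)
  calc _ ≤ (1 + ‖x‖) ^ k * (C * (1 + ‖x‖) ^ m * Real.exp (-Real.pi * ‖x‖ ^ 2)) := by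
        gcongr
        linarith
    _ = C * ((1 + ‖x‖) ^ (k + m) * Real.exp (-Real.pi * ‖x‖ ^ 2)) := by ring
    _ ≤ _ := by gcongr

lemma aux_lintegral {d : ℕ}
    (L : EuclideanSpace ℝ (Fin d) →L[ℝ] EuclideanSpace ℝ (Fin d))
    (v : EuclideanSpace ℝ (Fin d)) (hv : v ≠ 0) (hLv : L v = 0) (ξ : EuclideanSpace ℝ (Fin d)) :
    ∫⁻ x, ENNReal.ofReal (Real.exp (-Real.pi * ‖L x - ξ‖ ^ 2)) = ⊤ := by
  obtain ⟨w, hw, hLw⟩ : ∃ w : EuclideanSpace ℝ (Fin d), 2 ≤ ‖w‖ ∧ L w = 0 := by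
    refine ⟨(2 / ‖v‖) • v, ?_, by simp [hLv]⟩
    have : ‖v‖ ≠ 0 := norm_ne_zero_iff.2 hv
    rw [norm_smul]
    simp [this]
  set S : ℕ → Set (EuclideanSpace ℝ (Fin d)) := fun n => Metric.ball ((n : ℝ) • w) 1 with hS
  have hdisj : Pairwise (Function.onFun Disjoint S) := by
    intro m n hmn
    apply Metric.ball_disjoint_ball
    rw [dist_eq_norm, ← sub_smul, norm_smul]
    have h1 : (1 : ℝ) ≤ ‖(m : ℝ) - n‖ := by
      have : (1 : ℤ) ≤ |(m : ℤ) - n| := Int.one_le_abs (by omega)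
      rw [Real.norm_eq_abs]
      exact_mod_cast this
    nlinarith
  have hvol : volume (⋃ n, S n) = ⊤ := by
    rw [measure_iUnion hdisj (fun n => Metric.isOpen_ball.measurableSet)]
    have : ∀ n, volume (S n) = volume (Metric.ball (0 : EuclideanSpace ℝ (Fin d)) 1) := fun n =>
      Measure.addHaar_ball_center _ _ _
    simp_rw [this]
    exact ENNReal.tsum_const_eq_top_of_ne_zero (Metric.measure_ball_pos _ _ one_pos).ne'
  set c := Real.exp (-Real.pi * (‖L‖ + ‖ξ‖) ^ 2) with hc
  have hb : ∀ x ∈ ⋃ n, S n, c ≤ Real.exp (-Real.pi * ‖L x - ξ‖ ^ 2) := by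
    intro x hx
    obtain ⟨n, hn⟩ := Set.mem_iUnion.1 hx
    have hn' : ‖x - (n : ℝ) • w‖ < 1 := by simpa [hS, dist_eq_norm] using hn
    have e : L x = L (x - (n : ℝ) • w) := by simp [hLw]
    have h1 : ‖L x - ξ‖ ≤ ‖L‖ + ‖ξ‖ := by
      refine (norm_sub_le _ _).trans ?_
      gcongr
      rw [e]
      refine (L.le_opNorm _).trans ?_
      nlinarith [norm_nonneg L]
    apply Real.exp_le_exp.2
    have : ‖L x - ξ‖ ^ 2 ≤ (‖L‖ + ‖ξ‖) ^ 2 := by gcongr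
    nlinarith [Real.pi_pos]
  rw [eq_top_iff]
  have hm : MeasurableSet (⋃ n, S n) :=
    MeasurableSet.iUnion fun n => Metric.isOpen_ball.measurableSet
  calc (⊤ : ℝ≥0∞) = ENNReal.ofReal c * volume (⋃ n, S n) := by
        rw [hvol, ENNReal.mul_top]
        simp [hc, Real.exp_pos]
    _ = ∫⁻ x in ⋃ n, S n, ENNReal.ofReal c := by rw [setLIntegral_const]
    _ ≤ ∫⁻ x in ⋃ n, S n, ENNReal.ofReal (Real.exp (-Real.pi * ‖L x - ξ‖ ^ 2)) :=
        setLIntegral_mono' hm fun x hx => ENNReal.ofReal_le_ofReal (hb x hx)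
    _ ≤ _ := setLIntegral_le_lintegral _ _

/-- Let `Q` be a real symmetric `d×d` matrix with `det Q = 0`, and let
`F(x) = e^{2πi μ_Q(x)}` with `μ_Q(x) = (1/2) x·Qx`. Then there is a nonzero Schwartz window
`g` such that `∫ |V_g F(x,ξ)| dx = ∞` for every `ξ`; in particular `F ∉ M^{1,∞}(ℝ^d)`,
so the invertibility of the Hessian is necessary. -/
theorem degenerate_quadratic_not_M1inf (d : ℕ) (Q : Matrix (Fin d) (Fin d) ℝ)
    (hQ : Q.IsSymm) (hdet : Q.det = 0)
    (μQ : EuclideanSpace ℝ (Fin d) → ℝ)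
    (hμQ : ∀ x : EuclideanSpace ℝ (Fin d),
      μQ x = (1 / 2) * ∑ i : Fin d, ∑ j : Fin d, Q i j * x i * x j)
    (F : EuclideanSpace ℝ (Fin d) → ℂ)
    (hF : ∀ x : EuclideanSpace ℝ (Fin d),
      F x = Complex.exp (((2 * Real.pi * μQ x : ℝ) : ℂ) * Complex.I)) :
    ∃ g : SchwartzMap (EuclideanSpace ℝ (Fin d)) ℂ, g ≠ 0 ∧
      ∀ ξ : EuclideanSpace ℝ (Fin d),
        (∫⁻ x : EuclideanSpace ℝ (Fin d),
          (‖∫ (y : EuclideanSpace ℝ (Fin d)),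
              Complex.exp (-(((2 * Real.pi * ⟪ξ, y⟫ : ℝ) : ℂ) * Complex.I)) * F y *
                (starRingEnd ℂ) (g (y - x))‖₊ : ℝ≥0∞) ∂volume) = ⊤ := by
  classical
  set L : EuclideanSpace ℝ (Fin d) →L[ℝ] EuclideanSpace ℝ (Fin d) :=
    Matrix.toEuclideanCLM (𝕜 := ℝ) Q with hL
  have hLi : ∀ x i, (L x) i = ∑ j, Q i j * x j := by
    intro x i
    simp [hL, Matrix.mulVec, dotProduct]
  obtain ⟨v, hv, hLv⟩ : ∃ v, v ≠ 0 ∧ L v = 0 := by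
    obtain ⟨v, hv, hQv⟩ := Matrix.exists_mulVec_eq_zero_iff.2 hdet
    refine ⟨WithLp.toLp 2 v, by simpa using hv, ?_⟩
    ext i
    rw [hLi]
    simpa [Matrix.mulVec, dotProduct] using congrFun hQv i
  have hμL : ∀ x, μQ x = (1 / 2) * ⟪L x, x⟫ := by
    intro x
    rw [hμQ]
    simp only [PiLp.inner_apply, hLi, RCLike.inner_apply, conj_trivial, Finset.mul_sum]
    refine Finset.sum_congr rfl fun i _ => Finset.sum_congr rfl fun j _ => ?_
    ring
  have hsymm : ∀ x y, ⟪L x, y⟫ = ⟪L y, x⟫ := by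
    intro x y
    simp only [PiLp.inner_apply, hLi, RCLike.inner_apply, conj_trivial, Finset.mul_sum]
    rw [Finset.sum_comm]
    refine Finset.sum_congr rfl fun i _ => Finset.sum_congr rfl fun j _ => ?_
    rw [hQ.apply]
    ring
  have hadd : ∀ t x, μQ (t + x) = μQ t + μQ x + ⟪L x, t⟫ := by
    intro t x
    simp only [hμL, map_add, inner_add_left, inner_add_right, hsymm t x]
    ring
  have htμ : μQ.HasTemperateGrowth := by
    have hco : ∀ i, (fun x : EuclideanSpace ℝ (Fin d) => x i).HasTemperateGrowth := fun i =>
      (EuclideanSpace.proj (𝕜 := ℝ) i).hasTemperateGrowth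
    have : μQ = fun x => (1 / 2) * ∑ i : Fin d, ∑ j : Fin d, Q i j * x i * x j := funext hμQ
    rw [this]
    refine (Function.HasTemperateGrowth.const _).mul ?_
    refine Function.HasTemperateGrowth.sum fun i _ => ?_
    refine Function.HasTemperateGrowth.sum fun j _ => ?_
    exact ((Function.HasTemperateGrowth.const _).mul (hco i)).mul (hco j)
  set q : EuclideanSpace ℝ (Fin d) → ℂ := fun x =>
    ((-Real.pi * ‖x‖ ^ 2 : ℝ) : ℂ) + ((2 * Real.pi * μQ x : ℝ) : ℂ) * Complex.I with hq
  have htq : q.HasTemperateGrowth := by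
    have h1 : (fun x : EuclideanSpace ℝ (Fin d) => -Real.pi * ‖x‖ ^ 2).HasTemperateGrowth :=
      (Function.HasTemperateGrowth.const _).mul (by fun_prop)
    have h2 : (fun x : EuclideanSpace ℝ (Fin d) => 2 * Real.pi * μQ x).HasTemperateGrowth :=
      (Function.HasTemperateGrowth.const _).mul htμ
    exact (Function.Complex.hasTemperateGrowth_ofReal.comp h1).add
      ((Function.Complex.hasTemperateGrowth_ofReal.comp h2).mul (Function.HasTemperateGrowth.const _))
  obtain ⟨g, hg⟩ := aux_schwartz q htq (fun x => by simp [hq, ← Complex.ofReal_pow])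
  refine ⟨g, ?_, fun ξ => ?_⟩
  · intro h0
    have := hg 0
    rw [h0] at this
    exact Complex.exp_ne_zero _ this.symm
  rw [← aux_lintegral L v hv hLv ξ]
  refine lintegral_congr fun x => ?_
  rw [← enorm_eq_nnnorm, ← ofReal_norm]
  congr 1
  rw [← integral_add_right_eq_self _ x]
  have key : ∀ t : EuclideanSpace ℝ (Fin d),
      Complex.exp (-(((2 * Real.pi * ⟪ξ, t + x⟫ : ℝ) : ℂ) * Complex.I)) * F (t + x) *
                (starRingEnd ℂ) (g (t + x - x)) =
      Complex.exp (((2 * Real.pi * (μQ x - ⟪ξ, x⟫) : ℝ) : ℂ) * Complex.I) *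
        Complex.exp (-(Real.pi : ℂ) * ‖t‖ ^ 2 + (2 * Real.pi * Complex.I) * ⟪L x - ξ, t⟫) := by
    intro t
    rw [hF, add_sub_cancel_right, hg, ← Complex.exp_conj, ← Complex.exp_add, ← Complex.exp_add,
      ← Complex.exp_add, hadd, hq]
    congr 1
    simp only [map_add, map_mul, Complex.conj_ofReal, Complex.conj_I, inner_add_right,
      inner_sub_left]
    push_cast
    ring
  simp_rw [key]
  rw [integral_const_mul, norm_mul, Complex.norm_exp_ofReal_mul_I, one_mul,
    GaussianFourier.integral_cexp_neg_mul_sq_norm_add (by simpa using Real.pi_pos)]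
  have hpi : (Real.pi : ℂ) ≠ 0 := by exact_mod_cast Real.pi_ne_zero
  rw [div_self hpi, Complex.one_cpow, one_mul]
  have : (2 * (Real.pi : ℂ) * Complex.I) ^ 2 * ‖L x - ξ‖ ^ 2 / (4 * Real.pi)
      = ((-Real.pi * ‖L x - ξ‖ ^ 2 : ℝ) : ℂ) := by
    rw [mul_pow, Complex.I_sq]
    push_cast
    field_simp
    ring
  rw [this, Complex.norm_exp_ofReal]
end
end
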